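/- Let K be a finite 2-dimensional geometric simplicial complex in ℝⁿ with at least one face. Then the space |K| is homeomorphic to the closed unit disk {x ∈ ℝ² : ‖x‖ ≤ 1} if and only if |K| is connected, K is locally planar, K has at least one boundary edge, and χ(K) = 1. -/

import Mathlib

open Geometry

namespace PaperAlg

/-- Points of `ℝⁿ`. -/
abbrev Pt (n : ℕ) := EuclideanSpace ℝ (Fin n)

variable {n : ℕ}

/-- The 1-skeleton graph of a geometric simplicial complex `K`: its vertex set is the set of
vertices of `K`, and two vertices are adjacent iff they form an edge (a two-element face) of `K`. -/
def skeletonGraph (K : SimplicialComplex ℝ (Pt n)) : SimpleGraph K.vertices where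
  Adj u v := (u : Pt n) ≠ (v : Pt n) ∧
    ∃ s ∈ K.faces, (s : Set (Pt n)) = {(u : Pt n), (v : Pt n)}
  symm := by
    constructor
    rintro u v ⟨hne, s, hs, hset⟩
    exact ⟨fun h => hne h.symm, s, hs, by rw [hset, Set.pair_comm]⟩
  loopless := by constructor; rintro u ⟨hne, -⟩; exact hne rfl

/-- `K` is 2-dimensional: every face has at most three elements. -/
def TwoDimensional (K : SimplicialComplex ℝ (Pt n)) : Prop :=
  ∀ s ∈ K.faces, s.card ≤ 3

/-- The set of triangles (three-element faces) of `K` containing the finset `e`. -/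
def trianglesContaining (K : SimplicialComplex ℝ (Pt n)) (e : Finset (Pt n)) :
    Set (Finset (Pt n)) :=
  {t | t ∈ K.faces ∧ t.card = 3 ∧ e ⊆ t}

/-- An edge of `K` contained in exactly one triangle. -/
def IsBoundaryEdge (K : SimplicialComplex ℝ (Pt n)) (e : Finset (Pt n)) : Prop :=
  e ∈ K.faces ∧ e.card = 2 ∧ (trianglesContaining K e).ncard = 1

/-- An edge of `K` contained in exactly two triangles. -/
def IsInteriorEdge (K : SimplicialComplex ℝ (Pt n)) (e : Finset (Pt n)) : Prop :=
  e ∈ K.faces ∧ e.card = 2 ∧ (trianglesContaining K e).ncard = 2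

/-- The closed upper half-plane `{(a, b) ∈ ℝ² : b ≥ 0}`. -/
def HalfPlane : Set (ℝ × ℝ) := {p | 0 ≤ p.2}

/-- `x` has a neighborhood in `|K|` homeomorphic to an open subset of `ℝ²`. -/
def HasPlanarNbhd (K : SimplicialComplex ℝ (Pt n)) (x : Pt n) : Prop :=
  ∃ U : Set (Pt n), U ⊆ K.space ∧ U ∈ nhdsWithin x K.space ∧
    ∃ V : Set (ℝ × ℝ), IsOpen V ∧ Nonempty (↥U ≃ₜ ↥V)

/-- `x` has a neighborhood in `|K|` homeomorphic to an open subset of the closed half-plane. -/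
def HasHalfPlanarNbhd (K : SimplicialComplex ℝ (Pt n)) (x : Pt n) : Prop :=
  ∃ U : Set (Pt n), U ⊆ K.space ∧ U ∈ nhdsWithin x K.space ∧
    ∃ V : Set ↥HalfPlane, IsOpen V ∧ Nonempty (↥U ≃ₜ ↥V)

/-- `x` is a locally planar point of `|K|`. -/
def IsLocallyPlanarPt (K : SimplicialComplex ℝ (Pt n)) (x : Pt n) : Prop :=
  x ∈ K.space ∧ (HasPlanarNbhd K x ∨ HasHalfPlanarNbhd K x)

/-- `K` is locally planar if every point of `|K|` is locally planar. -/
def LocallyPlanar (K : SimplicialComplex ℝ (Pt n)) : Prop :=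
  ∀ x ∈ K.space, IsLocallyPlanarPt K x

/-- The vertices `a` of `K` such that `{v, a}` is an edge of `K`. -/
def linkVertices (K : SimplicialComplex ℝ (Pt n)) (v : Pt n) : Set (Pt n) :=
  {a | a ≠ v ∧ ∃ s ∈ K.faces, (s : Set (Pt n)) = {v, a}}

/-- The link graph `L(v)`: vertices are the `a` with `{v, a}` an edge of `K`, and `a`, `b`
are adjacent iff `{v, a, b}` is a triangle of `K`. -/
def linkGraph (K : SimplicialComplex ℝ (Pt n)) (v : Pt n) :
    SimpleGraph (linkVertices K v) where
  Adj a b := (a : Pt n) ≠ (b : Pt n) ∧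
    ∃ t ∈ K.faces, t.card = 3 ∧ (t : Set (Pt n)) = {v, (a : Pt n), (b : Pt n)}
  symm := by
    constructor
    rintro a b ⟨hne, t, ht, hc, hset⟩
    exact ⟨fun h => hne h.symm, t, ht, hc, by rw [hset, Set.pair_comm]⟩
  loopless := by constructor; rintro a ⟨hne, -⟩; exact hne rfl

/-- The vertices of `K` lying on some boundary edge. -/
def boundaryVertices (K : SimplicialComplex ℝ (Pt n)) : Set (Pt n) :=
  {v | ∃ e, IsBoundaryEdge K e ∧ v ∈ e}

/-- The boundary graph of `K`: the simple graph formed by the boundary edges of `K`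
and their endpoints. -/
def boundaryGraph (K : SimplicialComplex ℝ (Pt n)) :
    SimpleGraph (boundaryVertices K) where
  Adj u v := (u : Pt n) ≠ (v : Pt n) ∧
    ∃ e, IsBoundaryEdge K e ∧ (e : Set (Pt n)) = {(u : Pt n), (v : Pt n)}
  symm := by
    constructor
    rintro u v ⟨hne, e, he, hset⟩
    exact ⟨fun h => hne h.symm, e, he, by rw [hset, Set.pair_comm]⟩
  loopless := by constructor; rintro u ⟨hne, -⟩; exact hne rfl

/-- The Euler characteristic `χ(K) = V - E + F`. -/
noncomputable def eulerChar (K : SimplicialComplex ℝ (Pt n)) : ℤ :=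
  (K.vertices.ncard : ℤ)
    - ({e : Finset (Pt n) | e ∈ K.faces ∧ e.card = 2}.ncard : ℤ)
    + ({t : Finset (Pt n) | t ∈ K.faces ∧ t.card = 3}.ncard : ℤ)

/-- The three directed edges induced on its boundary by the cyclic ordering `(a, b, c)`. -/
def triDirs (o : Pt n × Pt n × Pt n) : Set (Pt n × Pt n) :=
  {(o.1, o.2.1), (o.2.1, o.2.2), (o.2.2, o.1)}

/-- `K` is orientable: one can assign to each triangle a cyclic ordering of its vertices so
that the two triangles containing any interior edge induce opposite directions on it. -/
def Orientable (K : SimplicialComplex ℝ (Pt n)) : Prop :=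
  ∃ ori : Finset (Pt n) → Pt n × Pt n × Pt n,
    (∀ t ∈ K.faces, t.card = 3 →
      (t : Set (Pt n)) = {(ori t).1, (ori t).2.1, (ori t).2.2}) ∧
    (∀ t₁ ∈ K.faces, ∀ t₂ ∈ K.faces, t₁.card = 3 → t₂.card = 3 → t₁ ≠ t₂ →
      ∀ e ∈ K.faces, e.card = 2 → e ⊆ t₁ → e ⊆ t₂ →
      ∀ x y : Pt n, x ∈ e → y ∈ e → x ≠ y →
        (x, y) ∈ triDirs (ori t₁) → (y, x) ∈ triDirs (ori t₂))

/-- The genus of a topological space `X`: the supremum of the numbers `m` for which there exist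
`m` pairwise disjoint subsets of `X`, each homeomorphic to the circle `S¹`, whose union has
connected complement. -/
noncomputable def genus (X : Type*) [TopologicalSpace X] : ℕ :=
  sSup {m : ℕ | ∃ C : Fin m → Set X,
    (Pairwise fun i j => Disjoint (C i) (C j)) ∧
    (∀ i, Nonempty (↥(C i) ≃ₜ ↥(Metric.sphere (0 : EuclideanSpace ℝ (Fin 2)) 1))) ∧
    IsConnected (⋃ i, C i)ᶜ}

section Part1
open Set Topology Filter

/-- Continuous logarithms on star-convex sets. -/
lemma exists_log_star {E : Type*} [NormedAddCommGroup E] [NormedSpace ℝ E] {s : Set E} {x0 : E}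
    (hs : StarConvex ℝ x0 s) (hx0 : x0 ∈ s) (f : E → ℂ) (hf : ContinuousOn f s)
    (h0 : ∀ x ∈ s, f x ≠ 0) :
    ∃ h : E → ℂ, ContinuousOn h s ∧ ∀ x ∈ s, f x = Complex.exp (h x) := by
  classical
  let H : C(unitInterval × s, {z : ℂ // z ≠ 0}) :=
    { toFun := fun p => ⟨f (x0 + (p.1 : ℝ) • ((p.2 : E) - x0)),
        h0 _ (hs.add_smul_sub_mem p.2.2 p.1.2.1 p.1.2.2)⟩
      continuous_toFun := by
        refine Continuous.subtype_mk ?_ _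
        refine hf.comp_continuous (by fun_prop) ?_
        intro p; exact hs.add_smul_sub_mem p.2.2 p.1.2.1 p.1.2.2 }
  let c : C(s, ℂ) := ContinuousMap.const _ (Complex.log (f x0))
  have H0 : ∀ a, H (0, a) = (⟨_, (c a).exp_ne_zero⟩ : {z : ℂ // z ≠ 0}) := by
    intro a
    apply Subtype.ext
    simp [H, c, Complex.exp_log (h0 _ hx0)]
  let L := Complex.isCoveringMap_exp.liftHomotopy H c H0
  have hL := Complex.isCoveringMap_exp.liftHomotopy_lifts H c H0
  refine ⟨fun x => if hx : x ∈ s then L (1, ⟨x, hx⟩) else 0, ?_, ?_⟩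
  · rw [continuousOn_iff_continuous_domRestrict]
    have : s.domRestrict (fun x => if hx : x ∈ s then L (1, ⟨x, hx⟩) else 0) = fun x : s => L (1, x) := by
      ext x; simp [Set.domRestrict]
    rw [this]; fun_prop
  · intro x hx
    have := congrArg Subtype.val (congr_fun hL (1, ⟨x, hx⟩))
    simp only [hx, dif_pos]
    simp only [Function.comp] at this
    rw [this]; simp [H]

def LocPC (X : Type*) [TopologicalSpace X] (x : X) : Prop :=
  ∀ N ∈ 𝓝 x, ∃ W ∈ 𝓝 x, W ⊆ N ∧ IsPreconnected (W \ {x}) ∧ (W \ {x}).Nonempty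

def LogRk (X : Type*) [TopologicalSpace X] (x : X) : Prop :=
  ∀ N ∈ 𝓝 x, ∀ f g : X → ℂ, ContinuousOn f (N \ {x}) → ContinuousOn g (N \ {x}) →
    (∀ y ∈ N \ {x}, f y ≠ 0 ∧ g y ≠ 0) →
    ∃ W ∈ 𝓝 x, W ⊆ N ∧ ∃ p q : ℤ, (p ≠ 0 ∨ q ≠ 0) ∧ ∃ h : X → ℂ, ContinuousOn h (W \ {x}) ∧
      ∀ y ∈ W \ {x}, f y ^ p * g y ^ q = Complex.exp (h y)

section transfer
variable {X Y : Type*} [TopologicalSpace X] [TopologicalSpace Y]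

lemma oph_aux (φ : OpenPartialHomeomorph X Y) {x : X} (hx : x ∈ φ.source) {W : Set Y} (hW : W ⊆ φ.target) :
    φ.symm '' (W \ {φ x}) = (φ.symm '' W) \ {x} := by
  ext z; constructor
  · rintro ⟨y, ⟨hy, hne⟩, rfl⟩
    refine ⟨⟨y, hy, rfl⟩, fun h => hne ?_⟩
    simp only [mem_singleton_iff] at h ⊢
    rw [← h, φ.right_inv (hW hy)]
  · rintro ⟨⟨y, hy, rfl⟩, hne⟩
    refine ⟨y, ⟨hy, fun h => hne ?_⟩, rfl⟩
    simp only [mem_singleton_iff] at h ⊢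
    rw [h, φ.left_inv hx]

lemma oph_nhds (φ : OpenPartialHomeomorph X Y) {x : X} (hx : x ∈ φ.source) {W : Set Y}
    (hW : W ∈ 𝓝 (φ x)) : φ.symm '' W ∈ 𝓝 x := by
  have := φ.symm.image_mem_nhds (x := φ x) (φ.map_source hx) hW
  rwa [φ.left_inv hx] at this

lemma LocPC.transfer (φ : OpenPartialHomeomorph X Y) {x : X} (hx : x ∈ φ.source)
    (h : LocPC Y (φ x)) : LocPC X x := by
  intro N hN
  obtain ⟨W, hW, hWN, hc, hne⟩ := h (φ.target ∩ φ.symm ⁻¹' N) (by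
    refine inter_mem (φ.open_target.mem_nhds (φ.map_source hx)) ?_
    exact (φ.continuousAt_symm (φ.map_source hx)).preimage_mem_nhds (by rwa [φ.left_inv hx]))
  have hWt : W ⊆ φ.target := hWN.trans inter_subset_left
  refine ⟨φ.symm '' W, oph_nhds φ hx hW, ?_, ?_, ?_⟩
  · rintro _ ⟨y, hy, rfl⟩; exact (hWN hy).2
  · rw [← oph_aux φ hx hWt]
    exact hc.image _ (φ.continuousOn_symm.mono (sdiff_subset.trans hWt))
  · rw [← oph_aux φ hx hWt]; exact hne.image _

lemma LogRk.transfer (φ : OpenPartialHomeomorph X Y) {x : X} (hx : x ∈ φ.source)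
    (h : LogRk Y (φ x)) : LogRk X x := by
  intro N hN f g hf hg h0
  have hm : ∀ y ∈ (φ.target ∩ φ.symm ⁻¹' N) \ {φ x}, φ.symm y ∈ N \ {x} := by
    rintro y ⟨⟨hy, hyN⟩, hne⟩
    refine ⟨hyN, fun h => hne ?_⟩
    simp only [mem_singleton_iff] at h ⊢
    rw [← h, φ.right_inv hy]
  have hcs : ContinuousOn φ.symm ((φ.target ∩ φ.symm ⁻¹' N) \ {φ x}) :=
    φ.continuousOn_symm.mono (sdiff_subset.trans inter_subset_left)
  obtain ⟨W, hW, hWN, p, q, hpq, k, hk, hkk⟩ := h (φ.target ∩ φ.symm ⁻¹' N) (by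
    refine inter_mem (φ.open_target.mem_nhds (φ.map_source hx)) ?_
    exact (φ.continuousAt_symm (φ.map_source hx)).preimage_mem_nhds (by rwa [φ.left_inv hx]))
    (f ∘ φ.symm) (g ∘ φ.symm) (hf.comp hcs hm) (hg.comp hcs hm) (fun y hy => h0 _ (hm y hy))
  have hWt : W ⊆ φ.target := hWN.trans inter_subset_left
  refine ⟨φ.symm '' W, oph_nhds φ hx hW, ?_, p, q, hpq, k ∘ φ, ?_, ?_⟩
  · rintro _ ⟨y, hy, rfl⟩; exact (hWN hy).2
  · refine hk.comp (φ.continuousOn.mono ?_) ?_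
    · rw [← oph_aux φ hx hWt]
      rintro _ ⟨y, hy, rfl⟩; exact φ.map_target (hWt hy.1)
    · rw [← oph_aux φ hx hWt]
      rintro _ ⟨y, hy, rfl⟩; rw [φ.right_inv (hWt hy.1)]; exact hy
  · rw [← oph_aux φ hx hWt]
    rintro _ ⟨y, hy, rfl⟩
    have := hkk y hy
    simpa [φ.right_inv (hWt hy.1)] using this

end transfer

lemma real_int_const {α : Type*} [TopologicalSpace α] {h : α → ℝ} {s : Set α}
    (hs : IsPreconnected s) (hc : ContinuousOn h s)
    (hi : ∀ x ∈ s, ∃ k : ℤ, h x = k) : ∀ x ∈ s, ∀ y ∈ s, h x = h y := by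
  have key : ∀ x ∈ s, ∀ y ∈ s, ¬ h x < h y := by
    intro x hx y hy hlt
    have hoc := (hs.image h hc).ordConnected
    obtain ⟨k, hk⟩ := hi x hx
    obtain ⟨l, hl⟩ := hi y hy
    have hkl : k + 1 ≤ l := by
      rw [hk, hl] at hlt; exact_mod_cast hlt
    have hkl' : (k : ℝ) + 1 ≤ l := by exact_mod_cast hkl
    obtain ⟨z, hz, hzz⟩ := hoc.out ⟨x, hx, rfl⟩ ⟨y, hy, rfl⟩ (show (k : ℝ) + 1/2 ∈ Icc (h x) (h y) by
      rw [hk, hl]; constructor <;> linarith)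
    obtain ⟨m, hm⟩ := hi z hz
    rw [hm] at hzz
    have h1 : (2 * m : ℝ) = 2 * k + 1 := by linarith
    have h2 : 2 * m = 2 * k + 1 := by exact_mod_cast h1
    omega
  intro x hx y hy
  exact le_antisymm (not_lt.1 (key y hy x hx)) (not_lt.1 (key x hx y hy))

lemma exp_one_const {α : Type*} [TopologicalSpace α] {h : α → ℂ} {s : Set α}
    (hs : IsPreconnected s) (hc : ContinuousOn h s)
    (hi : ∀ x ∈ s, Complex.exp (h x) = 1) : ∀ x ∈ s, ∀ y ∈ s, h x = h y := by
  have this : ∀ x ∈ s, ∃ k : ℤ, h x = k * (2 * Real.pi * Complex.I) := fun x hx => by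
    simpa using Complex.exp_eq_one_iff.1 (hi x hx)
  have key := real_int_const (h := fun x => (h x).im / (2 * Real.pi)) hs
    ((Complex.continuous_im.comp_continuousOn hc).div_const _) (by
      intro x hx; obtain ⟨k, hk⟩ := this x hx
      refine ⟨k, ?_⟩
      simp [hk])
  intro x hx y hy
  obtain ⟨k, hk⟩ := this x hx
  obtain ⟨l, hl⟩ := this y hy
  have := key x hx y hy
  simp [hk, hl] at this
  rw [hk, hl, this]

lemma convex_re_lt (r : ℝ) : Convex ℝ {w : ℂ | w.re < r} := convex_halfSpace_re_lt r

lemma exp_image_punct {r : ℝ} (hr : 0 < r) (y : ℂ) :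
    (fun w => y + Complex.exp w) '' {w : ℂ | w.re < Real.log r} = Metric.ball y r \ {y} := by
  ext z
  simp only [mem_image, mem_ofPred_eq, Set.mem_sdiff, Metric.mem_ball, mem_singleton_iff]
  constructor
  · rintro ⟨w, hw, rfl⟩
    refine ⟨?_, ?_⟩
    · simp [dist_eq_norm, Complex.norm_exp]
      exact (Real.lt_log_iff_exp_lt hr).1 hw
    · simp
  · rintro ⟨hz, hne⟩
    have h0 : z - y ≠ 0 := sub_ne_zero.2 hne
    refine ⟨Complex.log (z - y), ?_, by simp [Complex.exp_log h0]⟩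
    rw [Complex.log_re]
    rw [dist_eq_norm] at hz
    exact Real.log_lt_log (norm_pos_iff.2 h0) hz

lemma locPC_complex (y : ℂ) : LocPC ℂ y := by
  intro N hN
  obtain ⟨r, hr, hrN⟩ := Metric.mem_nhds_iff.1 hN
  refine ⟨_, Metric.ball_mem_nhds y hr, hrN, ?_, ?_⟩
  · rw [← exp_image_punct hr]
    exact (convex_re_lt _).isPreconnected.image _ (by fun_prop)
  · rw [← exp_image_punct hr]
    exact Set.Nonempty.image _ ⟨((Real.log r - 1 : ℝ) : ℂ), by simp⟩

lemma punct_log {r : ℝ} (hr : 0 < r) (y : ℂ) (f : ℂ → ℂ)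
    (hf : ContinuousOn f (Metric.ball y r \ {y})) (h0 : ∀ z ∈ Metric.ball y r \ {y}, f z ≠ 0) :
    ∃ k : ℤ, ∃ h : ℂ → ℂ, ContinuousOn h (Metric.ball y r \ {y}) ∧
      ∀ z ∈ Metric.ball y r \ {y}, f z = (z - y) ^ k * Complex.exp (h z) := by
  set D := {w : ℂ | w.re < Real.log r} with hD
  have himg := exp_image_punct hr y
  have hmem : ∀ w ∈ D, y + Complex.exp w ∈ Metric.ball y r \ {y} := fun w hw => by
    rw [← himg]; exact ⟨w, hw, rfl⟩
  have hw0 : ((Real.log r - 1 : ℝ) : ℂ) ∈ D := by simp [hD]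
  obtain ⟨G, hG, hGe⟩ := exists_log_star ((convex_re_lt (Real.log r)).starConvex hw0) hw0
    (fun w => f (y + Complex.exp w)) (hf.comp (by fun_prop) hmem) (fun w hw => h0 _ (hmem w hw))
  have hper : ∀ w ∈ D, w + 2 * Real.pi * Complex.I ∈ D := fun w hw => by
    simpa [hD] using hw
  have hconst := exp_one_const (h := fun w => G (w + 2 * Real.pi * Complex.I) - G w)
    (convex_re_lt (Real.log r)).isPreconnected
    ((hG.comp (by fun_prop) hper).sub hG) (by
      intro w hw
      rw [Complex.exp_sub, ← hGe _ (hper w hw), ← hGe _ hw, Complex.exp_periodic w]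
      exact div_self (h0 _ (hmem w hw)))
  obtain ⟨k, hk⟩ : ∃ k : ℤ, ∀ w ∈ D, G (w + 2 * Real.pi * Complex.I) - G w =
      k * (2 * Real.pi * Complex.I) := by
    have := (Complex.exp_eq_one_iff (x := G (((Real.log r - 1 : ℝ) : ℂ) + 2 * Real.pi * Complex.I) - G ((Real.log r - 1 : ℝ) : ℂ))).1 (by
      rw [Complex.exp_sub, ← hGe _ (hper _ hw0), ← hGe _ hw0, Complex.exp_periodic _]
      exact div_self (h0 _ (hmem _ hw0)))
    obtain ⟨k, hk⟩ := this
    exact ⟨k, fun w hw => (hconst w hw _ hw0).trans hk⟩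
  let P := fun w => G w - k * w
  have hP1 : ∀ w ∈ D, P (w + 2 * Real.pi * Complex.I) = P w := by
    intro w hw
    have := hk w hw
    simp only [P]; linear_combination this
  have hP2 : ∀ n : ℕ, ∀ w ∈ D, P (w + n * (2 * Real.pi * Complex.I)) = P w := by
    intro n
    induction n with
    | zero => intro w _; simp
    | succ n ih =>
      intro w hw
      have := ih _ (hper w hw)
      rw [hP1 w hw] at this
      rw [← this]; congr 1; push_cast; ring
  have hP : ∀ w ∈ D, ∀ w' ∈ D, Complex.exp w = Complex.exp w' → P w = P w' := by
    intro w hw w' hw' h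
    obtain ⟨n, hn⟩ := Complex.exp_eq_exp_iff_exists_int.1 h
    obtain ⟨m, rfl | rfl⟩ := n.eq_nat_or_neg
    · rw [hn]; exact_mod_cast hP2 m w' hw'
    · have : w' = w + m * (2 * Real.pi * Complex.I) := by rw [hn]; push_cast; ring
      rw [this]; exact (hP2 m w hw).symm
  have hlogD : ∀ z ∈ Metric.ball y r \ {y}, ∀ w, Complex.exp w = z - y → w ∈ D := by
    rintro z ⟨hz, hne⟩ w hw
    rw [Metric.mem_ball, dist_eq_norm, ← hw, Complex.norm_exp] at hz
    exact (Real.lt_log_iff_exp_lt hr).2 hz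
  have hDo : IsOpen D := isOpen_lt Complex.continuous_re continuous_const
  refine ⟨k, fun z => P (Complex.log (z - y)), ?_, ?_⟩
  · intro z0 hz0
    have hz0' : z0 - y ≠ 0 := sub_ne_zero.2 hz0.2
    let w0 := Complex.log (z0 - y)
    have hw0 : Complex.exp w0 = z0 - y := Complex.exp_log hz0'
    have hw0D := hlogD z0 hz0 w0 hw0
    have hPc : ContinuousAt P w0 :=
      ((hG.continuousAt (hDo.mem_nhds hw0D)).sub (by fun_prop))
    have hloc : ContinuousAt (fun z => w0 + Complex.log ((z - y) / (z0 - y))) z0 := by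
      refine continuousAt_const.add (ContinuousAt.clog (by fun_prop) ?_)
      rw [div_self hz0']; simp
    have hcomp : ContinuousAt (fun z => P (w0 + Complex.log ((z - y) / (z0 - y)))) z0 := by
      refine ContinuousAt.comp (g := P) ?_ hloc
      simpa [div_self hz0'] using hPc
    refine (hcomp.continuousWithinAt).congr ?_ ?_
    · intro z hz
      have hz' : z - y ≠ 0 := sub_ne_zero.2 hz.2
      have e1 : Complex.exp (w0 + Complex.log ((z - y) / (z0 - y))) = z - y := by
        rw [Complex.exp_add, hw0, Complex.exp_log (div_ne_zero hz' hz0')]; field_simp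
      have e2 := Complex.exp_log hz'
      exact hP _ (hlogD z hz _ e2) _ (hlogD z hz _ e1) (e2.trans e1.symm)
    · simp [div_self hz0', w0]
  · intro z hz
    have hz' : z - y ≠ 0 := sub_ne_zero.2 hz.2
    have e2 := Complex.exp_log hz'
    have := hGe _ (hlogD z hz _ e2)
    simp only [e2, add_sub_cancel] at this
    rw [this]
    simp only [P]
    rw [Complex.exp_sub, Complex.exp_int_mul, e2]
    field_simp

lemma logRk_complex (y : ℂ) : LogRk ℂ y := by
  intro N hN f g hf hg h0
  obtain ⟨r, hr, hrN⟩ := Metric.mem_nhds_iff.1 hN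
  have hs : Metric.ball y r \ {y} ⊆ N \ {y} := sdiff_subset_sdiff_left hrN
  obtain ⟨k, F, hF, hFe⟩ := punct_log hr y f (hf.mono hs) (fun z hz => (h0 z (hs hz)).1)
  obtain ⟨l, G, hG, hGe⟩ := punct_log hr y g (hg.mono hs) (fun z hz => (h0 z (hs hz)).2)
  refine ⟨_, Metric.ball_mem_nhds y hr, hrN, ?_⟩
  by_cases hk : k = 0
  · refine ⟨1, 0, by simp, F, hF, fun z hz => ?_⟩
    simp [hFe z hz, hk]
  · refine ⟨l, -k, by simp [hk], fun z => l * F z - k * G z, by fun_prop, fun z hz => ?_⟩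
    have hz' : z - y ≠ 0 := sub_ne_zero.2 hz.2
    rw [hFe z hz, hGe z hz, mul_zpow, mul_zpow, Complex.exp_sub, Complex.exp_int_mul,
      Complex.exp_int_mul, ← zpow_mul, ← zpow_mul]
    rw [show l * -k = -(k * l) by ring, zpow_neg, zpow_neg]
    field_simp

end Part1

section Part2
open Set Topology Filter

/-- chart of ℝ × ℝ into ℂ -/
noncomputable def rrC : (ℝ × ℝ) ≃ₜ ℂ := Complex.equivRealProdCLM.symm.toHomeomorph

lemma locPC_rr (y : ℝ × ℝ) : LocPC (ℝ × ℝ) y :=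
  LocPC.transfer rrC.toOpenPartialHomeomorph (by simp) (locPC_complex _)

lemma logRk_rr (y : ℝ × ℝ) : LogRk (ℝ × ℝ) y :=
  LogRk.transfer rrC.toOpenPartialHomeomorph (by simp) (logRk_complex _)

lemma mem_hp {p : ℝ × ℝ} : p ∈ HalfPlane ↔ 0 ≤ p.2 := by simp [HalfPlane]

lemma hp_abs (p : ℝ × ℝ) : ((p.1, |p.2|) : ℝ × ℝ) ∈ HalfPlane := mem_hp.2 (abs_nonneg _)

lemma continuous_hp_abs : Continuous (fun p : ℝ × ℝ => (⟨(p.1, |p.2|), hp_abs p⟩ : HalfPlane)) :=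
  Continuous.subtype_mk (by fun_prop) _

lemma hp_interior {y : HalfPlane} (hy : 0 < y.1.2) :
    ∃ φ : OpenPartialHomeomorph HalfPlane (ℝ × ℝ), y ∈ φ.source := by
  have ho : IsOpen {p : ℝ × ℝ | 0 < p.2} := isOpen_lt continuous_const continuous_snd
  refine ⟨{ toFun := Subtype.val
            invFun := fun p => ⟨(p.1, |p.2|), hp_abs p⟩
            source := {p | 0 < p.1.2}
            target := {p | 0 < p.2}
            map_source' := fun p hp => hp
            map_target' := fun p hp => by
              simp only [mem_ofPred_eq] at hp ⊢; exact abs_pos.2 hp.ne'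
            left_inv' := fun p hp => by
              apply Subtype.ext; simp only [mem_ofPred_eq] at hp ⊢; rw [abs_of_pos hp]
            right_inv' := fun p hp => by
              simp only [mem_ofPred_eq] at hp ⊢; rw [abs_of_pos hp]
            open_source := ho.preimage continuous_subtype_val
            open_target := ho
            continuousOn_toFun := continuous_subtype_val.continuousOn
            continuousOn_invFun := by
              exact continuous_hp_abs.continuousOn }, hy⟩

lemma hp_star {y : ℝ × ℝ} (hy : y.2 = 0) {r : ℝ} (hr : 0 < r) :
    StarConvex ℝ ((y.1, r / 2) : ℝ × ℝ) ((HalfPlane ∩ Metric.ball y r) \ {y}) ∧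
      ((y.1, r / 2) : ℝ × ℝ) ∈ (HalfPlane ∩ Metric.ball y r) \ {y} := by
  have hcH : Convex ℝ HalfPlane := by
    intro p hp q hq a b ha hb hab
    simp only [HalfPlane, mem_ofPred_eq] at *
    simp; positivity
  have hmem : ((y.1, r / 2) : ℝ × ℝ) ∈ (HalfPlane ∩ Metric.ball y r) \ {y} := by
    refine ⟨⟨?_, ?_⟩, ?_⟩
    · simp [HalfPlane]; positivity
    · simp [Prod.dist_eq, hy, Real.dist_eq, abs_of_pos hr, hr]
    · intro h; have := congrArg Prod.snd (mem_singleton_iff.1 h); simp [hy] at this; linarith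
  refine ⟨?_, hmem⟩
  intro p hp a b ha hb hab
  refine ⟨(hcH.inter (convex_ball y r)) hmem.1 hp.1 ha hb hab, ?_⟩
  intro h
  rw [mem_singleton_iff] at h
  have h2 := congrArg Prod.snd h
  have h1 := congrArg Prod.fst h
  simp at h1 h2
  have hp2 : 0 ≤ p.2 := mem_hp.1 hp.1.1
  have ha0 : a = 0 := by
    by_contra hne
    have : 0 < a := lt_of_le_of_ne ha (Ne.symm hne)
    have : 0 ≤ b * p.2 := by positivity
    have : 0 < a * (r / 2) := by positivity
    rw [hy] at h2; linarith
  have hb1 : b = 1 := by linarith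
  rw [ha0, hb1] at h1 h2
  exact hp.2 (Prod.ext (by simpa using h1) (by simpa using h2))

lemma hp_image {y : HalfPlane} (r : ℝ) :
    (Subtype.val : HalfPlane → ℝ × ℝ) '' (Metric.ball y r \ {y}) =
      (HalfPlane ∩ Metric.ball y.1 r) \ {y.1} := by
  ext p
  constructor
  · rintro ⟨q, ⟨hq, hne⟩, rfl⟩
    exact ⟨⟨q.2, hq⟩, fun h => hne (Subtype.ext h)⟩
  · rintro ⟨⟨hp, hb⟩, hne⟩
    exact ⟨⟨p, hp⟩, ⟨hb, fun h => hne (congrArg Subtype.val h)⟩, rfl⟩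

lemma locPC_hp (y : HalfPlane) : LocPC HalfPlane y := by
  rcases lt_or_eq_of_le (mem_hp.1 y.2) with hy | hy
  · obtain ⟨φ, hφ⟩ := hp_interior hy
    exact LocPC.transfer φ hφ (locPC_rr _)
  · intro N hN
    obtain ⟨r, hr, hrN⟩ := Metric.mem_nhds_iff.1 hN
    obtain ⟨hst, hm⟩ := hp_star (y := y.1) hy.symm hr
    refine ⟨_, Metric.ball_mem_nhds y hr, hrN, ?_, ?_⟩
    · rw [← IsInducing.subtypeVal.isPreconnected_image, hp_image]
      exact (hst.isPathConnected hm).isConnected.isPreconnected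
    · rw [← image_nonempty (f := Subtype.val), hp_image]; exact ⟨_, hm⟩

lemma logRk_hp (y : HalfPlane) : LogRk HalfPlane y := by
  classical
  rcases lt_or_eq_of_le (mem_hp.1 y.2) with hy | hy
  · obtain ⟨φ, hφ⟩ := hp_interior hy
    exact LogRk.transfer φ hφ (logRk_rr _)
  · intro N hN f g hf hg h0
    obtain ⟨r, hr, hrN⟩ := Metric.mem_nhds_iff.1 hN
    obtain ⟨hst, hm⟩ := hp_star (y := y.1) hy.symm hr
    let f' : ℝ × ℝ → ℂ := fun p => f ⟨(p.1, |p.2|), hp_abs p⟩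
    have hval : ∀ p : ℝ × ℝ, ∀ hp : p ∈ HalfPlane,
        (⟨(p.1, |p.2|), hp_abs p⟩ : HalfPlane) = ⟨p, hp⟩ := fun p hp =>
      Subtype.ext (Prod.ext rfl (abs_of_nonneg (mem_hp.1 hp)))
    have hin : ∀ p ∈ (HalfPlane ∩ Metric.ball y.1 r) \ {y.1},
        (⟨(p.1, |p.2|), hp_abs p⟩ : HalfPlane) ∈ Metric.ball y r \ {y} := by
      rintro p ⟨⟨hp, hb⟩, hne⟩
      rw [hval p hp]
      exact ⟨hb, fun h => hne (congrArg Subtype.val h)⟩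
    obtain ⟨h, hh, hhe⟩ := exists_log_star hst hm f'
      (by
        refine (hf.mono (sdiff_subset_sdiff_left hrN)).comp (Continuous.continuousOn ?_) hin
        exact continuous_hp_abs)
      (fun p hp => (h0 _ (sdiff_subset_sdiff_left hrN (hin p hp))).1)
    refine ⟨_, Metric.ball_mem_nhds y hr, hrN, 1, 0, by simp, fun p => h p.1, ?_, ?_⟩
    · refine hh.comp continuous_subtype_val.continuousOn ?_
      intro p hp; rw [← hp_image]; exact ⟨p, hp, rfl⟩
    · intro p hp
      have := hhe p.1 (by rw [← hp_image]; exact ⟨p, hp, rfl⟩)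
      simp only [f', hval p.1 p.2] at this
      simpa using this

/-- intrinsic local planarity -/
def LPt (X : Type*) [TopologicalSpace X] (x : X) : Prop :=
  (∃ φ : OpenPartialHomeomorph X (ℝ × ℝ), x ∈ φ.source) ∨
  (∃ φ : OpenPartialHomeomorph X HalfPlane, x ∈ φ.source)

lemma LPt.locPC {X : Type*} [TopologicalSpace X] {x : X} (h : LPt X x) : LocPC X x := by
  rcases h with ⟨φ, h⟩ | ⟨φ, h⟩
  · exact LocPC.transfer φ h (locPC_rr _)
  · exact LocPC.transfer φ h (locPC_hp _)

lemma LPt.logRk {X : Type*} [TopologicalSpace X] {x : X} (h : LPt X x) : LogRk X x := by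
  rcases h with ⟨φ, h⟩ | ⟨φ, h⟩
  · exact LogRk.transfer φ h (logRk_rr _)
  · exact LogRk.transfer φ h (logRk_hp _)

lemma LPt.homeo {X Y : Type*} [TopologicalSpace X] [TopologicalSpace Y] {x : X} (e : X ≃ₜ Y)
    (h : LPt X x) : LPt Y (e x) := by
  rcases h with ⟨φ, h⟩ | ⟨φ, h⟩
  · exact Or.inl ⟨e.symm.toOpenPartialHomeomorph.trans φ, by simpa using h⟩
  · exact Or.inr ⟨e.symm.toOpenPartialHomeomorph.trans φ, by simpa using h⟩

/-- A neighbourhood homeomorphic to an open set gives a chart. -/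
lemma chart_of_nbhd {X Y : Type*} [TopologicalSpace X] [TopologicalSpace Y] {x : X} {U : Set X}
    (hU : U ∈ 𝓝 x) {V : Set Y} (hV : IsOpen V) (e : U ≃ₜ V) :
    ∃ φ : OpenPartialHomeomorph X Y, x ∈ φ.source := by
  obtain ⟨O, hOU, hO, hxO⟩ := mem_nhds_iff.1 hU
  have : Nonempty O := ⟨⟨x, hxO⟩⟩
  let O' : Set U := Subtype.val ⁻¹' O
  have hxU := hOU hxO
  have : Nonempty U := ⟨⟨x, hxU⟩⟩
  have : Nonempty V := ⟨e ⟨x, hxU⟩⟩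
  have ho1 : IsOpenEmbedding (fun z : O => (e ⟨z.1, hOU z.2⟩ : Y)) := by
    have h1 : IsOpenEmbedding (fun z : O => (⟨z.1, hOU z.2⟩ : U)) := by
      refine ⟨⟨.of_comp (by fun_prop) continuous_subtype_val IsInducing.subtypeVal, ?_⟩, ?_⟩
      · intro a b h; exact Subtype.ext (congrArg (fun z : U => (z : X)) h)
      · have : range (fun z : O => (⟨z.1, hOU z.2⟩ : U)) = Subtype.val ⁻¹' O := by
          ext z; constructor
          · rintro ⟨w, rfl⟩; exact w.2
          · intro hz; exact ⟨⟨z.1, hz⟩, rfl⟩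
        rw [this]; exact hO.preimage continuous_subtype_val
    exact hV.isOpenEmbedding_subtypeVal.comp (e.isOpenEmbedding.comp h1)
  have ho2 : IsOpenEmbedding (Subtype.val : O → X) := hO.isOpenEmbedding_subtypeVal
  refine ⟨(ho2.toOpenPartialHomeomorph).symm.trans ho1.toOpenPartialHomeomorph, ?_⟩
  simp [hxO]

end Part2

section Part3
open Set Topology Filter Geometry

/-- realization of a family of simplices in barycentric coordinates -/
def R {V : Type*} [Fintype V] (C : Set (Finset V)) : Set (V → ℝ) :=
  {w | (∀ i, 0 ≤ w i) ∧ ∑ i, w i = 1 ∧ ∃ s ∈ C, ∀ i, w i ≠ 0 → i ∈ s}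

lemma mem_R {V : Type*} [Fintype V] {C : Set (Finset V)} {w : V → ℝ} :
    w ∈ R C ↔ (∀ i, 0 ≤ w i) ∧ ∑ i, w i = 1 ∧ ∃ s ∈ C, ∀ i, w i ≠ 0 → i ∈ s := by
  simp [R]

lemma R_compact {V : Type*} [Fintype V] (C : Set (Finset V)) : IsCompact (R C) := by
  have h1 : R C = ⋃ s ∈ C, (stdSimplex ℝ V ∩ {w | ∀ i, i ∉ s → w i = 0}) := by
    ext w
    simp only [mem_R, stdSimplex, mem_iUnion, mem_inter_iff, mem_ofPred_eq]
    constructor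
    · rintro ⟨h1, h2, s, hs, h3⟩
      exact ⟨s, hs, ⟨h1, h2⟩, fun i hi => by by_contra h; exact hi (h3 i h)⟩
    · rintro ⟨s, hs, ⟨h1, h2⟩, h3⟩
      exact ⟨h1, h2, s, hs, fun i hi => by by_contra h; exact hi (h3 i h)⟩
  rw [h1]
  refine (Set.toFinite C).isCompact_biUnion fun s _ => ?_
  refine (isCompact_stdSimplex ℝ V).inter_right ?_
  have : {w : V → ℝ | ∀ i, i ∉ s → w i = 0} = ⋂ i, ⋂ (_ : i ∉ s), {w | w i = 0} := by
    ext; simp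
  rw [this]
  exact isClosed_iInter fun i => isClosed_iInter fun _ =>
    isClosed_eq (continuous_apply i) continuous_const

lemma model_aux {m : ℕ} (ve : Fin m → Pt n) (hinj : Function.Injective ve)
    (K : SimplicialComplex ℝ (Pt n)) {s : Finset (Fin m)} (hs : s.image ve ∈ K.faces)
    {w1 w2 : Fin m → ℝ} (h1 : ∀ i, w1 i ≠ 0 → i ∈ s) (h2 : ∀ i, w2 i ≠ 0 → i ∈ s)
    (hs1 : ∑ i, w1 i = ∑ i, w2 i) (hx : ∑ i, w1 i • ve i = ∑ i, w2 i • ve i) : w1 = w2 := by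
  have hind := K.indep hs
  let emb : s ↪ (↑(s.image ve) : Set (Pt n)) :=
    ⟨fun i => ⟨ve i, by simpa using ⟨i.1, i.2, rfl⟩⟩, fun a b h => by
      simp only [Subtype.mk.injEq] at h
      exact Subtype.ext (hinj h)⟩
  have h3 := hind.comp_embedding emb
  rw [affineIndependent_iff] at h3
  have e1 : ∑ i : s, (w1 i - w2 i) = 0 := by
    rw [Finset.sum_coe_sort s (fun i => w1 i - w2 i),
      Finset.sum_subset (Finset.subset_univ s), Finset.sum_sub_distrib, hs1, sub_self]
    intro i _ hi
    have := mt (h1 i) hi; have := mt (h2 i) hi; simp_all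
  have e2 : ∑ i : s, (w1 i - w2 i) • ve i = 0 := by
    rw [Finset.sum_coe_sort s (fun i => (w1 i - w2 i) • ve i),
      Finset.sum_subset (Finset.subset_univ s)]
    · simp only [sub_smul]
      rw [Finset.sum_sub_distrib, hx, sub_self]
    intro i _ hi
    have := mt (h1 i) hi; have := mt (h2 i) hi; simp_all
  have h4 := h3 Finset.univ (fun i => w1 i - w2 i) e1 e2
  funext i
  by_cases hi : i ∈ s
  · have := h4 ⟨i, hi⟩ (Finset.mem_univ _); simp only at this; linarith
  · have := mt (h1 i) hi; have := mt (h2 i) hi; simp_all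

lemma model_surj {m : ℕ} (ve : Fin m → Pt n) (hinj : Function.Injective ve)
    {s : Finset (Fin m)} {x : Pt n} (hx : x ∈ convexHull ℝ (↑(s.image ve) : Set (Pt n))) :
    ∃ w : Fin m → ℝ, (∀ i, 0 ≤ w i) ∧ ∑ i, w i = 1 ∧ (∀ i, w i ≠ 0 → i ∈ s) ∧
      ∑ i, w i • ve i = x := by
  rw [Finset.mem_convexHull'] at hx
  obtain ⟨u, hu0, hu1, hux⟩ := hx
  rw [Finset.sum_image hinj.injOn] at hu1 hux
  refine ⟨fun i => if i ∈ s then u (ve i) else 0, fun i => ?_, ?_, ?_, ?_⟩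
  · dsimp only; split_ifs with h
    · exact hu0 _ (Finset.mem_image_of_mem _ h)
    · exact le_rfl
  · rw [← hu1]; simp
  · intro i hi; by_contra h; simp [h] at hi
  · rw [← hux]; simp

theorem exists_model (K : SimplicialComplex ℝ (Pt n)) (hfin : K.faces.Finite) :
    ∃ (m : ℕ) (ve : Fin m → Pt n), Function.Injective ve ∧ range ve = K.vertices ∧
      Nonempty (R {s : Finset (Fin m) | s.image ve ∈ K.faces} ≃ₜ K.space) := by
  classical
  have hvf : K.vertices.Finite := by
    have : K.vertices = (fun x => ({x} : Finset (Pt n))) ⁻¹' K.faces := by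
      ext; simp [SimplicialComplex.vertices]
    rw [this]
    exact hfin.preimage (fun a _ b _ h => by simpa using h)
  have := hvf.to_subtype
  obtain ⟨m, ⟨e⟩⟩ := Finite.exists_equiv_fin K.vertices
  let ve : Fin m → Pt n := fun i => (e.symm i : Pt n)
  have hinj : Function.Injective ve := Subtype.val_injective.comp e.symm.injective
  have hrange : range ve = K.vertices := by
    ext x; constructor
    · rintro ⟨i, rfl⟩; exact (e.symm i).2
    · intro hx; exact ⟨e ⟨x, hx⟩, by simp [ve]⟩
  refine ⟨m, ve, hinj, hrange, ?_⟩
  set C : Set (Finset (Fin m)) := {s | s.image ve ∈ K.faces} with hC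
  have hCm : ∀ s, s ∈ C ↔ s.image ve ∈ K.faces := fun s => by simp [hC]
  have hdown : ∀ s ∈ C, ∀ t, t ⊆ s → t.Nonempty → t ∈ C := by
    intro s hs t hts htn
    rw [hCm] at hs ⊢
    exact K.down_closed hs (Finset.image_subset_image hts) (htn.image _)
  let Φ : (Fin m → ℝ) → Pt n := fun w => ∑ i, w i • ve i
  have hΦc : Continuous Φ := by fun_prop
  have hsupp : ∀ w : Fin m → ℝ, (∀ i, 0 ≤ w i) → ∑ i, w i = 1 → ∀ s : Finset (Fin m),
      (∀ i, w i ≠ 0 → i ∈ s) → Φ w ∈ convexHull ℝ (↑(s.image ve) : Set (Pt n)) := by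
    intro w h0 h1 s hs
    have : Φ w = ∑ i ∈ s, w i • ve i := by
      symm
      apply Finset.sum_subset (Finset.subset_univ s)
      intro i _ hi; have := mt (hs i) hi; simp_all
    rw [this]
    refine (convex_convexHull ℝ _).sum_mem (fun i _ => h0 i) ?_ ?_
    · rw [← h1]
      apply Finset.sum_subset (Finset.subset_univ s)
      intro i _ hi; have := mt (hs i) hi; simp_all
    · intro i hi; apply subset_convexHull; simpa using ⟨i, hi, rfl⟩
  have hmaps : ∀ w ∈ R C, Φ w ∈ K.space := by
    intro w hw
    obtain ⟨h0, h1, s, hs, h2⟩ := mem_R.1 hw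
    exact SimplicialComplex.mem_space_iff.2 ⟨_, (hCm s).1 hs, hsupp w h0 h1 s h2⟩
  let Ψ : R C → K.space := fun w => ⟨Φ w.1, hmaps w.1 w.2⟩
  have hΨc : Continuous Ψ := (hΦc.comp continuous_subtype_val).subtype_mk _
  have hΨi : Function.Injective Ψ := by
    rintro ⟨w1, hw1⟩ ⟨w2, hw2⟩ h
    have h : Φ w1 = Φ w2 := congrArg Subtype.val h
    apply Subtype.ext
    obtain ⟨h10, h11, s1, hs1, h12⟩ := mem_R.1 hw1
    obtain ⟨h20, h21, s2, hs2, h22⟩ := mem_R.1 hw2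
    have hx := K.inter_subset_convexHull ((hCm _).1 hs1) ((hCm _).1 hs2)
      ⟨hsupp w1 h10 h11 s1 h12, h ▸ hsupp w2 h20 h21 s2 h22⟩
    rw [← Finset.coe_inter, ← Finset.image_inter _ _ hinj] at hx
    obtain ⟨u, hu0, hu1, hu2, hu3⟩ := model_surj ve hinj hx
    have a1 := model_aux ve hinj K ((hCm _).1 hs1) h12
      (fun i hi => (Finset.mem_inter.1 (hu2 i hi)).1) (h11.trans hu1.symm) hu3.symm
    have a2 := model_aux ve hinj K ((hCm _).1 hs2) h22
      (fun i hi => (Finset.mem_inter.1 (hu2 i hi)).2) (h21.trans hu1.symm) (h.symm.trans hu3.symm)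
    exact a1.trans a2.symm
  have hΨs : Function.Surjective Ψ := by
    rintro ⟨x, hx⟩
    obtain ⟨t, ht, hxt⟩ := SimplicialComplex.mem_space_iff.1 hx
    have hti : (Finset.univ.filter (fun i => ve i ∈ t)).image ve = t := by
      ext y
      simp only [Finset.mem_image, Finset.mem_filter, Finset.mem_univ, true_and]
      constructor
      · rintro ⟨i, hi, rfl⟩; exact hi
      · intro hy
        have : y ∈ K.vertices := K.down_closed ht (by simpa using hy) (by simp)
        rw [← hrange] at this
        obtain ⟨i, rfl⟩ := this
        exact ⟨i, hy, rfl⟩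
    rw [← hti] at hxt
    obtain ⟨u, hu0, hu1, hu2, hu3⟩ := model_surj ve hinj hxt
    exact ⟨⟨u, mem_R.2 ⟨hu0, hu1, _, (hCm _).2 (hti.symm ▸ ht), hu2⟩⟩, Subtype.ext hu3⟩
  have : CompactSpace (R C) := isCompact_iff_compactSpace.1 (R_compact C)
  exact ⟨Continuous.homeoOfEquivCompactToT2 (f := Equiv.ofBijective Ψ ⟨hΨi, hΨs⟩) hΨc⟩

end Part3

section Part4
open Set Topology Filter

lemma contOn_of_comp {E F Z : Type*} [TopologicalSpace E] [TopologicalSpace F]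
    [TopologicalSpace Z] [T2Space F] {X : Set E} (hX : IsCompact X) {p : E → F}
    (hp : ContinuousOn p X) {G : F → Z} (h : ContinuousOn (G ∘ p) X) :
    ContinuousOn G (p '' X) := by
  rw [continuousOn_iff_isClosed] at h ⊢
  intro t ht
  obtain ⟨u, hu, hut⟩ := h t ht
  refine ⟨p '' (X ∩ u), ((hX.inter_right hu).image_of_continuousOn
    (hp.mono inter_subset_left)).isClosed, ?_⟩
  ext y
  constructor
  · rintro ⟨hy, x, hx, rfl⟩
    have : x ∈ u ∩ X := hut ▸ (⟨hy, hx⟩ : x ∈ (G ∘ p) ⁻¹' t ∩ X)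
    exact ⟨⟨x, ⟨hx, this.1⟩, rfl⟩, ⟨x, hx, rfl⟩⟩
  · rintro ⟨⟨x, ⟨hx, hxu⟩, rfl⟩, hy⟩
    have : x ∈ (G ∘ p) ⁻¹' t ∩ X := hut ▸ (⟨hxu, hx⟩ : x ∈ u ∩ X)
    exact ⟨this.1, hy⟩

lemma exists_inv_contOn {E F : Type*} [TopologicalSpace E] [TopologicalSpace F] [Nonempty E]
    [T2Space F] {X : Set E} (hX : IsCompact X) {p : E → F}
    (hp : ContinuousOn p X) (hi : InjOn p X) :
    ∃ q : F → E, ContinuousOn q (p '' X) ∧ (∀ x ∈ X, q (p x) = x) := by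
  refine ⟨Function.invFunOn p X, ?_, fun x hx => hi.leftInvOn_invFunOn hx⟩
  refine contOn_of_comp hX hp (continuousOn_id.congr fun x hx => ?_)
  exact hi.leftInvOn_invFunOn hx

lemma circle_ext {g : ℝ → ℝ} (hg : Continuous g) (hm : StrictMono g)
    (h1 : g (-Real.pi) = -Real.pi) (h2 : g Real.pi = Real.pi) :
    ∃ G : ℂ → ℂ, ContinuousOn G (Metric.closedBall 0 1) ∧ InjOn G (Metric.closedBall 0 1) ∧
      G '' (Metric.closedBall 0 1) = Metric.closedBall 0 1 ∧ (∀ z, ‖G z‖ = ‖z‖) ∧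
      ∀ φ ∈ Icc (-Real.pi) Real.pi, G (Complex.exp (φ * Complex.I)) =
        Complex.exp (g φ * Complex.I) := by
  let G : ℂ → ℂ := fun z => ‖z‖ * Complex.exp (g z.arg * Complex.I)
  have hpi := Real.pi_pos
  have key : ∀ r : ℝ, 0 ≤ r → ∀ φ ∈ Icc (-Real.pi) Real.pi,
      G (r * Complex.exp (φ * Complex.I)) = r * Complex.exp (g φ * Complex.I) := by
    intro r hr φ hφ
    have hn : ‖(r : ℂ) * Complex.exp (φ * Complex.I)‖ = r := by
      rw [norm_mul, Complex.norm_exp_ofReal_mul_I]; simp [hr]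
    simp only [G, hn]
    rcases hr.eq_or_lt with rfl | hr
    · simp
    · rcases hφ.1.eq_or_lt with h | h
      · have : Complex.exp (φ * Complex.I) = Complex.exp ((Real.pi : ℝ) * Complex.I) := by
          rw [← h]; push_cast; rw [Complex.exp_pi_mul_I, neg_mul, Complex.exp_neg,
            Complex.exp_pi_mul_I]; norm_num
        rw [this, Complex.exp_mul_I (Real.pi : ℂ), Complex.arg_mul_cos_add_sin_mul_I hr ⟨by linarith, le_rfl⟩,
          ← h, h1, h2]
        push_cast
        rw [Complex.exp_pi_mul_I, neg_mul, Complex.exp_neg,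
            Complex.exp_pi_mul_I]; norm_num
      · rw [Complex.exp_mul_I (φ : ℂ), Complex.arg_mul_cos_add_sin_mul_I hr ⟨h, hφ.2⟩]
  have hnorm : ∀ z, ‖G z‖ = ‖z‖ := by
    intro z; simp only [G]; rw [norm_mul, Complex.norm_exp_ofReal_mul_I]; simp
  have hD : (fun q : ℝ × ℝ => (q.1 : ℂ) * Complex.exp (q.2 * Complex.I)) ''
      (Icc 0 1 ×ˢ Icc (-Real.pi) Real.pi) = Metric.closedBall 0 1 := by
    ext z
    constructor
    · rintro ⟨⟨r, φ⟩, ⟨hr, hφ⟩, rfl⟩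
      simp only at hr hφ ⊢
      rw [mem_closedBall_zero_iff, norm_mul, Complex.norm_exp_ofReal_mul_I]
      simpa [abs_of_nonneg hr.1] using hr.2
    · intro hz
      exact ⟨(‖z‖, z.arg), ⟨⟨norm_nonneg _, by simpa using hz⟩,
        ⟨(Complex.neg_pi_lt_arg z).le, Complex.arg_le_pi z⟩⟩, Complex.norm_mul_exp_arg_mul_I z⟩
  refine ⟨G, ?_, ?_, ?_, hnorm, ?_⟩
  · rw [← hD]
    refine contOn_of_comp (isCompact_Icc.prod isCompact_Icc) (by fun_prop) ?_
    refine ContinuousOn.congr (f := fun q : ℝ × ℝ => (q.1 : ℂ) * Complex.exp (g q.2 * Complex.I))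
      (by fun_prop) ?_
    rintro ⟨r, φ⟩ ⟨hr, hφ⟩
    exact key r hr.1 φ hφ
  · intro z _ w _ h
    have hzw : ‖z‖ = ‖w‖ := by rw [← hnorm z, ← hnorm w, h]
    by_cases hz : z = 0
    · subst hz; simp at hzw; exact (norm_eq_zero.1 hzw.symm).symm
    have hz' : 0 < ‖z‖ := norm_pos_iff.2 hz
    have harg : ∀ z : ℂ, 0 < ‖z‖ → (G z).arg = g z.arg := by
      intro z hz
      simp only [G]
      rw [Complex.exp_mul_I, Complex.arg_mul_cos_add_sin_mul_I hz]
      refine ⟨?_, ?_⟩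
      · rw [← h1]; exact hm (Complex.neg_pi_lt_arg z)
      · rw [← h2]; exact hm.monotone (Complex.arg_le_pi z)
    have h3 : g z.arg = g w.arg := by
      rw [← harg z hz', ← harg w (hzw ▸ hz'), h]
    have h4 := hm.injective h3
    rw [← Complex.norm_mul_exp_arg_mul_I z, ← Complex.norm_mul_exp_arg_mul_I w, hzw, h4]
  · apply Subset.antisymm
    · rintro _ ⟨z, hz, rfl⟩
      rw [mem_closedBall_zero_iff, hnorm]; simpa using hz
    · intro z hz
      have : z.arg ∈ Icc (g (-Real.pi)) (g Real.pi) := by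
        rw [h1, h2]; exact ⟨(Complex.neg_pi_lt_arg z).le, Complex.arg_le_pi z⟩
      obtain ⟨φ, hφ, hgφ⟩ := intermediate_value_Icc (by linarith : -Real.pi ≤ Real.pi)
        hg.continuousOn this
      refine ⟨‖z‖ * Complex.exp (φ * Complex.I), ?_, ?_⟩
      · rw [mem_closedBall_zero_iff, norm_mul, Complex.norm_exp_ofReal_mul_I]; simpa using hz
      · rw [key _ (norm_nonneg _) φ hφ, hgφ, Complex.norm_mul_exp_arg_mul_I]
  · intro φ hφ
    have := key 1 zero_le_one φ hφ
    simpa using this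

lemma exists_g {θ : ℝ → ℝ} (hc : ContinuousOn θ (Icc (-1) 1)) (hm : StrictMonoOn θ (Icc (-1) 1))
    (h1 : -Real.pi < θ (-1)) (h2 : θ 1 < Real.pi) :
    ∃ g : ℝ → ℝ, Continuous g ∧ StrictMono g ∧ g (-Real.pi) = -Real.pi ∧ g Real.pi = Real.pi ∧
      ∀ t ∈ Icc (-1 : ℝ) 1, g (Real.pi / 2 * t) = θ t := by
  have hpi := Real.pi_pos
  let cl : ℝ → ℝ := fun x => max (-1) (min 1 x)
  have hcl : ∀ x, cl x ∈ Icc (-1 : ℝ) 1 := fun x => by simp [cl]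
  have hclc : Continuous cl := by fun_prop
  have hclm : Monotone cl := fun x y h => by simp only [cl]; gcongr
  let k1 := (θ (-1) + Real.pi) / (Real.pi / 2)
  let k2 := (Real.pi - θ 1) / (Real.pi / 2)
  have hk1 : 0 < k1 := by apply div_pos <;> linarith
  have hk2 : 0 < k2 := by apply div_pos <;> linarith
  have hk1' : k1 * (Real.pi / 2) = θ (-1) + Real.pi := by simp only [k1]; field_simp
  have hk2' : k2 * (Real.pi / 2) = Real.pi - θ 1 := by simp only [k2]; field_simp
  let g : ℝ → ℝ := fun φ => θ (cl (2 / Real.pi * φ)) + k1 * min (φ + Real.pi / 2) 0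
    + k2 * max (φ - Real.pi / 2) 0
  have hθm : Monotone (fun x => θ (cl x)) := fun x y h => hm.monotoneOn (hcl x) (hcl y) (hclm h)
  have hθc : Continuous (fun x => θ (cl x)) := hc.comp_continuous hclc hcl
  have e1 : 2 / Real.pi * (-Real.pi) = -2 := by field_simp
  have e2 : 2 / Real.pi * (Real.pi) = 2 := by field_simp
  refine ⟨g, ?_, ?_, ?_, ?_, ?_⟩
  · have : Continuous (fun φ : ℝ => θ (cl (2 / Real.pi * φ))) :=
      hθc.comp (continuous_const.mul continuous_id)
    exact (this.add (by fun_prop)).add (by fun_prop)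
  · intro x y hxy
    have a1 : θ (cl (2 / Real.pi * x)) ≤ θ (cl (2 / Real.pi * y)) :=
      hθm (by gcongr)
    have a2 : k1 * min (x + Real.pi / 2) 0 ≤ k1 * min (y + Real.pi / 2) 0 := by gcongr
    have a3 : k2 * max (x - Real.pi / 2) 0 ≤ k2 * max (y - Real.pi / 2) 0 := by gcongr
    simp only [g]
    by_cases c1 : x < - (Real.pi / 2)
    · have : k1 * min (x + Real.pi / 2) 0 < k1 * min (y + Real.pi / 2) 0 := by
        gcongr
        rw [min_eq_left (by linarith)]
        exact lt_min (by linarith) (by linarith)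
      linarith
    by_cases c2 : Real.pi / 2 < y
    · have : k2 * max (x - Real.pi / 2) 0 < k2 * max (y - Real.pi / 2) 0 := by
        gcongr
        rw [max_eq_left (a := y - Real.pi / 2) (by linarith)]
        exact max_lt (by linarith) (by linarith)
      linarith
    push Not at c1 c2
    have hcl' : ∀ z, -(Real.pi / 2) ≤ z → z ≤ Real.pi / 2 →
        cl (2 / Real.pi * z) = 2 / Real.pi * z := by
      intro z hz1 hz2
      have b1 : -1 ≤ 2 / Real.pi * z := by
        rw [div_mul_eq_mul_div, le_div_iff₀ hpi]; linarith
      have b2 : 2 / Real.pi * z ≤ 1 := by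
        rw [div_mul_eq_mul_div, div_le_iff₀ hpi]; linarith
      simp only [cl]; rw [min_eq_right b2, max_eq_right b1]
    have : θ (cl (2 / Real.pi * x)) < θ (cl (2 / Real.pi * y)) := by
      apply hm (hcl _) (hcl _)
      rw [hcl' x c1 (by linarith), hcl' y (by linarith) c2]
      gcongr
    linarith
  · simp only [g, e1]
    rw [min_eq_left (by linarith), max_eq_right (by linarith)]
    have : cl (-2) = -1 := by simp only [cl]; norm_num
    rw [this]; nlinarith
  · simp only [g, e2]
    rw [min_eq_right (by linarith), max_eq_left (by linarith)]
    have : cl 2 = 1 := by simp only [cl]; norm_num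
    rw [this]; nlinarith
  · intro t ht
    have e3 : 2 / Real.pi * (Real.pi / 2 * t) = t := by field_simp
    simp only [g, e3]
    have : cl t = t := by simp only [cl]; rw [min_eq_right ht.2, max_eq_right ht.1]
    rw [this, min_eq_right (by nlinarith [ht.1]), max_eq_right (by nlinarith [ht.2])]
    ring

lemma arc_not_surj {β : ℝ → ℂ} (hc : ContinuousOn β (Icc (-1) 1)) (hi : InjOn β (Icc (-1) 1)) :
    ∃ z : ℂ, ‖z‖ = 1 ∧ z ∉ β '' Icc (-1) 1 := by
  by_contra hcon
  push Not at hcon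
  obtain ⟨q, hq, hqβ⟩ := exists_inv_contOn isCompact_Icc hc hi
  have hqi : ∀ z w : ℂ, ‖z‖ = 1 → ‖w‖ = 1 → q z = q w → z = w := by
    intro z w hz hw h
    obtain ⟨s, hs, rfl⟩ := hcon z hz
    obtain ⟨t, ht, rfl⟩ := hcon w hw
    rw [hqβ s hs, hqβ t ht] at h; rw [h]
  let ψ : ℝ → ℝ := fun φ => q (Complex.exp (φ * Complex.I)) - q (-Complex.exp (φ * Complex.I))
  have hψ : Continuous ψ := by
    apply Continuous.sub
    · exact hq.comp_continuous (by fun_prop) fun φ => hcon _ (Complex.norm_exp_ofReal_mul_I φ)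
    · exact hq.comp_continuous (by fun_prop) fun φ => hcon _
        (by rw [norm_neg]; exact Complex.norm_exp_ofReal_mul_I φ)
  have h0 : ψ Real.pi = - ψ 0 := by simp [ψ, Complex.exp_pi_mul_I]
  have : (0 : ℝ) ∈ uIcc (ψ 0) (ψ Real.pi) := by
    rw [h0, mem_uIcc]
    rcases le_total (ψ 0) 0 with h | h
    · left; constructor <;> linarith
    · right; constructor <;> linarith
  obtain ⟨φ, -, hφ⟩ := intermediate_value_uIcc (hψ.continuousOn (s := uIcc 0 Real.pi)) this
  have h1 := hqi (Complex.exp (φ * Complex.I)) (-Complex.exp (φ * Complex.I))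
    (Complex.norm_exp_ofReal_mul_I φ) (by rw [norm_neg]; exact Complex.norm_exp_ofReal_mul_I φ)
    (sub_eq_zero.1 hφ)
  exact Complex.exp_ne_zero _ (self_eq_neg.1 h1)



lemma arc_norm {β : ℝ → ℂ} (hc : ContinuousOn β (Icc (-1) 1)) (hi : InjOn β (Icc (-1) 1))
    (h1 : ∀ t ∈ Icc (-1 : ℝ) 1, ‖β t‖ = 1) :
    ∃ G : ℂ → ℂ, ContinuousOn G (Metric.closedBall 0 1) ∧ InjOn G (Metric.closedBall 0 1) ∧
      G '' (Metric.closedBall 0 1) = Metric.closedBall 0 1 ∧ (∀ z, ‖G z‖ = ‖z‖) ∧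
      ∀ t ∈ Icc (-1 : ℝ) 1, G (Complex.exp ((Real.pi / 2 * t : ℝ) * Complex.I)) = β t := by
  have hpi := Real.pi_pos
  -- reduced version
  have red : ∀ β : ℝ → ℂ, ContinuousOn β (Icc (-1) 1) → (∀ t ∈ Icc (-1 : ℝ) 1, ‖β t‖ = 1) →
      (∀ t ∈ Icc (-1 : ℝ) 1, β t ∈ Complex.slitPlane) →
      StrictMonoOn (fun t => (β t).arg) (Icc (-1) 1) →
      ∃ G : ℂ → ℂ, ContinuousOn G (Metric.closedBall 0 1) ∧ InjOn G (Metric.closedBall 0 1) ∧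
      G '' (Metric.closedBall 0 1) = Metric.closedBall 0 1 ∧ (∀ z, ‖G z‖ = ‖z‖) ∧
      ∀ t ∈ Icc (-1 : ℝ) 1, G (Complex.exp ((Real.pi / 2 * t : ℝ) * Complex.I)) = β t := by
    intro β hc h1 hs hm
    have hca : ContinuousOn (fun t => (β t).arg) (Icc (-1) 1) := fun t ht =>
      (Complex.continuousAt_arg (hs t ht)).comp_continuousWithinAt (hc t ht)
    have hlt : (β 1).arg < Real.pi := lt_of_le_of_ne (Complex.arg_le_pi _)
      (Complex.mem_slitPlane_iff_arg.1 (hs 1 (by simp))).1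
    obtain ⟨g, hg, hgm, hg1, hg2, hgt⟩ := exists_g hca hm (Complex.neg_pi_lt_arg _) hlt
    obtain ⟨G, G1, G2, G3, G4, G5⟩ := circle_ext hg hgm hg1 hg2
    refine ⟨G, G1, G2, G3, G4, fun t ht => ?_⟩
    rw [G5 _ ⟨by nlinarith [ht.1], by nlinarith [ht.2]⟩, hgt t ht]
    have := Complex.norm_mul_exp_arg_mul_I (β t)
    rw [h1 t ht] at this; simpa using this
  obtain ⟨z0, hz0, hz0β⟩ := arc_not_surj hc hi
  have hz00 : z0 ≠ 0 := by rintro rfl; simp at hz0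
  -- rotate
  let u : ℂ := -z0⁻¹
  have hu : ‖u‖ = 1 := by simp [u, hz0]
  have hu0 : u ≠ 0 := by simp [u, hz00]
  have hsl : ∀ t ∈ Icc (-1 : ℝ) 1, u * β t ∈ Complex.slitPlane := by
    intro t ht
    rw [Complex.mem_slitPlane_iff_arg]
    refine ⟨fun h => ?_, fun h => ?_⟩
    · have h2 := Complex.norm_mul_exp_arg_mul_I (u * β t)
      rw [h, norm_mul, hu, h1 t ht, Complex.exp_pi_mul_I] at h2
      apply hz0β
      refine ⟨t, ht, ?_⟩
      simp only [u] at h2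
      field_simp at h2
      simpa using h2.symm
    · have := congrArg norm h
      rw [norm_mul, hu, h1 t ht] at this; simp at this
  have huβ : ContinuousOn (fun t => u * β t) (Icc (-1) 1) := continuousOn_const.mul hc
  have hca : ContinuousOn (fun t => (u * β t).arg) (Icc (-1) 1) := fun t ht =>
      ContinuousAt.comp_continuousWithinAt (f := fun t => u * β t)
        (Complex.continuousAt_arg (hsl t ht)) (huβ t ht)
  have hai : InjOn (fun t => (u * β t).arg) (Icc (-1) 1) := by
    intro s hs t ht h
    apply hi hs ht
    apply mul_left_cancel₀ hu0
    simp only at h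
    rw [← Complex.norm_mul_exp_arg_mul_I (u * β s), ← Complex.norm_mul_exp_arg_mul_I (u * β t), h,
      norm_mul, norm_mul, h1 s hs, h1 t ht]
  have hun : ∀ z : ℂ, ‖u⁻¹ * z‖ = ‖z‖ := by intro z; rw [norm_mul, norm_inv, hu]; simp
  have hrot : ∀ z ∈ Metric.closedBall (0 : ℂ) 1, u * z ∈ Metric.closedBall (0 : ℂ) 1 := by
    intro z hz; rw [mem_closedBall_zero_iff] at *; rw [norm_mul, hu]; simpa using hz
  rcases hca.strictMonoOn_of_injOn_Icc' (by norm_num) hai with hm | hm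
  · obtain ⟨G, G1, G2, G3, G4, G5⟩ := red (fun t => u * β t) (continuousOn_const.mul hc)
      (fun t ht => by rw [norm_mul, hu, h1 t ht, one_mul]) hsl hm
    refine ⟨fun z => u⁻¹ * G z, continuousOn_const.mul G1, ?_, ?_, ?_, ?_⟩
    · intro z hz w hw h
      exact G2 hz hw (mul_left_cancel₀ (inv_ne_zero hu0) h)
    · apply Subset.antisymm
      · rintro _ ⟨z, hz, rfl⟩
        simp only
        rw [mem_closedBall_zero_iff, hun, G4]; simpa using hz
      · intro z hz
        obtain ⟨w, hw, hwz⟩ := G3.symm.subset (hrot z hz)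
        exact ⟨w, hw, by simp only [hwz]; field_simp⟩
    · intro z; rw [hun, G4]
    · intro t ht; simp only [G5 t ht]; field_simp
  · have hci : ∀ z : ℂ, z ∈ Complex.slitPlane → ((starRingEnd ℂ) z).arg = - z.arg := by
      intro z hz
      rw [Complex.arg_conj, if_neg (Complex.mem_slitPlane_iff_arg.1 hz).1]
    obtain ⟨G, G1, G2, G3, G4, G5⟩ := red (fun t => (starRingEnd ℂ) (u * β t))
      (Complex.continuous_conj.comp_continuousOn (continuousOn_const.mul hc))
      (fun t ht => by rw [Complex.norm_conj, norm_mul, hu, h1 t ht, one_mul])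
      (fun t ht => by
        have h3 := hsl t ht
        rw [Complex.mem_slitPlane_iff] at h3 ⊢
        rw [Complex.conj_re, Complex.conj_im, neg_ne_zero]
        exact h3)
      (fun s hs t ht hst => by
        simp only [hci _ (hsl s hs), hci _ (hsl t ht)]
        exact neg_lt_neg (hm hs ht hst))
    refine ⟨fun z => u⁻¹ * (starRingEnd ℂ) (G z), continuousOn_const.mul
      (Complex.continuous_conj.comp_continuousOn G1), ?_, ?_, ?_, ?_⟩
    · intro z hz w hw h
      exact G2 hz hw ((starRingEnd ℂ).injective (mul_left_cancel₀ (inv_ne_zero hu0) h))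
    · apply Subset.antisymm
      · rintro _ ⟨z, hz, rfl⟩
        simp only
        rw [mem_closedBall_zero_iff, hun, Complex.norm_conj, G4]; simpa using hz
      · intro z hz
        have h5 : (starRingEnd ℂ) (u * z) ∈ Metric.closedBall (0 : ℂ) 1 := by
          have := hrot z hz
          rw [mem_closedBall_zero_iff] at this ⊢; rwa [Complex.norm_conj]
        obtain ⟨w, hw, hwz⟩ := G3.symm.subset h5
        refine ⟨w, hw, ?_⟩
        simp only [hwz, Complex.conj_conj]
        field_simp
    · intro z; rw [hun, Complex.norm_conj, G4]
    · intro t ht; simp only [G5 t ht, Complex.conj_conj]; field_simp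

/-- `X` is a closed disc with `B ∩ X` on the boundary circle. -/
def IsDisc {E : Type*} [TopologicalSpace E] (X B : Set E) : Prop :=
  IsCompact X ∧ ∃ f : E → ℂ, ContinuousOn f X ∧ InjOn f X ∧ f '' X = Metric.closedBall 0 1 ∧
    ∀ x ∈ X, x ∈ B → ‖f x‖ = 1

lemma disc_normalize {E : Type*} [TopologicalSpace E] [Nonempty E] {X B A : Set E}
    (h : IsDisc X B)
    (hA : IsCompact A) (hAX : A ⊆ X) (hAB : A ⊆ B) {α : E → ℝ} (hα : ContinuousOn α A)
    (hαi : InjOn α A) (hαA : α '' A = Icc (-1) 1) :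
    ∃ f : E → ℂ, ContinuousOn f X ∧ InjOn f X ∧ f '' X = Metric.closedBall 0 1 ∧
    (∀ x ∈ X, x ∈ B → ‖f x‖ = 1) ∧
    ∀ x ∈ A, f x = Complex.exp ((Real.pi / 2 * α x : ℝ) * Complex.I) := by
  obtain ⟨hX, f, f1, f2, f3, f4⟩ := h
  obtain ⟨q, hq, hqα⟩ := exists_inv_contOn hA hα hαi
  rw [hαA] at hq
  have hqm : ∀ t ∈ Icc (-1 : ℝ) 1, q t ∈ A := by
    intro t ht; rw [← hαA] at ht; obtain ⟨a, ha, rfl⟩ := ht; rw [hqα a ha]; exact ha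
  have hαq : ∀ t ∈ Icc (-1 : ℝ) 1, α (q t) = t := by
    intro t ht; rw [← hαA] at ht; obtain ⟨a, ha, rfl⟩ := ht; rw [hqα a ha]
  obtain ⟨G, G1, G2, G3, G4, G5⟩ := arc_norm (β := fun t => f (q t))
    (f1.comp hq fun t ht => hAX (hqm t ht))
    (fun s hs t ht h => by
      have := f2 (hAX (hqm s hs)) (hAX (hqm t ht)) h
      rw [← hαq s hs, ← hαq t ht, this])
    (fun t ht => f4 _ (hAX (hqm t ht)) (hAB (hqm t ht)))
  obtain ⟨F, F1, F2⟩ := exists_inv_contOn (isCompact_closedBall 0 1) G1 G2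
  rw [G3] at F1
  have hFm : ∀ z ∈ Metric.closedBall (0 : ℂ) 1, F z ∈ Metric.closedBall (0 : ℂ) 1 ∧ G (F z) = z := by
    intro z hz
    obtain ⟨w, hw, rfl⟩ := G3.symm.subset hz
    rw [F2 w hw]; exact ⟨hw, rfl⟩
  have hfX : ∀ x ∈ X, f x ∈ Metric.closedBall (0 : ℂ) 1 := fun x hx => f3 ▸ mem_image_of_mem f hx
  refine ⟨fun x => F (f x), F1.comp f1 hfX, ?_, ?_, ?_, ?_⟩
  · intro x hx y hy h
    apply f2 hx hy
    rw [← (hFm _ (hfX x hx)).2, ← (hFm _ (hfX y hy)).2]; exact congrArg G h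
  · apply Subset.antisymm
    · rintro _ ⟨x, hx, rfl⟩; exact (hFm _ (hfX x hx)).1
    · intro z hz
      have : G z ∈ Metric.closedBall (0 : ℂ) 1 := G3 ▸ mem_image_of_mem G hz
      obtain ⟨x, hx, hxz⟩ := f3.symm.subset this
      exact ⟨x, hx, by simp only [hxz]; exact F2 z hz⟩
  · intro x hx hxB
    rw [← G4, (hFm _ (hfX x hx)).2]; exact f4 x hx hxB
  · intro x hx
    have hαx : α x ∈ Icc (-1 : ℝ) 1 := hαA ▸ mem_image_of_mem α hx
    have h5 := G5 (α x) hαx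
    simp only [hqα x hx] at h5
    simp only
    rw [← h5, F2]
    rw [mem_closedBall_zero_iff, Complex.norm_exp_ofReal_mul_I]

end Part4

section Part5
open Set Topology Filter

lemma mem_D {z : ℂ} : z ∈ Metric.closedBall (0 : ℂ) 1 ↔ z.re ^ 2 + z.im ^ 2 ≤ 1 := by
  rw [mem_closedBall_zero_iff, ← sq_le_one_iff₀ (norm_nonneg z), Complex.sq_norm,
    Complex.normSq_apply, ← sq, ← sq]

lemma norm_one_iff {z : ℂ} : ‖z‖ = 1 ↔ z.re ^ 2 + z.im ^ 2 = 1 := by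
  rw [← pow_eq_one_iff_of_nonneg (norm_nonneg z) two_ne_zero, Complex.sq_norm,
    Complex.normSq_apply, ← sq, ← sq]

/-- squeeze onto the left half disc (`e = 1`) or right half disc (`e = -1`) -/
noncomputable def hmap (e : ℝ) (z : ℂ) : ℂ := ⟨e * ((z.re - √(1 - z.im ^ 2)) / 2), z.im⟩

lemma hmap_cont (e : ℝ) : Continuous (hmap e) := by
  have : hmap e = fun z : ℂ => ((e * ((z.re - √(1 - z.im ^ 2)) / 2) : ℝ) : ℂ) + (z.im : ℂ) * Complex.I := by
    funext z; apply Complex.ext <;> simp [hmap]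
  rw [this]
  fun_prop

lemma hmap_re {e : ℝ} {z : ℂ} : (hmap e z).re = e * ((z.re - √(1 - z.im ^ 2)) / 2) := rfl
lemma hmap_im {e : ℝ} {z : ℂ} : (hmap e z).im = z.im := rfl

lemma hmap_inj {e : ℝ} (he : e ≠ 0) {z w : ℂ} (h : hmap e z = hmap e w) : z = w := by
  have h1 := congrArg Complex.re h
  have h2 := congrArg Complex.im h
  rw [hmap_im, hmap_im] at h2
  rw [hmap_re, hmap_re, h2] at h1
  have := mul_left_cancel₀ he h1
  apply Complex.ext _ h2; linarith

lemma hmap_mem {e : ℝ} (he : e ^ 2 = 1) {z : ℂ} (hz : z ∈ Metric.closedBall (0 : ℂ) 1) :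
    hmap e z ∈ Metric.closedBall (0 : ℂ) 1 := by
  rw [mem_D] at *
  rw [hmap_re, hmap_im]
  have h1 := Real.sq_sqrt (show 0 ≤ 1 - z.im ^ 2 by nlinarith [sq_nonneg z.re])
  set s := √(1 - z.im ^ 2)
  have : (e * ((z.re - s) / 2)) ^ 2 = ((z.re - s) / 2) ^ 2 := by rw [mul_pow, he, one_mul]
  rw [this]; nlinarith [sq_nonneg (z.re + s)]

lemma hmap_surj {e : ℝ} (he : e ^ 2 = 1) {z : ℂ} (hz : z ∈ Metric.closedBall (0 : ℂ) 1)
    (hze : e * z.re ≤ 0) : ∃ w ∈ Metric.closedBall (0 : ℂ) 1, hmap e w = z := by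
  rw [mem_D] at hz
  have h1 := Real.sq_sqrt (show 0 ≤ 1 - z.im ^ 2 by nlinarith [sq_nonneg z.re])
  have h2 := Real.sqrt_nonneg (1 - z.im ^ 2)
  refine ⟨⟨2 * (e * z.re) + √(1 - z.im ^ 2), z.im⟩, ?_, ?_⟩
  · rw [mem_D]
    simp only
    set s := √(1 - z.im ^ 2)
    have h3 : (e * z.re) ^ 2 = z.re ^ 2 := by rw [mul_pow, he, one_mul]
    have h4 : -s ≤ e * z.re := (abs_le_of_sq_le_sq' (by rw [h3]; linarith) h2).1
    nlinarith
  · apply Complex.ext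
    · rw [hmap_re]; simp only
      ring_nf; rw [he]; ring
    · rfl

lemma hmap_re_nonpos {e : ℝ} (he : e ^ 2 = 1) {z : ℂ} (hz : z ∈ Metric.closedBall (0 : ℂ) 1) :
    e * (hmap e z).re ≤ 0 := by
  rw [mem_D] at hz
  rw [hmap_re, ← mul_assoc, ← sq, he]
  have : z.re ≤ √(1 - z.im ^ 2) := le_trans (le_abs_self _) (Real.abs_le_sqrt (by linarith))
  linarith

lemma hmap_re_zero {e : ℝ} (he : e ≠ 0) {z : ℂ} (hz : z ∈ Metric.closedBall (0 : ℂ) 1)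
    (h : (hmap e z).re = 0) : z.re ^ 2 + z.im ^ 2 = 1 ∧ 0 ≤ z.re := by
  rw [mem_D] at hz
  rw [hmap_re] at h
  have h1 := Real.sq_sqrt (show 0 ≤ 1 - z.im ^ 2 by nlinarith [sq_nonneg z.re])
  have h2 := Real.sqrt_nonneg (1 - z.im ^ 2)
  have h3 : z.re = √(1 - z.im ^ 2) := by
    have := (mul_eq_zero.1 h).resolve_left he
    linarith
  rw [← h3] at h1 h2
  exact ⟨by linarith, h2⟩

lemma hmap_arc {e : ℝ} {z : ℂ} (h1 : z.re ^ 2 + z.im ^ 2 = 1) (h2 : 0 ≤ z.re) :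
    hmap e z = ⟨0, z.im⟩ := by
  apply Complex.ext
  · rw [hmap_re]
    have : 1 - z.im ^ 2 = z.re ^ 2 := by linarith
    rw [this, Real.sqrt_sq h2]; simp
  · rfl

lemma hmap_bdry {e : ℝ} (he : e ^ 2 = 1) {z : ℂ} (h : ‖z‖ = 1) (h' : 0 ≤ z.re → z.re = 0) :
    ‖hmap e z‖ = 1 := by
  rw [norm_one_iff] at *
  rw [hmap_re, hmap_im]
  have h3 : 1 - z.im ^ 2 = z.re ^ 2 := by linarith
  rw [h3, Real.sqrt_sq_eq_abs, mul_pow, he]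
  rcases le_or_gt 0 z.re with h4 | h4
  · have h5 := h' h4
    rw [h5] at h ⊢; rw [← h]; simp
  · rw [abs_of_neg h4]; linarith

lemma glue {E : Type*} [TopologicalSpace E] [T2Space E] [Nonempty E] {X1 X2 B1 B2 B : Set E}
    (h1 : IsDisc X1 B1) (h2 : IsDisc X2 B2) {α : E → ℝ} (hα : ContinuousOn α (X1 ∩ X2))
    (hαi : InjOn α (X1 ∩ X2)) (hαA : α '' (X1 ∩ X2) = Icc (-1) 1) (hA1 : X1 ∩ X2 ⊆ B1)
    (hA2 : X1 ∩ X2 ⊆ B2) (hB1 : ∀ x ∈ X1, x ∈ B → x ∈ B1) (hB2 : ∀ x ∈ X2, x ∈ B → x ∈ B2)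
    (hB : ∀ x ∈ X1 ∩ X2, x ∈ B → |α x| = 1) : IsDisc (X1 ∪ X2) B := by
  classical
  have hAc : IsCompact (X1 ∩ X2) := h1.1.inter h2.1
  obtain ⟨f, f1, f2, f3, f4, f5⟩ := disc_normalize h1 hAc inter_subset_left hA1 hα hαi hαA
  obtain ⟨g, g1, g2, g3, g4, g5⟩ := disc_normalize h2 hAc inter_subset_right hA2 hα hαi hαA
  refine ⟨h1.1.union h2.1, ?_⟩
  have hpi := Real.pi_pos
  have hαm : ∀ x ∈ X1 ∩ X2, α x ∈ Icc (-1 : ℝ) 1 := fun x hx => hαA ▸ mem_image_of_mem α hx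
  have harc : ∀ t ∈ Icc (-1 : ℝ) 1, 0 ≤ (Complex.exp ((Real.pi / 2 * t : ℝ) * Complex.I)).re := by
    intro t ht
    rw [Complex.exp_ofReal_mul_I_re]
    exact Real.cos_nonneg_of_neg_pi_div_two_le_of_le (by nlinarith [ht.1]) (by nlinarith [ht.2])
  have harc1 : ∀ t : ℝ, (Complex.exp ((Real.pi / 2 * t : ℝ) * Complex.I)).re ^ 2 +
      (Complex.exp ((Real.pi / 2 * t : ℝ) * Complex.I)).im ^ 2 = 1 := by
    intro t
    exact norm_one_iff.1 (Complex.norm_exp_ofReal_mul_I _)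
  -- points of the right arc come from A
  have hback : ∀ (Y : Set E) (k : E → ℂ), InjOn k Y → X1 ∩ X2 ⊆ Y →
      (∀ x ∈ X1 ∩ X2, k x = Complex.exp ((Real.pi / 2 * α x : ℝ) * Complex.I)) →
      ∀ x ∈ Y, (k x).re ^ 2 + (k x).im ^ 2 = 1 → 0 ≤ (k x).re → x ∈ X1 ∩ X2 := by
    intro Y k hk hY hkA x hx hx1 hx2
    have hn := norm_one_iff.2 hx1
    have ha := abs_le.1 (Complex.abs_arg_le_pi_div_two_iff.2 hx2)
    have ht : (k x).arg / (Real.pi / 2) ∈ Icc (-1 : ℝ) 1 := by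
      constructor
      · rw [le_div_iff₀ (by positivity)]; linarith
      · rw [div_le_iff₀ (by positivity)]; linarith
    rw [← hαA] at ht
    obtain ⟨a, haA, hat⟩ := ht
    have h5 := hkA a haA
    rw [hat, mul_div_cancel₀ _ (by positivity)] at h5
    have h6 := Complex.norm_mul_exp_arg_mul_I (k x)
    rw [hn] at h6
    have : k a = k x := by rw [h5]; simpa using h6
    rw [← hk (hY haA) hx this]; exact haA
  have hfb := hback X1 f f2 inter_subset_left f5
  have hgb := hback X2 g g2 inter_subset_right g5
  have hfX : ∀ x ∈ X1, f x ∈ Metric.closedBall (0 : ℂ) 1 := fun x hx => f3 ▸ mem_image_of_mem f hx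
  have hgX : ∀ x ∈ X2, g x ∈ Metric.closedBall (0 : ℂ) 1 := fun x hx => g3 ▸ mem_image_of_mem g hx
  let h : E → ℂ := fun x => if x ∈ X1 then hmap 1 (f x) else hmap (-1) (g x)
  have hh1 : ∀ x ∈ X1, h x = hmap 1 (f x) := fun x hx => if_pos hx
  have hh2 : ∀ x ∈ X2, h x = hmap (-1) (g x) := by
    intro x hx
    by_cases hx1 : x ∈ X1
    · rw [hh1 x hx1, f5 x ⟨hx1, hx⟩, g5 x ⟨hx1, hx⟩, hmap_arc (harc1 _) (harc _ (hαm _ ⟨hx1, hx⟩)),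
        hmap_arc (harc1 _) (harc _ (hαm _ ⟨hx1, hx⟩))]
    · exact if_neg hx1
  have e1 : (1 : ℝ) ^ 2 = 1 := by norm_num
  have e2 : (-1 : ℝ) ^ 2 = 1 := by norm_num
  have i1 : ∀ x ∈ X1, ∀ y ∈ X1, h x = h y → x = y := by
    intro x hx y hy hxy
    rw [hh1 x hx, hh1 y hy] at hxy
    exact f2 hx hy (hmap_inj one_ne_zero hxy)
  have i2 : ∀ x ∈ X2, ∀ y ∈ X2, h x = h y → x = y := by
    intro x hx y hy hxy
    rw [hh2 x hx, hh2 y hy] at hxy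
    exact g2 hx hy (hmap_inj (by norm_num) hxy)
  have i12 : ∀ x ∈ X1, ∀ y ∈ X2, h x = h y → x = y := by
    intro x hx y hy hxy
    have hxy' := hxy
    rw [hh1 x hx, hh2 y hy] at hxy'
    have a1 := hmap_re_nonpos e1 (hfX x hx)
    have a2 := hmap_re_nonpos e2 (hgX y hy)
    rw [← hxy'] at a2
    obtain ⟨b1, b2⟩ := hmap_re_zero one_ne_zero (hfX x hx) (by linarith)
    exact i2 x (hfb x hx b1 b2).2 y hy hxy
  refine ⟨h, ?_, ?_, ?_, ?_⟩
  · apply ContinuousOn.union_of_isClosed _ _ h1.1.isClosed h2.1.isClosed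
    · exact ((hmap_cont 1).comp_continuousOn f1).congr hh1
    · exact ((hmap_cont (-1)).comp_continuousOn g1).congr hh2
  · rintro x (hx | hx) y (hy | hy) hxy
    · exact i1 x hx y hy hxy
    · exact i12 x hx y hy hxy
    · exact (i12 y hy x hx hxy.symm).symm
    · exact i2 x hx y hy hxy
  · apply Subset.antisymm
    · rintro _ ⟨x, hx | hx, rfl⟩
      · rw [hh1 x hx]; exact hmap_mem e1 (hfX x hx)
      · rw [hh2 x hx]; exact hmap_mem e2 (hgX x hx)
    · intro z hz
      rcases le_total z.re 0 with hz0 | hz0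
      · obtain ⟨w, hw, rfl⟩ := hmap_surj e1 hz (by linarith)
        obtain ⟨x, hx, rfl⟩ := f3.symm.subset hw
        exact ⟨x, Or.inl hx, hh1 x hx⟩
      · obtain ⟨w, hw, rfl⟩ := hmap_surj e2 hz (by linarith)
        obtain ⟨x, hx, rfl⟩ := g3.symm.subset hw
        exact ⟨x, Or.inr hx, hh2 x hx⟩
  · have hend : ∀ x ∈ X1 ∩ X2, x ∈ B →
        (Complex.exp ((Real.pi / 2 * α x : ℝ) * Complex.I)).re = 0 := by
      intro x hx hxB
      rw [Complex.exp_ofReal_mul_I_re]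
      rcases eq_or_eq_neg_of_abs_eq (hB x hx hxB) with h | h <;> rw [h] <;> simp
    rintro x (hx | hx) hxB
    · rw [hh1 x hx]
      have hn := f4 x hx (hB1 x hx hxB)
      refine hmap_bdry e1 hn fun h0 => ?_
      have hxA := hfb x hx (norm_one_iff.1 hn) h0
      rw [f5 x hxA]; exact hend x hxA hxB
    · rw [hh2 x hx]
      have hn := g4 x hx (hB2 x hx hxB)
      refine hmap_bdry e2 hn fun h0 => ?_
      have hxA := hgb x hx (norm_one_iff.1 hn) h0
      rw [g5 x hxA]; exact hend x hxA hxB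

/-- a single triangle is a disc -/
lemma triangle_disc {V : Type*} [Fintype V] [DecidableEq V] {a b c : V} (hab : a ≠ b) (hac : a ≠ c)
    (hbc : b ≠ c) :
    IsDisc (R {({a, b, c} : Finset V)}) {w | w a = 0 ∨ w b = 0 ∨ w c = 0} := by
  refine ⟨R_compact _, ?_⟩
  let S : Set ℂ := {z | 0 ≤ z.re ∧ 0 ≤ z.im ∧ z.re + z.im ≤ 1}
  have hSm : ∀ z, z ∈ S ↔ 0 ≤ z.re ∧ 0 ≤ z.im ∧ z.re + z.im ≤ 1 := fun z => by simp [S]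
  have hSc : Convex ℝ S := by
    intro z hz w hw p q hp hq hpq
    rw [hSm] at *
    simp only [Complex.add_re, Complex.add_im, Complex.smul_re, Complex.smul_im, smul_eq_mul]
    refine ⟨by nlinarith, by nlinarith, by nlinarith⟩
  have hScl : IsClosed S := by
    have : S = {z | 0 ≤ z.re} ∩ ({z | 0 ≤ z.im} ∩ {z | z.re + z.im ≤ 1}) := by
      ext z; simp [hSm]
    rw [this]
    exact (isClosed_le continuous_const Complex.continuous_re).inter
      ((isClosed_le continuous_const Complex.continuous_im).inter
        (isClosed_le (Complex.continuous_re.add Complex.continuous_im) continuous_const))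
  have hSi : (interior S).Nonempty := by
    have hO : IsOpen {z : ℂ | 0 < z.re ∧ 0 < z.im ∧ z.re + z.im < 1} := by
      have : {z : ℂ | 0 < z.re ∧ 0 < z.im ∧ z.re + z.im < 1} =
        {z | 0 < z.re} ∩ ({z | 0 < z.im} ∩ {z | z.re + z.im < 1}) := by ext z; simp
      rw [this]
      exact (isOpen_lt continuous_const Complex.continuous_re).inter
        ((isOpen_lt continuous_const Complex.continuous_im).inter
        (isOpen_lt (Complex.continuous_re.add Complex.continuous_im) continuous_const))
    refine ⟨⟨1/4, 1/4⟩, interior_maximal ?_ hO (by simp only [mem_ofPred_eq]; norm_num)⟩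
    intro z hz
    simp only [mem_ofPred_eq] at hz
    exact (hSm z).2 ⟨hz.1.le, hz.2.1.le, hz.2.2.le⟩
  have hSb : Bornology.IsBounded S := by
    apply Bornology.IsBounded.subset (Metric.isBounded_closedBall (x := (0 : ℂ)) (r := 1))
    intro z hz
    rw [hSm] at hz
    rw [mem_D]; nlinarith
  obtain ⟨h, -, hcl, hfr⟩ := exists_homeomorph_image_interior_closure_frontier_eq_unitBall hSc hSi hSb
  rw [hScl.closure_eq] at hcl
  have hR : ∀ w, w ∈ R {({a, b, c} : Finset V)} ↔ (∀ i, 0 ≤ w i) ∧ w a + w b + w c = 1 ∧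
      ∀ i, w i ≠ 0 → i = a ∨ i = b ∨ i = c := by
    intro w
    rw [mem_R]
    simp only [mem_singleton_iff, exists_eq_left, Finset.mem_insert, Finset.mem_singleton]
    refine and_congr_right fun h0 => and_congr_left fun h1 => ?_
    have : ∑ i, w i = ∑ i ∈ ({a, b, c} : Finset V), w i := by
      symm; apply Finset.sum_subset (Finset.subset_univ _)
      intro i _ hi; by_contra h; apply hi; simpa using h1 i h
    rw [this, Finset.sum_insert (by simp [hab, hac]), Finset.sum_insert (by simp [hbc]),
      Finset.sum_singleton, add_assoc]
  let p : (V → ℝ) → ℂ := fun w => (w a : ℂ) + (w b : ℂ) * Complex.I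
  have hpre : ∀ w, (p w).re = w a := fun w => by simp [p]
  have hpim : ∀ w, (p w).im = w b := fun w => by simp [p]
  have hpS : ∀ w ∈ R {({a, b, c} : Finset V)}, p w ∈ S := by
    intro w hw
    obtain ⟨h0, h1, -⟩ := (hR w).1 hw
    rw [hSm, hpre, hpim]
    exact ⟨h0 a, h0 b, by linarith [h0 c]⟩
  refine ⟨fun w => h (p w), h.continuous.comp_continuousOn (by fun_prop), ?_, ?_, ?_⟩
  · intro w hw w' hw' hww
    have hp := h.injective hww
    obtain ⟨h0, h1, h2⟩ := (hR w).1 hw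
    obtain ⟨h0', h1', h2'⟩ := (hR w').1 hw'
    have ha : w a = w' a := by rw [← hpre w, ← hpre w', hp]
    have hb : w b = w' b := by rw [← hpim w, ← hpim w', hp]
    have hc : w c = w' c := by linarith
    funext i
    by_cases hi : i = a ∨ i = b ∨ i = c
    · rcases hi with rfl | rfl | rfl <;> assumption
    · rw [not_not.1 (mt (h2 i) hi), not_not.1 (mt (h2' i) hi)]
  · rw [← hcl, ← image_image (g := h) (f := p)]
    congr 1
    apply Subset.antisymm
    · rintro _ ⟨w, hw, rfl⟩; exact hpS w hw
    · intro z hz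
      rw [hSm] at hz
      refine ⟨fun i => if i = a then z.re else if i = b then z.im else if i = c then
        1 - z.re - z.im else 0, ?_, ?_⟩
      · rw [hR]
        refine ⟨fun i => ?_, ?_, ?_⟩
        · split_ifs <;> linarith
        · simp [hab.symm, hac.symm, hbc.symm]
        · intro i hi; by_contra hcon; push Not at hcon; simp [hcon] at hi
      · apply Complex.ext
        · simp [p, hab.symm]
        · simp [p, hab.symm]
  · intro w hw hwB
    obtain ⟨h0, h1, h2⟩ := (hR w).1 hw
    have : p w ∈ frontier S := by
      rw [hScl.frontier_eq]
      refine ⟨hpS w hw, fun hint => ?_⟩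
      obtain ⟨r, hr, hball⟩ := Metric.isOpen_iff.1 isOpen_interior _ hint
      have hmem : ∀ d : ℂ, ‖d‖ < r → p w + d ∈ S := fun d hd =>
        interior_subset (hball (by simpa [dist_eq_norm] using hd))
      simp only [mem_ofPred_eq] at hwB
      rcases hwB with h | h | h
      · have := ((hSm _).1 (hmem (-(r / 2 : ℝ)) (by rw [norm_neg, Complex.norm_real, Real.norm_eq_abs, abs_of_pos] <;> linarith))).1
        rw [Complex.add_re, hpre, Complex.neg_re, Complex.ofReal_re] at this; linarith
      · have := ((hSm _).1 (hmem (-(r / 2 : ℝ) * Complex.I) (by rw [norm_mul, Complex.norm_I, norm_neg, Complex.norm_real, Real.norm_eq_abs, abs_of_pos] <;> linarith))).2.1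
        rw [Complex.add_im, hpim] at this
        simp at this
        linarith
      · have := ((hSm _).1 (hmem ((r / 2 : ℝ)) (by rw [Complex.norm_real, Real.norm_eq_abs, abs_of_pos] <;> linarith))).2.2
        rw [Complex.add_re, Complex.add_im, hpre, hpim, Complex.ofReal_re, Complex.ofReal_im] at this; linarith
    have h6 : h (p w) ∈ Metric.sphere (0 : ℂ) 1 := hfr ▸ mem_image_of_mem h this
    simpa using h6

end Part5

section Part6
open Set Topology Filter

variable {V : Type*} [Fintype V]

lemma R_union (S T : Set (Finset V)) : R (S ∪ T) = R S ∪ R T := by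
  ext w
  simp only [mem_R, mem_union]
  constructor
  · rintro ⟨h0, h1, s, hs | hs, h⟩
    · exact Or.inl ⟨h0, h1, s, hs, h⟩
    · exact Or.inr ⟨h0, h1, s, hs, h⟩
  · rintro (⟨h0, h1, s, hs, h⟩ | ⟨h0, h1, s, hs, h⟩)
    · exact ⟨h0, h1, s, Or.inl hs, h⟩
    · exact ⟨h0, h1, s, Or.inr hs, h⟩

lemma R_refine {S T : Set (Finset V)} (h : ∀ s ∈ S, ∃ t ∈ T, s ⊆ t) : R S ⊆ R T := by
  intro w hw
  obtain ⟨h0, h1, s, hs, h2⟩ := mem_R.1 hw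
  obtain ⟨t, ht, hst⟩ := h s hs
  exact mem_R.2 ⟨h0, h1, t, ht, fun i hi => hst (h2 i hi)⟩

lemma IsDisc.closure {E : Type*} [TopologicalSpace E] [T2Space E] {X B B' : Set E} (h : IsDisc X B)
    (hB : ∀ x ∈ X, x ∈ B' → x ∈ _root_.closure (X ∩ B)) : IsDisc X B' := by
  obtain ⟨hX, f, f1, f2, f3, f4⟩ := h
  refine ⟨hX, f, f1, f2, f3, fun x hx hxB => ?_⟩
  have hc := hB x hx hxB
  have h1 : ContinuousWithinAt f (X ∩ B) x := (f1 x hx).mono inter_subset_left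
  have h2 := h1.mem_closure_image hc
  have h3 : _root_.closure (f '' (X ∩ B)) ⊆ Metric.sphere 0 1 := by
    apply closure_minimal _ Metric.isClosed_sphere
    rintro _ ⟨y, hy, rfl⟩
    simpa using f4 y hy.1 hy.2
  simpa using h3 h2

lemma IsDisc.mono {E : Type*} [TopologicalSpace E] {X B B' : Set E} (h : IsDisc X B)
    (hB : ∀ x ∈ X, x ∈ B' → x ∈ B) : IsDisc X B' := by
  obtain ⟨hX, f, f1, f2, f3, f4⟩ := h
  exact ⟨hX, f, f1, f2, f3, fun x hx hxB => f4 x hx (hB x hx hxB)⟩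

/-- relative interiors of the simplices in `E` -/
def Bo (E : Set (Finset V)) : Set (V → ℝ) := {w | ∃ f ∈ E, ∀ i, w i ≠ 0 ↔ i ∈ f}

lemma mem_Bo {E : Set (Finset V)} {w : V → ℝ} : w ∈ Bo E ↔ ∃ f ∈ E, ∀ i, w i ≠ 0 ↔ i ∈ f := by
  simp [Bo]

lemma mem_closure_Bo [DecidableEq V] {T E : Set (Finset V)} (hE : ∀ f ∈ E, ∃ s ∈ T, f ⊆ s)
    {w : V → ℝ}
    (hw : w ∈ R E) : w ∈ closure (R T ∩ Bo E) := by
  obtain ⟨h0, h1, f, hf, h2⟩ := mem_R.1 hw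
  obtain ⟨s, hs, hfs⟩ := hE f hf
  have hfn : f.Nonempty := by
    by_contra hne
    rw [Finset.not_nonempty_iff_eq_empty] at hne
    subst hne
    have : ∀ i, w i = 0 := fun i => by by_contra h; simpa using h2 i h
    simp [this] at h1
  have hfc : (0 : ℝ) < f.card := by exact_mod_cast hfn.card_pos
  let u : V → ℝ := fun i => if i ∈ f then 1 / (f.card : ℝ) else 0
  have hu1 : ∑ i, u i = 1 := by simp [u]; field_simp
  have hlim : Tendsto (fun ε : ℝ => (fun i => (1 - ε) * w i + ε * u i)) (𝓝[>] 0) (𝓝 w) := by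
    have : Continuous (fun ε : ℝ => (fun i => (1 - ε) * w i + ε * u i)) := by fun_prop
    have h3 := (this.tendsto 0).mono_left (nhdsWithin_le_nhds (s := Ioi 0))
    simpa using h3
  refine mem_closure_of_tendsto hlim ?_
  have : ∀ᶠ ε : ℝ in 𝓝[>] 0, ε ∈ Ioo (0 : ℝ) 1 := Ioo_mem_nhdsGT one_pos
  filter_upwards [this] with ε hε
  have hz : ∀ i, (1 - ε) * w i + ε * u i ≠ 0 ↔ i ∈ f := by
    intro i
    by_cases hi : i ∈ f
    · simp only [u, hi, if_true, iff_true]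
      have : 0 ≤ (1 - ε) * w i := mul_nonneg (by linarith [hε.2]) (h0 i)
      have : 0 < ε * (1 / (f.card : ℝ)) := mul_pos hε.1 (by positivity)
      linarith
    · have : w i = 0 := by by_contra h; exact hi (h2 i h)
      simp [u, hi, this]
  refine ⟨mem_R.2 ⟨fun i => ?_, ?_, s, hs, fun i hi => hfs ((hz i).1 hi)⟩, mem_Bo.2 ⟨f, hf, hz⟩⟩
  · have : 0 ≤ u i := by simp only [u]; split_ifs <;> positivity
    have := h0 i; have := hε.1; have := hε.2
    have : 0 ≤ (1 - ε) * w i := mul_nonneg (by linarith [hε.2]) (h0 i)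
    positivity
  · rw [Finset.sum_add_distrib, ← Finset.mul_sum, ← Finset.mul_sum, h1, hu1]; ring

lemma glue_complex [DecidableEq V] {T1 T2 A E1 E2 E : Set (Finset V)} (h1 : IsDisc (R T1) (R E1))
    (h2 : IsDisc (R T2) (R E2)) (hA : R T1 ∩ R T2 = R A) {α : (V → ℝ) → ℝ} (hα : Continuous α)
    (hαi : InjOn α (R A)) (hαA : α '' (R A) = Icc (-1) 1) (hAE1 : A ⊆ E1) (hAE2 : A ⊆ E2)
    (hAc : ∀ e ∈ A, e.card = 2) (hE1 : ∀ f ∈ E1, ∃ s ∈ T1, f ⊆ s) (hE2 : ∀ f ∈ E2, ∃ s ∈ T2, f ⊆ s)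
    (hE : ∀ f ∈ E, f.card = 2 ∧ f ∉ A ∧ (f ∈ E1 ∨ f ∈ E2)) :
    IsDisc (R (T1 ∪ T2)) (R E) := by
  have hET : ∀ f ∈ E, ∃ s ∈ T1 ∪ T2, f ⊆ s := by
    intro f hf
    rcases (hE f hf).2.2 with h | h
    · obtain ⟨s, hs, hfs⟩ := hE1 f h; exact ⟨s, Or.inl hs, hfs⟩
    · obtain ⟨s, hs, hfs⟩ := hE2 f h; exact ⟨s, Or.inr hs, hfs⟩
  have hsub1 : R A ⊆ R E1 := R_refine fun s hs => ⟨s, hAE1 hs, subset_rfl⟩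
  have hsub2 : R A ⊆ R E2 := R_refine fun s hs => ⟨s, hAE2 hs, subset_rfl⟩
  have hBoR : ∀ S : Set (Finset V), ∀ w ∈ R S, ∀ f, (∀ i, w i ≠ 0 ↔ i ∈ f) → ∀ F : Set (Finset V),
      f ∈ F → w ∈ R F := by
    intro S w hw f hf F hF
    obtain ⟨a0, a1, -⟩ := mem_R.1 hw
    exact mem_R.2 ⟨a0, a1, f, hF, fun i hi => (hf i).1 hi⟩
  refine IsDisc.closure (B := Bo E) ?_ fun x _ hx => mem_closure_Bo hET hx
  rw [R_union]
  refine glue h1 h2 (α := α) (hα.continuousOn) (by rw [hA]; exact hαi) (by rw [hA]; exact hαA)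
    (by rw [hA]; exact hsub1) (by rw [hA]; exact hsub2) ?_ ?_ ?_
  · intro w hw hwB
    obtain ⟨f, hf, hfw⟩ := mem_Bo.1 hwB
    rcases (hE f hf).2.2 with h | h
    · exact hBoR _ w hw f hfw _ h
    · have : w ∈ R T2 := R_refine hE2 (hBoR _ w hw f hfw _ h)
      exact hsub1 (hA ▸ ⟨hw, this⟩)
  · intro w hw hwB
    obtain ⟨f, hf, hfw⟩ := mem_Bo.1 hwB
    rcases (hE f hf).2.2 with h | h
    · have : w ∈ R T1 := R_refine hE1 (hBoR _ w hw f hfw _ h)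
      exact hsub2 (hA ▸ ⟨this, hw⟩)
    · exact hBoR _ w hw f hfw _ h
  · intro w hw hwB
    exfalso
    obtain ⟨f, hf, hfw⟩ := mem_Bo.1 hwB
    rw [hA] at hw
    obtain ⟨-, -, e, he, hwe⟩ := mem_R.1 hw
    have hfe : f ⊆ e := fun i hi => hwe i ((hfw i).2 hi)
    have := Finset.eq_of_subset_of_card_le hfe (by rw [(hE f hf).1, hAc e he])
    exact (hE f hf).2.1 (this ▸ he)

lemma sum_pair_R [DecidableEq V] {a b : V} (hab : a ≠ b) {w : V → ℝ} (h1 : ∑ i, w i = 1)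
    (h2 : ∀ i, w i ≠ 0 → i ∈ ({a, b} : Finset V)) : w a + w b = 1 := by
  rw [← h1, ← Finset.sum_pair hab]
  apply Finset.sum_subset (Finset.subset_univ _)
  intro i _ hi; by_contra h; exact hi (h2 i h)

/-- parametrization of a path `a - v - b` -/
lemma arc_two [DecidableEq V] {a b v : V} (hab : a ≠ b) (hav : a ≠ v) (hbv : b ≠ v) :
    let A : Set (Finset V) := {{a, v}, {b, v}}
    Continuous (fun w : V → ℝ => w b - w a) ∧ InjOn (fun w : V → ℝ => w b - w a) (R A) ∧
      (fun w : V → ℝ => w b - w a) '' (R A) = Icc (-1) 1 := by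
  intro A
  have hR : ∀ w, w ∈ R A ↔ (∀ i, 0 ≤ w i) ∧ ∑ i, w i = 1 ∧
      ((∀ i, w i ≠ 0 → i ∈ ({a, v} : Finset V)) ∨ (∀ i, w i ≠ 0 → i ∈ ({b, v} : Finset V))) := by
    intro w; rw [mem_R]; simp [A]
  have key : ∀ w ∈ R A, w a = max 0 (-(w b - w a)) ∧ w b = max 0 (w b - w a) ∧
      w v = 1 - w a - w b ∧ (∀ i, i ≠ a → i ≠ b → i ≠ v → w i = 0) := by
    intro w hw
    obtain ⟨h0, h1, h | h⟩ := (hR w).1 hw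
    · have hb : w b = 0 := by by_contra hne; simpa [hab.symm, hbv] using h b hne
      have := sum_pair_R hav h1 h
      refine ⟨?_, ?_, by linarith, ?_⟩
      · rw [hb, max_eq_right]; ring; linarith [h0 a]
      · rw [hb, max_eq_left]; linarith [h0 a]
      · intro i ha hb hv; by_contra hne; simpa [ha, hv] using h i hne
    · have ha : w a = 0 := by by_contra hne; simpa [hab, hav] using h a hne
      have := sum_pair_R hbv h1 h
      refine ⟨?_, ?_, by linarith, ?_⟩
      · rw [ha, max_eq_left]; linarith [h0 b]
      · rw [ha, max_eq_right]; ring; linarith [h0 b]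
      · intro i ha hb hv; by_contra hne; simpa [hb, hv] using h i hne
  refine ⟨by fun_prop, ?_, ?_⟩
  · intro w hw w' hw' hww
    simp only at hww
    obtain ⟨k1, k2, k3, k4⟩ := key w hw
    obtain ⟨l1, l2, l3, l4⟩ := key w' hw'
    have ha : w a = w' a := by rw [k1, l1, hww]
    have hb : w b = w' b := by rw [k2, l2, hww]
    have hv : w v = w' v := by rw [k3, l3, ha, hb]
    funext i
    by_cases i1 : i = a
    · subst i1; exact ha
    by_cases i2 : i = b
    · subst i2; exact hb
    by_cases i3 : i = v
    · subst i3; exact hv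
    rw [k4 i i1 i2 i3, l4 i i1 i2 i3]
  · apply Subset.antisymm
    · rintro _ ⟨w, hw, rfl⟩
      obtain ⟨h0, h1, h⟩ := (hR w).1 hw
      obtain ⟨k1, k2, k3, k4⟩ := key w hw
      have := h0 a; have := h0 b; have := h0 v
      constructor <;> simp only <;> linarith
    · intro t ht
      refine ⟨fun i => if i = a then max 0 (-t) else if i = b then max 0 t else if i = v then
        1 - |t| else 0, ?_, ?_⟩
      · have hsum : ∑ i, (if i = a then max 0 (-t) else if i = b then max 0 t else if i = v then
            1 - |t| else 0) = max 0 (-t) + (max 0 t + (1 - |t|)) := by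
          rw [← Finset.sum_subset (Finset.subset_univ ({a, b, v} : Finset V)),
            Finset.sum_insert (by simp [hab, hav]), Finset.sum_pair hbv]
          · simp [hab.symm, hav.symm, hbv.symm]
          · intro i _ hi; simp at hi; simp [hi]
        rw [hR]
        refine ⟨fun i => ?_, ?_, ?_⟩
        · have := abs_le.2 ht
          split_ifs <;> first | positivity | linarith | simp
        · rw [hsum]
          rcases le_total t 0 with h | h
          · rw [abs_of_nonpos h, max_eq_right (by linarith), max_eq_left h]; ring
          · rw [abs_of_nonneg h, max_eq_left (by linarith), max_eq_right h]; ring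
        · rcases le_total t 0 with h | h
          · left
            intro i hi; by_contra hcon; simp at hcon
            apply hi; simp [hcon, h]
          · right
            intro i hi; by_contra hcon; simp at hcon
            apply hi; simp [hcon, h]
      · simp only [if_true, if_neg hab.symm]
        rcases le_total t 0 with h | h
        · rw [max_eq_left h, max_eq_right (by linarith)]; ring
        · rw [max_eq_right h, max_eq_left (by linarith)]; ring

lemma arc_one [DecidableEq V] {a v : V} (hav : a ≠ v) :
    let A : Set (Finset V) := {{a, v}}
    Continuous (fun w : V → ℝ => 2 * w v - 1) ∧ InjOn (fun w : V → ℝ => 2 * w v - 1) (R A) ∧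
      (fun w : V → ℝ => 2 * w v - 1) '' (R A) = Icc (-1) 1 := by
  intro A
  have hR : ∀ w, w ∈ R A ↔ (∀ i, 0 ≤ w i) ∧ ∑ i, w i = 1 ∧
      (∀ i, w i ≠ 0 → i ∈ ({a, v} : Finset V)) := by
    intro w; rw [mem_R]; simp [A]
  refine ⟨by fun_prop, ?_, ?_⟩
  · intro w hw w' hw' hww
    simp only at hww
    obtain ⟨h0, h1, h2⟩ := (hR w).1 hw
    obtain ⟨h0', h1', h2'⟩ := (hR w').1 hw'
    have e1 := sum_pair_R hav h1 h2
    have e2 := sum_pair_R hav h1' h2'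
    funext i
    by_cases i1 : i = a
    · subst i1; linarith
    by_cases i3 : i = v
    · subst i3; linarith
    rw [not_not.1 (mt (h2 i) (by simp [i1, i3])), not_not.1 (mt (h2' i) (by simp [i1, i3]))]
  · apply Subset.antisymm
    · rintro _ ⟨w, hw, rfl⟩
      obtain ⟨h0, h1, h2⟩ := (hR w).1 hw
      have e1 := sum_pair_R hav h1 h2
      have := h0 a; have := h0 v
      constructor <;> simp only <;> linarith
    · intro t ht
      have h1 := ht.1
      have h2 := ht.2
      refine ⟨fun i => if i = a then (1 - t) / 2 else if i = v then (1 + t) / 2 else 0, ?_, ?_⟩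
      · rw [hR]
        refine ⟨fun i => ?_, ?_, ?_⟩
        · split_ifs <;> linarith
        · rw [← Finset.sum_subset (Finset.subset_univ ({a, v} : Finset V)), Finset.sum_pair hav]
          · simp [hav.symm]; ring
          · intro i _ hi; simp at hi; simp [hi]
        · intro i hi; by_contra hcon; simp at hcon; simp [hcon] at hi
      · simp [hav.symm]; ring

end Part6

section Part7
open Set Topology Filter Relation

variable {V : Type*} [DecidableEq V]

/-- number of triangles containing `e` -/
def deg (T : Finset (Finset V)) (e : Finset V) : ℕ := (T.filter (e ⊆ ·)).card

/-- boundary edges -/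
def Bd (T : Finset (Finset V)) : Set (Finset V) := {e | e.card = 2 ∧ deg T e = 1}

lemma mem_Bd {T : Finset (Finset V)} {e : Finset V} : e ∈ Bd T ↔ e.card = 2 ∧ deg T e = 1 := by
  simp [Bd]

/-- dual adjacency of triangles containing `A` -/
def Rel (T : Finset (Finset V)) (A s t : Finset V) : Prop :=
  s ∈ T ∧ t ∈ T ∧ A ⊆ s ∧ A ⊆ t ∧ 2 ≤ (s ∩ t).card

/-- combinatorial discs -/
structure Good (T : Finset (Finset V)) : Prop where
  tri : ∀ t ∈ T, t.card = 3
  deg2 : ∀ e : Finset V, e.card = 2 → deg T e ≤ 2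
  conn : ∀ A : Finset V, A.card ≤ 1 → ∀ s ∈ T, ∀ t ∈ T, A ⊆ s → A ⊆ t → ReflTransGen (Rel T A) s t
  bd : ∃ e, e ∈ Bd T
  coh : ∀ c : Finset V → ZMod 2, (∀ x y z, x ≠ y → x ≠ z → y ≠ z → {x, y, z} ∈ T →
    c {x, y} + c {x, z} + c {y, z} = 0) → ∃ g : V → ZMod 2, ∀ t ∈ T, ∀ x ∈ t, ∀ y ∈ t, x ≠ y →
      c {x, y} = g x + g y

lemma Rel.symm {T : Finset (Finset V)} {A s t : Finset V} (h : Rel T A s t) : Rel T A t s :=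
  ⟨h.2.1, h.1, h.2.2.2.1, h.2.2.1, by rw [Finset.inter_comm]; exact h.2.2.2.2⟩

lemma RTG.symm {T : Finset (Finset V)} {A s t : Finset V} (h : ReflTransGen (Rel T A) s t) :
    ReflTransGen (Rel T A) t s := by
  induction h with
  | refl => exact ReflTransGen.refl
  | tail _ h2 ih => exact ReflTransGen.head h2.symm ih

lemma RTG.mono {T : Finset (Finset V)} {A B s t : Finset V} (hAB : A ⊆ B)
    (h : ReflTransGen (Rel T B) s t) : ReflTransGen (Rel T A) s t := by
  induction h with
  | refl => exact ReflTransGen.refl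
  | tail _ h ih =>
    exact ih.tail ⟨h.1, h.2.1, hAB.trans h.2.2.1, hAB.trans h.2.2.2.1, h.2.2.2.2⟩

lemma deg_mono {T T1 : Finset (Finset V)} (h : T1 ⊆ T) (e : Finset V) : deg T1 e ≤ deg T e :=
  Finset.card_le_card (Finset.filter_subset_filter _ h)

lemma deg_pos {T : Finset (Finset V)} {e s : Finset V} (hs : s ∈ T) (he : e ⊆ s) : 1 ≤ deg T e :=
  Finset.card_pos.2 ⟨s, Finset.mem_filter.2 ⟨hs, he⟩⟩

lemma deg_one_unique {T : Finset (Finset V)} {e s s' : Finset V} (h : deg T e = 1) (hs : s ∈ T)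
    (he : e ⊆ s) (hs' : s' ∈ T) (he' : e ⊆ s') : s = s' :=
  Finset.card_le_one.1 h.le s (Finset.mem_filter.2 ⟨hs, he⟩) s' (Finset.mem_filter.2 ⟨hs', he'⟩)

lemma deg_one_of {T : Finset (Finset V)} {e s : Finset V} (hs : s ∈ T)
    (he : e ⊆ s) (h : ∀ s' ∈ T, e ⊆ s' → s' = s) : deg T e = 1 := by
  refine le_antisymm (Finset.card_le_one.2 ?_) (deg_pos hs he)
  intro x hx y hy
  rw [Finset.mem_filter] at hx hy
  rw [h x hx.1 hx.2, h y hy.1 hy.2]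

lemma deg_two_unique {T : Finset (Finset V)} {e t s s' : Finset V} (h : deg T e ≤ 2) (ht : t ∈ T)
    (het : e ⊆ t) (hs : s ∈ T)
    (he : e ⊆ s) (hs' : s' ∈ T) (he' : e ⊆ s') (h1 : s ≠ t) (h2 : s' ≠ t) : s = s' := by
  by_contra hne
  have hsub : ({t, s, s'} : Finset (Finset V)) ⊆ T.filter (e ⊆ ·) := by
    intro x hx
    simp only [Finset.mem_insert, Finset.mem_singleton] at hx
    rw [Finset.mem_filter]
    rcases hx with rfl | rfl | rfl
    · exact ⟨ht, het⟩
    · exact ⟨hs, he⟩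
    · exact ⟨hs', he'⟩
  have h3 := Finset.card_le_card hsub
  rw [Finset.card_insert_of_notMem (by simp [h1.symm, h2.symm]), Finset.card_pair hne] at h3
  unfold deg at h; omega

lemma deg_two_of {T : Finset (Finset V)} {e t s : Finset V} (ht : t ∈ T) (het : e ⊆ t) (hs : s ∈ T)
    (he : e ⊆ s) (h1 : s ≠ t) : deg T e ≠ 1 := fun h => h1 (deg_one_unique h hs he ht het)

lemma retract {T T1 : Finset (Finset V)} {A : Finset V}
    (hex : ∀ n ∈ T1, ∀ n' ∈ T1, ∀ y ∈ T, ∀ y' ∈ T, y ∉ T1 → y' ∉ T1 → A ⊆ n → A ⊆ n' → A ⊆ y →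
      A ⊆ y' → 2 ≤ (n ∩ y).card → 2 ≤ (n' ∩ y').card → ReflTransGen (Rel T1 A) n n')
    {s s' : Finset V} (hs : s ∈ T1) (hs' : s' ∈ T1) (h : ReflTransGen (Rel T A) s s') :
    ReflTransGen (Rel T1 A) s s' := by
  have key : (s' ∈ T1 → ReflTransGen (Rel T1 A) s s') ∧ (s' ∉ T1 → ∀ n ∈ T1, A ⊆ n →
      (∃ y ∈ T, y ∉ T1 ∧ A ⊆ y ∧ 2 ≤ (n ∩ y).card) → ReflTransGen (Rel T1 A) s n) := by
    clear hs'
    induction h with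
    | refl => exact ⟨fun _ => ReflTransGen.refl, fun h => absurd hs h⟩
    | @tail z z' _ h2 ih =>
      obtain ⟨r1, r2, r3, r4, r5⟩ := h2
      by_cases hz : z ∈ T1
      · have ih1 := ih.1 hz
        refine ⟨fun hz' => ih1.tail ⟨hz, hz', r3, r4, r5⟩, fun hz' n hn hAn hy => ?_⟩
        obtain ⟨y, hy, hyT, hAy, hyc⟩ := hy
        exact ih1.trans (hex z hz n hn z' r2 y hy hz' hyT r3 hAn r4 hAy r5 hyc)
      · have ih2 := ih.2 hz
        refine ⟨fun hz' => ih2 z' hz' r4 ⟨z, r1, hz, r3, by rwa [Finset.inter_comm]⟩, fun _ => ih2⟩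
  exact key.1 hs'

lemma sub_good {T T1 : Finset (Finset V)} (hT : Good T) {a b v : V} (hab : a ≠ b) (hav : a ≠ v)
    (hbv : b ≠ v) (ht : {a, b, v} ∈ T) (hdeg : deg T {a, b} = 1) (hsub : T1 ⊆ T.erase {a, b, v})
    (sep : ∀ s1 ∈ T1, ∀ s ∈ T, s ≠ {a, b, v} → s ∉ T1 → (s1 ∩ s).card < 2)
    (exit : ∀ A : Finset V, A.card ≤ 1 → ∀ n ∈ T1, ∀ n' ∈ T1, A ⊆ {a, b, v} → A ⊆ n → A ⊆ n' →
      2 ≤ (n ∩ {a, b, v}).card → 2 ≤ (n' ∩ {a, b, v}).card → ReflTransGen (Rel T1 A) n n')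
    (bd : ∃ e, e ∈ Bd T1) : Good T1 := by
  classical
  have hsT : T1 ⊆ T := hsub.trans (Finset.erase_subset _ _)
  have htT1 : ({a, b, v} : Finset V) ∉ T1 := fun h => by simpa using hsub h
  have hnab : ∀ s ∈ T1, ¬ ({a, b} : Finset V) ⊆ s := by
    intro s hs h
    have := deg_one_unique hdeg (hsT hs) h ht (by intro x; simp; tauto)
    exact htT1 (this ▸ hs)
  refine ⟨fun t h => hT.tri t (hsT h), fun e he => (deg_mono hsT e).trans (hT.deg2 e he), ?_, bd, ?_⟩
  · intro A hA s hs t' ht' hAs hAt'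
    refine retract ?_ hs ht' (hT.conn A hA s (hsT hs) t' (hsT ht') hAs hAt')
    intro n hn n' hn' y hy y' hy' hyT hyT' hAn hAn' hAy hAy' hc hc'
    by_cases h1 : y = {a, b, v}
    · by_cases h2 : y' = {a, b, v}
      · subst h1; subst h2
        exact exit A hA n hn n' hn' hAy hAn hAn' hc hc'
      · exact absurd hc' (not_le.2 (sep n' hn' y' hy' h2 hyT'))
    · exact absurd hc (not_le.2 (sep n hn y hy h1 hyT))
  · intro c hc
    let d : Finset V → ZMod 2 := fun e => if ∃ s ∈ T1, e ⊆ s then c e else 0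
    let c' : Finset V → ZMod 2 := fun e => if e = {a, b} then d {a, v} + d {b, v} else d e
    have hc'1 : ∀ s ∈ T1, ∀ x ∈ s, ∀ y ∈ s, c' {x, y} = c {x, y} := by
      intro s hs x hx y hy
      have hxy : ({x, y} : Finset V) ⊆ s := by
        intro z hz; simp at hz; rcases hz with rfl | rfl <;> assumption
      have : ({x, y} : Finset V) ≠ {a, b} := fun h => hnab s hs (h ▸ hxy)
      simp only [c', if_neg this, d]
      rw [if_pos ⟨s, hs, hxy⟩]
    have hc'0 : ∀ s ∈ T, s ≠ {a, b, v} → s ∉ T1 → ∀ x ∈ s, ∀ y ∈ s, x ≠ y → c' {x, y} = 0 := by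
      intro s hs hst hsT1 x hx y hy hne
      have hxy : ({x, y} : Finset V) ⊆ s := by
        intro z hz; simp at hz; rcases hz with rfl | rfl <;> assumption
      have : ({x, y} : Finset V) ≠ {a, b} := fun h =>
        hst (deg_one_unique hdeg hs (h ▸ hxy) ht (by intro x; simp; tauto))
      simp only [c', if_neg this, d]
      rw [if_neg]
      rintro ⟨s1, hs1, hx1⟩
      have h5 := sep s1 hs1 s hs hst hsT1
      have h6 := Finset.card_le_card (Finset.subset_inter hx1 hxy)
      rw [Finset.card_pair hne] at h6; omega
    obtain ⟨g, hg⟩ := hT.coh c' (by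
      intro x y z hxy hxz hyz hT'
      by_cases h1 : ({x, y, z} : Finset V) ∈ T1
      · rw [hc'1 _ h1 x (by simp) y (by simp), hc'1 _ h1 x (by simp) z (by simp),
          hc'1 _ h1 y (by simp) z (by simp)]
        exact hc x y z hxy hxz hyz h1
      by_cases h2 : ({x, y, z} : Finset V) = {a, b, v}
      · have hx : x ∈ ({a, b, v} : Finset V) := h2 ▸ (by simp)
        have hy : y ∈ ({a, b, v} : Finset V) := h2 ▸ (by simp)
        have hz : z ∈ ({a, b, v} : Finset V) := h2 ▸ (by simp)
        have e1 : c' {a, b} = d {a, v} + d {b, v} := if_pos rfl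
        have e2 : c' {a, v} = d {a, v} := if_neg (by
          intro h; have : v ∈ ({a, b} : Finset V) := h ▸ (by simp)
          simp [hav.symm, hbv.symm] at this)
        have e3 : c' {b, v} = d {b, v} := if_neg (by
          intro h; have : v ∈ ({a, b} : Finset V) := h ▸ (by simp)
          simp [hav.symm, hbv.symm] at this)
        have e0 : c' {a, b} + c' {a, v} + c' {b, v} = 0 := by
          rw [e1, e2, e3]
          generalize d {a, v} = p; generalize d {b, v} = q; revert p q; decide
        have p1 := Finset.pair_comm a b
        have p2 := Finset.pair_comm a v
        have p3 := Finset.pair_comm b v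
        simp only [Finset.mem_insert, Finset.mem_singleton] at hx hy hz
        rcases hx with rfl | rfl | rfl <;> rcases hy with rfl | rfl | rfl <;>
          rcases hz with rfl | rfl | rfl <;> first
            | contradiction
            | (simp only [p1, p2, p3] at *; rw [← e0]; ring)
            | (simp only [p1, p2, p3] at *; rw [← e0]; done)
      · rw [hc'0 _ hT' h2 h1 x (by simp) y (by simp) hxy, hc'0 _ hT' h2 h1 x (by simp) z (by simp) hxz,
          hc'0 _ hT' h2 h1 y (by simp) z (by simp) hyz]; simp)
    exact ⟨g, fun s hs x hx y hy hne => by rw [← hc'1 s hs x hx y hy]; exact hg s (hsT hs) x hx y hy hne⟩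

end Part7

section Part8
open Set Topology Filter Relation

variable {V : Type*} [DecidableEq V]

lemma R_inter [Fintype V] {T1 T2 A : Set (Finset V)} (h : ∀ s1 ∈ T1, ∀ s2 ∈ T2, ∃ e ∈ A, s1 ∩ s2 ⊆ e)
    (h1 : ∀ e ∈ A, ∃ s ∈ T1, e ⊆ s) (h2 : ∀ e ∈ A, ∃ s ∈ T2, e ⊆ s) : R T1 ∩ R T2 = R A := by
  apply Subset.antisymm
  · rintro w ⟨hw1, hw2⟩
    obtain ⟨k0, k1, s, hs, k2⟩ := mem_R.1 hw1
    obtain ⟨-, -, s', hs', k3⟩ := mem_R.1 hw2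
    obtain ⟨e, he, hse⟩ := h s hs s' hs'
    exact mem_R.2 ⟨k0, k1, e, he, fun i hi => hse (Finset.mem_inter.2 ⟨k2 i hi, k3 i hi⟩)⟩
  · exact subset_inter (R_refine h1) (R_refine h2)

/-- the three edges -/
def E3 (a b v : V) : Set (Finset V) := {{a, b}, {a, v}, {b, v}}

lemma mem_E3 {a b v : V} {f : Finset V} : f ∈ E3 a b v ↔ f = {a, b} ∨ f = {a, v} ∨ f = {b, v} := by
  simp [E3]

lemma E3_sub {a b v : V} {f : Finset V} (h : f ∈ E3 a b v) : f ⊆ {a, b, v} := by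
  rcases mem_E3.1 h with rfl | rfl | rfl <;> intro x <;> simp <;> tauto

lemma mem_E3_of {a b v : V} {f : Finset V} (hc : f.card = 2)
    (hf : f ⊆ {a, b, v}) : f ∈ E3 a b v := by
  obtain ⟨x, y, hxy, rfl⟩ := Finset.card_eq_two.1 hc
  have hx : x ∈ ({a, b, v} : Finset V) := hf (by simp)
  have hy : y ∈ ({a, b, v} : Finset V) := hf (by simp)
  have p1 := Finset.pair_comm a b
  have p2 := Finset.pair_comm a v
  have p3 := Finset.pair_comm b v
  rw [mem_E3]
  simp only [Finset.mem_insert, Finset.mem_singleton] at hx hy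
  rcases hx with rfl | rfl | rfl <;> rcases hy with rfl | rfl | rfl <;> simp_all

lemma tri_disc [Fintype V] {a b v : V} (hab : a ≠ b) (hav : a ≠ v) (hbv : b ≠ v) :
    IsDisc (R {({a, b, v} : Finset V)}) (R (E3 a b v)) := by
  refine (triangle_disc hab hav hbv).mono ?_
  intro w _ hw
  obtain ⟨-, -, e, he, h⟩ := mem_R.1 hw
  show w a = 0 ∨ w b = 0 ∨ w v = 0
  rcases mem_E3.1 he with rfl | rfl | rfl
  · right; right; by_contra h1; simpa [hav.symm, hbv.symm] using h v h1
  · right; left; by_contra h1; simpa [hab.symm, hbv] using h b h1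
  · left; by_contra h1; simpa [hab, hav] using h a h1

lemma Bd_sub {T T1 : Finset (Finset V)} {f s : Finset V} (hf : f ∈ Bd T) (hT : T1 ⊆ T) (hs : s ∈ T1)
    (hfs : f ⊆ s) : f ∈ Bd T1 := by
  rw [mem_Bd] at *
  exact ⟨hf.1, deg_one_of hs hfs fun s' hs' h => deg_one_unique hf.2 (hT hs') h (hT hs) hfs⟩

lemma Bd_ex {T : Finset (Finset V)} {f : Finset V} (hf : f ∈ Bd T) : ∃ s ∈ T, f ⊆ s := by
  rw [mem_Bd] at hf
  obtain ⟨s, hs⟩ := Finset.card_pos.1 (show 0 < (T.filter (f ⊆ ·)).card by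
    have := hf.2; unfold deg at this; omega)
  exact ⟨s, (Finset.mem_filter.1 hs).1, (Finset.mem_filter.1 hs).2⟩

lemma pair_sub {x y : V} {s : Finset V} : ({x, y} : Finset V) ⊆ s ↔ x ∈ s ∧ y ∈ s := by
  simp [Finset.insert_subset_iff]

lemma nab {T : Finset (Finset V)} {a b v : V} (ht : {a, b, v} ∈ T) (hdeg : deg T {a, b} = 1)
    {s : Finset V} (hs : s ∈ T) (hne : s ≠ {a, b, v}) (ha : a ∈ s) (hb : b ∈ s) : False :=
  hne (deg_one_unique hdeg hs (pair_sub.2 ⟨ha, hb⟩) ht (by simp [pair_sub]))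

lemma nbr {T : Finset (Finset V)} {a b v : V} (ht : {a, b, v} ∈ T) (hdeg : deg T {a, b} = 1)
    {s : Finset V} (hs : s ∈ T) (hne : s ≠ {a, b, v}) (h2 : 2 ≤ (s ∩ {a, b, v}).card) :
    ({a, v} : Finset V) ⊆ s ∨ ({b, v} : Finset V) ⊆ s := by
  by_cases hb : b ∈ s
  · right
    have h3 : s ∩ {a, b, v} ⊆ {b, v} := by
      intro x hx; simp at hx ⊢
      rcases hx.2 with rfl | h | h
      · exact (nab ht hdeg hs hne hx.1 hb).elim
      · exact Or.inl h
      · exact Or.inr h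
    rw [← Finset.eq_of_subset_of_card_le h3 (Finset.card_le_two.trans h2)]
    exact Finset.inter_subset_left
  · left
    have h3 : s ∩ {a, b, v} ⊆ {a, v} := by
      intro x hx; simp at hx ⊢
      rcases hx.2 with h | rfl | h
      · exact Or.inl h
      · exact (hb hx.1).elim
      · exact Or.inr h
    rw [← Finset.eq_of_subset_of_card_le h3 (Finset.card_le_two.trans h2)]
    exact Finset.inter_subset_left

lemma first_step {T : Finset (Finset V)} {A t s : Finset V} (h : ReflTransGen (Rel T A) t s) (hne : s ≠ t) :
    ∃ n ∈ T, n ≠ t ∧ A ⊆ n ∧ 2 ≤ (n ∩ t).card := by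
  by_contra hcon
  push Not at hcon
  apply hne
  clear hne
  induction h with
  | refl => rfl
  | tail _ h ih =>
    subst ih
    by_contra hne
    have := hcon _ h.2.1 hne h.2.2.2.1
    have h5 := h.2.2.2.2
    rw [Finset.inter_comm] at h5; omega

lemma comp_stay {T : Finset (Finset V)} {t t1 s s2 : Finset V} {x : V} {S : Set (Finset V)}
    (h : ∀ n ∈ T, n ≠ t → x ∈ t → x ∈ n → 2 ≤ (n ∩ t).card → n = t1)
    (hS : ∀ s ∈ S, ∀ s' ∈ T, s' ≠ t → 2 ≤ (s ∩ s').card → s' ∈ S) (ht1 : t1 ∈ S)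
    (hs : s ∈ S) (hp : ReflTransGen (Rel T {x}) s s2) : s2 ∈ S ∨ s2 = t := by
  induction hp with
  | refl => exact Or.inl hs
  | @tail y z _ r ih =>
    obtain ⟨r1, r2, r3, r4, r5⟩ := r
    by_cases hz : z = t
    · exact Or.inr hz
    left
    rcases ih with ih | rfl
    · exact hS _ ih _ r2 hz r5
    · rw [h z r2 hz (by simpa using r3) (by simpa using r4) (by rwa [Finset.inter_comm])]; exact ht1

/-- no separating path in the sense of Case 2b -/
lemma no_path {T : Finset (Finset V)} (hT : Good T) {a b v : V} (hab : a ≠ b) (hav : a ≠ v)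
    (hbv : b ≠ v) (ht : {a, b, v} ∈ T) (hdeg : deg T {a, b} = 1) {t1 t2 : Finset V}
    (ht1 : t1 ∈ T) (h1 : t1 ≠ {a, b, v}) (hav1 : {a, v} ⊆ t1)
    (ht2 : t2 ∈ T) (h2 : t2 ≠ {a, b, v}) (hbv2 : {b, v} ⊆ t2)
    (hno : ¬ ReflTransGen (Rel (T.erase {a, b, v}) {v}) t1 t2) :
    ¬ ReflTransGen (Rel (T.erase {a, b, v}) ∅) t1 t2 := by
  classical
  set T' := T.erase {a, b, v} with hT'
  have memT' : ∀ s, s ∈ T' ↔ s ≠ {a, b, v} ∧ s ∈ T := fun s => Finset.mem_erase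
  let L1 : Finset V → Prop := fun s => s ∈ T' ∧ ReflTransGen (Rel T' {v}) t1 s
  let c : Finset V → ZMod 2 := fun e => if e = {a, b} ∨ (v ∈ e ∧ ∃ s, L1 s ∧ e ⊆ s) then 1 else 0
  have hvab : v ∉ ({a, b} : Finset V) := by simp [hav.symm, hbv.symm]
  have c0 : ∀ s ∈ T', ∀ x ∈ s, ∀ y ∈ s, x ≠ y → x ≠ v → y ≠ v → c {x, y} = 0 := by
    intro s hs x hx y hy hxy hxv hyv
    rw [memT'] at hs
    refine if_neg ?_
    rintro (h | ⟨h, -⟩)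
    · have : a ∈ ({x, y} : Finset V) := h ▸ (by simp)
      have hb : b ∈ ({x, y} : Finset V) := h ▸ (by simp)
      have hsub : ({x, y} : Finset V) ⊆ s := pair_sub.2 ⟨hx, hy⟩
      exact nab ht hdeg hs.2 hs.1 (hsub this) (hsub hb)
    · simp [hxv.symm, hyv.symm] at h
  have cv : ∀ x, x ≠ v → (c {v, x} = if ∃ s, L1 s ∧ {v, x} ⊆ s then 1 else 0) := by
    intro x hx
    have : ¬ ({v, x} : Finset V) = {a, b} := fun h => hvab (h ▸ (by simp))
    simp [c, this]
  have cab : c {a, b} = 1 := if_pos (Or.inl rfl)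
  have cav : c {v, a} = 1 := by
    rw [cv a hav, if_pos]
    exact ⟨t1, ⟨(memT' _).2 ⟨h1, ht1⟩, ReflTransGen.refl⟩, by rwa [Finset.pair_comm]⟩
  have cbv : c {v, b} = 0 := by
    rw [cv b hbv, if_neg]
    rintro ⟨s, ⟨hs, hs1⟩, hs2⟩
    rw [memT'] at hs
    have : s = t2 := deg_two_unique (hT.deg2 {b, v} (Finset.card_pair hbv)) ht (by simp [pair_sub]) hs.2
      (by rwa [Finset.pair_comm]) ht2 hbv2 hs.1 h2
    exact hno (this ▸ hs1)
  have cyc : ∀ x y, x ≠ y → x ≠ v → y ≠ v → {v, x, y} ∈ T → c {v, x} + c {v, y} + c {x, y} = 0 := by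
    intro x y hxy hx hy hm
    by_cases hst : ({v, x, y} : Finset V) = {a, b, v}
    · have hx' : x ∈ ({a, b, v} : Finset V) := hst ▸ (by simp)
      have hy' : y ∈ ({a, b, v} : Finset V) := hst ▸ (by simp)
      simp only [Finset.mem_insert, Finset.mem_singleton, hx, hy, or_false] at hx' hy'
      rcases hx' with rfl | rfl <;> rcases hy' with rfl | rfl
      · exact absurd rfl hxy
      · rw [cav, cbv, cab]; decide
      · rw [Finset.pair_comm x y, cav, cbv, cab]; decide
      · exact absurd rfl hxy
    · have hmT : ({v, x, y} : Finset V) ∈ T' := (memT' _).2 ⟨hst, hm⟩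
      rw [c0 _ hmT x (by simp) y (by simp) hxy hx hy, cv x hx, cv y hy]
      have key : ∀ z, z ≠ v → z ∈ ({v, x, y} : Finset V) → (∃ s, L1 s ∧ {v, z} ⊆ s) → L1 {v, x, y} := by
        rintro z hz hz' ⟨s, ⟨hs1, hs2⟩, hs⟩
        refine ⟨hmT, hs2.tail ⟨hs1, hmT, by simpa using (pair_sub.1 hs).1, by simp, ?_⟩⟩
        rw [← Finset.card_pair hz.symm]
        exact Finset.card_le_card (Finset.subset_inter hs (pair_sub.2 ⟨by simp, hz'⟩))
      have : (∃ s, L1 s ∧ {v, x} ⊆ s) ↔ (∃ s, L1 s ∧ {v, y} ⊆ s) :=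
        ⟨fun h => ⟨_, key x hx (by simp) h, by simp [pair_sub]⟩,
          fun h => ⟨_, key y hy (by simp) h, by simp [pair_sub]⟩⟩
      simp only [this]
      split_ifs <;> decide
  obtain ⟨g, hg⟩ := hT.coh c (by
    intro x y z hxy hxz hyz hm
    by_cases hx : x = v
    · subst hx; exact cyc y z hyz hxy.symm hxz.symm hm
    by_cases hy : y = v
    · subst hy
      rw [Finset.insert_comm] at hm
      rw [← cyc x z hxz hx hyz.symm hm, Finset.pair_comm x y]; ring
    by_cases hz : z = v
    · subst hz
      rw [Finset.pair_comm y z, Finset.insert_comm] at hm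
      rw [← cyc x y hxy hx hy hm, Finset.pair_comm x z, Finset.pair_comm y z]; ring
    have hm' : ({x, y, z} : Finset V) ∈ T' := (memT' _).2 ⟨fun h => by
      have : v ∈ ({x, y, z} : Finset V) := h ▸ (by simp)
      simp [Ne.symm hx, Ne.symm hy, Ne.symm hz] at this, hm⟩
    rw [c0 _ hm' x (by simp) y (by simp) hxy hx hy, c0 _ hm' x (by simp) z (by simp) hxz hx hz,
      c0 _ hm' y (by simp) z (by simp) hyz hy hz]; simp)
  have geq : ∀ s ∈ T', ∀ x ∈ s, ∀ y ∈ s, x ≠ v → y ≠ v → g x = g y := by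
    intro s hs x hx y hy hxv hyv
    by_cases hxy : x = y
    · rw [hxy]
    have := hg s ((memT' s).1 hs).2 x hx y hy hxy
    rw [c0 s hs x hx y hy hxy hxv hyv] at this
    revert this; generalize g x = p; generalize g y = q; revert p q; decide
  intro hp
  have inv : ∀ x ∈ t2, x ≠ v → g x = g a := by
    clear hno ht2 h2 hbv2
    induction hp with
    | refl => exact fun x hx hxv => geq t1 ((memT' _).2 ⟨h1, ht1⟩) x hx a (pair_sub.1 hav1).1 hxv hav
    | @tail y z _ r ih =>
      obtain ⟨r1, r2, -, -, r5⟩ := r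
      obtain ⟨u, hu, huv⟩ : ∃ u ∈ y ∩ z, u ≠ v := by
        by_contra hcon
        push Not at hcon
        have : y ∩ z ⊆ {v} := fun u hu => by simpa using hcon u hu
        have := Finset.card_le_card this
        simp at this; omega
      rw [Finset.mem_inter] at hu
      intro x hx hxv
      rw [geq z r2 x hx u hu.2 hxv huv, ih u hu.1 huv]
  have e1 := hg _ ht a (by simp) b (by simp) hab
  rw [cab, inv b (pair_sub.1 hbv2).1 hbv] at e1
  revert e1; generalize g a = p; revert p; decide

end Part8

section Part9
open Set Topology Filter Relation

variable {V : Type*} [DecidableEq V] [Fintype V]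

lemma disc_case1 {T : Finset (Finset V)} (hT : Good T)
    (IH : ∀ T1 : Finset (Finset V), T1.card < T.card → Good T1 → IsDisc (R (T1 : Set (Finset V))) (R (Bd T1)))
    {a b v : V} (hab : a ≠ b) (hav : a ≠ v) (hbv : b ≠ v) (ht : {a, b, v} ∈ T)
    (hdeg : deg T {a, b} = 1) {t1 : Finset V} (ht1 : t1 ∈ T) (h1 : t1 ≠ {a, b, v}) (hav1 : {a, v} ⊆ t1)
    (hQ : ¬ ∃ t2 ∈ T, t2 ≠ {a, b, v} ∧ {b, v} ⊆ t2) : IsDisc (R (T : Set (Finset V))) (R (Bd T)) := by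
  have hdav := hT.deg2 {a, v} (Finset.card_pair hav)
  have hsav : ({a, v} : Finset V) ⊆ {a, b, v} := by simp [pair_sub]
  have hb : ∀ s ∈ T, s ≠ {a, b, v} → b ∉ s := by
    intro s hs hne hb
    obtain ⟨n, hn, hnt, hbn, hc⟩ := first_step (hT.conn {b} (by simp) _ ht s hs (by simp) (by simpa)) hne
    rcases nbr ht hdeg hn hnt hc with h | h
    · exact nab ht hdeg hn hnt (pair_sub.1 h).1 (by simpa using hbn)
    · exact hQ ⟨n, hn, hnt, h⟩
  have mem1 : ∀ s, s ∈ T.erase {a, b, v} ↔ s ≠ {a, b, v} ∧ s ∈ T := fun s => Finset.mem_erase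
  have hBd : ({a, v} : Finset V) ∈ Bd (T.erase {a, b, v}) := by
    rw [mem_Bd]
    refine ⟨Finset.card_pair hav, deg_one_of ((mem1 _).2 ⟨h1, ht1⟩) hav1 ?_⟩
    intro s hs h
    rw [mem1] at hs
    exact deg_two_unique hdav ht hsav hs.2 h ht1 hav1 hs.1 h1
  have hg : Good (T.erase {a, b, v}) := by
    refine sub_good hT hab hav hbv ht hdeg subset_rfl ?_ ?_ ⟨_, hBd⟩
    · intro s1 _ s hs hne hn
      exact absurd ((mem1 s).2 ⟨hne, hs⟩) hn
    · intro A _ n hn n' hn' _ _ _ hc hc'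
      rw [mem1] at hn hn'
      have e1 : ({a, v} : Finset V) ⊆ n := (nbr ht hdeg hn.2 hn.1 hc).resolve_right
        fun h => hQ ⟨n, hn.2, hn.1, h⟩
      have e2 : ({a, v} : Finset V) ⊆ n' := (nbr ht hdeg hn'.2 hn'.1 hc').resolve_right
        fun h => hQ ⟨n', hn'.2, hn'.1, h⟩
      rw [deg_two_unique hdav ht hsav hn.2 e1 hn'.2 e2 hn.1 hn'.1]
  obtain ⟨α1, α2, α3⟩ := arc_one hav
  have := glue_complex (E := Bd T) (IH _ (Finset.card_erase_lt_of_mem ht) hg) (tri_disc hab hav hbv)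
    (A := {{a, v}}) (R_inter ?_ ?_ ?_) α1 α2 α3 ?_ ?_ ?_ ?_ ?_ ?_
  · convert this using 2
    ext s; simp [mem1]
    by_cases hs : s = {a, b, v}
    · simp [hs, ht]
    · simp [hs]
  · intro s1 hs1 s2 hs2
    rw [Finset.mem_coe, mem1] at hs1
    have hs2' : s2 = {a, b, v} := hs2
    subst hs2'
    refine ⟨{a, v}, rfl, ?_⟩
    intro x hx; simp at hx ⊢
    rcases hx.2 with h | rfl | h
    · exact Or.inl h
    · exact absurd hx.1 (hb _ hs1.2 hs1.1)
    · exact Or.inr h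
  · intro e he
    have he' : e = {a, v} := he
    exact ⟨t1, (mem1 _).2 ⟨h1, ht1⟩, he' ▸ hav1⟩
  · intro e he
    have he' : e = {a, v} := he
    exact ⟨_, rfl, he' ▸ hsav⟩
  · intro e he
    have he' : e = {a, v} := he
    exact he' ▸ hBd
  · intro e he
    have he' : e = {a, v} := he
    rw [mem_E3]; simp [he']
  · intro e he
    have he' : e = {a, v} := he
    rw [he', Finset.card_pair hav]
  · exact fun f hf => Bd_ex hf
  · exact fun f hf => ⟨_, rfl, E3_sub hf⟩
  · intro f hf
    have hf' := mem_Bd.1 hf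
    refine ⟨hf'.1, ?_, ?_⟩
    · intro he
      have he' : f = {a, v} := he
      rw [he'] at hf'
      exact deg_two_of ht hsav ht1 hav1 h1 hf'.2
    · obtain ⟨s, hs, hfs⟩ := Bd_ex hf
      by_cases hst : s = {a, b, v}
      · right; exact mem_E3_of hf'.1 (hst ▸ hfs)
      · left; exact Bd_sub hf (Finset.erase_subset _ _) ((mem1 s).2 ⟨hst, hs⟩) hfs

lemma disc_case2a {T : Finset (Finset V)} (hT : Good T)
    (IH : ∀ T1 : Finset (Finset V), T1.card < T.card → Good T1 → IsDisc (R (T1 : Set (Finset V))) (R (Bd T1)))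
    {a b v : V} (hab : a ≠ b) (hav : a ≠ v) (hbv : b ≠ v) (ht : {a, b, v} ∈ T)
    (hdeg : deg T {a, b} = 1) {t1 : Finset V} (ht1 : t1 ∈ T) (h1 : t1 ≠ {a, b, v}) (hav1 : {a, v} ⊆ t1)
    {t2 : Finset V} (ht2 : t2 ∈ T) (h2 : t2 ≠ {a, b, v}) (hbv2 : {b, v} ⊆ t2)
    (hp : ReflTransGen (Rel (T.erase {a, b, v}) {v}) t1 t2) :
    IsDisc (R (T : Set (Finset V))) (R (Bd T)) := by
  have hdav := hT.deg2 {a, v} (Finset.card_pair hav)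
  have hdbv := hT.deg2 {b, v} (Finset.card_pair hbv)
  have hsav : ({a, v} : Finset V) ⊆ {a, b, v} := by simp [pair_sub]
  have hsbv : ({b, v} : Finset V) ⊆ {a, b, v} := by simp [pair_sub]
  have mem1 : ∀ s, s ∈ T.erase {a, b, v} ↔ s ≠ {a, b, v} ∧ s ∈ T := fun s => Finset.mem_erase
  have hBd1 : ({a, v} : Finset V) ∈ Bd (T.erase {a, b, v}) := by
    rw [mem_Bd]
    refine ⟨Finset.card_pair hav, deg_one_of ((mem1 _).2 ⟨h1, ht1⟩) hav1 ?_⟩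
    intro s hs h
    rw [mem1] at hs
    exact deg_two_unique hdav ht hsav hs.2 h ht1 hav1 hs.1 h1
  have hBd2 : ({b, v} : Finset V) ∈ Bd (T.erase {a, b, v}) := by
    rw [mem_Bd]
    refine ⟨Finset.card_pair hbv, deg_one_of ((mem1 _).2 ⟨h2, ht2⟩) hbv2 ?_⟩
    intro s hs h
    rw [mem1] at hs
    exact deg_two_unique hdbv ht hsbv hs.2 h ht2 hbv2 hs.1 h2
  have hA : ∀ A : Finset V, A ⊆ {a, b, v} → A ⊆ t1 → A ⊆ t2 → A ⊆ {v} := by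
    intro A k1 k2 k3 x hx
    have := k1 hx
    simp at this ⊢
    rcases this with rfl | rfl | h
    · exact (nab ht hdeg ht2 h2 (k3 hx) (pair_sub.1 hbv2).1).elim
    · exact (nab ht hdeg ht1 h1 (pair_sub.1 hav1).1 (k2 hx)).elim
    · exact h
  have hg : Good (T.erase {a, b, v}) := by
    refine sub_good hT hab hav hbv ht hdeg subset_rfl ?_ ?_ ⟨_, hBd1⟩
    · intro s1 _ s hs hne hn
      exact absurd ((mem1 s).2 ⟨hne, hs⟩) hn
    · intro A _ n hn n' hn' hAt hAn hAn' hc hc'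
      rw [mem1] at hn hn'
      have e1 : n = t1 ∨ n = t2 := (nbr ht hdeg hn.2 hn.1 hc).imp
        (fun h => deg_two_unique hdav ht hsav hn.2 h ht1 hav1 hn.1 h1)
        (fun h => deg_two_unique hdbv ht hsbv hn.2 h ht2 hbv2 hn.1 h2)
      have e2 : n' = t1 ∨ n' = t2 := (nbr ht hdeg hn'.2 hn'.1 hc').imp
        (fun h => deg_two_unique hdav ht hsav hn'.2 h ht1 hav1 hn'.1 h1)
        (fun h => deg_two_unique hdbv ht hsbv hn'.2 h ht2 hbv2 hn'.1 h2)
      rcases e1 with rfl | rfl <;> rcases e2 with rfl | rfl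
      · exact ReflTransGen.refl
      · exact RTG.mono (hA A hAt hAn hAn') hp
      · exact RTG.mono (hA A hAt hAn' hAn) (RTG.symm hp)
      · exact ReflTransGen.refl
  obtain ⟨α1, α2, α3⟩ := arc_two hab hav hbv
  have mA : ∀ e, e ∈ ({{a, v}, {b, v}} : Set (Finset V)) ↔ e = {a, v} ∨ e = {b, v} := by simp
  have := glue_complex (E := Bd T) (IH _ (Finset.card_erase_lt_of_mem ht) hg) (tri_disc hab hav hbv)
    (A := {{a, v}, {b, v}}) (R_inter ?_ ?_ ?_) α1 α2 α3 ?_ ?_ ?_ ?_ ?_ ?_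
  · convert this using 2
    ext s; simp [mem1]
    by_cases hs : s = {a, b, v}
    · simp [hs, ht]
    · simp [hs]
  · intro s1 hs1 s2 hs2
    rw [Finset.mem_coe, mem1] at hs1
    have hs2' : s2 = {a, b, v} := hs2
    subst hs2'
    by_cases hb : b ∈ s1
    · refine ⟨{b, v}, (mA _).2 (Or.inr rfl), ?_⟩
      intro x hx; simp at hx ⊢
      rcases hx.2 with rfl | h | h
      · exact (nab ht hdeg hs1.2 hs1.1 hx.1 hb).elim
      · exact Or.inl h
      · exact Or.inr h
    · refine ⟨{a, v}, (mA _).2 (Or.inl rfl), ?_⟩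
      intro x hx; simp at hx ⊢
      rcases hx.2 with h | rfl | h
      · exact Or.inl h
      · exact absurd hx.1 hb
      · exact Or.inr h
  · intro e he
    rcases (mA e).1 he with rfl | rfl
    · exact ⟨t1, (mem1 _).2 ⟨h1, ht1⟩, hav1⟩
    · exact ⟨t2, (mem1 _).2 ⟨h2, ht2⟩, hbv2⟩
  · intro e he
    rcases (mA e).1 he with rfl | rfl
    · exact ⟨_, rfl, hsav⟩
    · exact ⟨_, rfl, hsbv⟩
  · intro e he
    rcases (mA e).1 he with rfl | rfl
    · exact hBd1
    · exact hBd2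
  · intro e he
    rcases (mA e).1 he with rfl | rfl <;> rw [mem_E3] <;> simp
  · intro e he
    rcases (mA e).1 he with rfl | rfl
    · exact Finset.card_pair hav
    · exact Finset.card_pair hbv
  · exact fun f hf => Bd_ex hf
  · exact fun f hf => ⟨_, rfl, E3_sub hf⟩
  · intro f hf
    have hf' := mem_Bd.1 hf
    refine ⟨hf'.1, ?_, ?_⟩
    · intro he
      rcases (mA f).1 he with rfl | rfl
      · exact deg_two_of ht hsav ht1 hav1 h1 hf'.2
      · exact deg_two_of ht hsbv ht2 hbv2 h2 hf'.2
    · obtain ⟨s, hs, hfs⟩ := Bd_ex hf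
      by_cases hst : s = {a, b, v}
      · right; exact mem_E3_of hf'.1 (hst ▸ hfs)
      · left; exact Bd_sub hf (Finset.erase_subset _ _) ((mem1 s).2 ⟨hst, hs⟩) hfs

lemma disc_case2b {T : Finset (Finset V)} (hT : Good T)
    (IH : ∀ T1 : Finset (Finset V), T1.card < T.card → Good T1 → IsDisc (R (T1 : Set (Finset V))) (R (Bd T1)))
    {a b v : V} (hab : a ≠ b) (hav : a ≠ v) (hbv : b ≠ v) (ht : {a, b, v} ∈ T)
    (hdeg : deg T {a, b} = 1) {t1 : Finset V} (ht1 : t1 ∈ T) (h1 : t1 ≠ {a, b, v}) (hav1 : {a, v} ⊆ t1)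
    {t2 : Finset V} (ht2 : t2 ∈ T) (h2 : t2 ≠ {a, b, v}) (hbv2 : {b, v} ⊆ t2)
    (hp : ¬ ReflTransGen (Rel (T.erase {a, b, v}) ∅) t1 t2) :
    IsDisc (R (T : Set (Finset V))) (R (Bd T)) := by
  classical
  have hdav := hT.deg2 {a, v} (Finset.card_pair hav)
  have hdbv := hT.deg2 {b, v} (Finset.card_pair hbv)
  have hsav : ({a, v} : Finset V) ⊆ {a, b, v} := by simp [pair_sub]
  have hsbv : ({b, v} : Finset V) ⊆ {a, b, v} := by simp [pair_sub]
  have mem1 : ∀ s, s ∈ T.erase {a, b, v} ↔ s ≠ {a, b, v} ∧ s ∈ T := fun s => Finset.mem_erase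
  set T' := T.erase {a, b, v} with hT'
  let C : Finset V → Finset (Finset V) := fun t0 => T'.filter (fun s => ReflTransGen (Rel T' ∅) t0 s)
  have mC : ∀ t0 s, s ∈ C t0 ↔ (s ≠ {a, b, v} ∧ s ∈ T) ∧ ReflTransGen (Rel T' ∅) t0 s := by
    intro t0 s; simp only [C, Finset.mem_filter, mem1]
  have hCT : ∀ t0, C t0 ⊆ T := fun t0 s hs => ((mC t0 s).1 hs).1.2
  have hCc : ∀ t0, (C t0).card < T.card := fun t0 =>
    (Finset.card_le_card (Finset.filter_subset _ _)).trans_lt (Finset.card_erase_lt_of_mem ht)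
  have hstep : ∀ t0, ∀ s ∈ C t0, ∀ s' ∈ T, s' ≠ {a, b, v} → 2 ≤ (s ∩ s').card → s' ∈ C t0 := by
    intro t0 s hs s' hs' hne hc
    rw [mC] at hs ⊢
    exact ⟨⟨hne, hs'⟩, hs.2.tail ⟨(mem1 _).2 hs.1, (mem1 _).2 ⟨hne, hs'⟩, by simp, by simp, hc⟩⟩
  have m1 : t1 ∈ C t1 := (mC _ _).2 ⟨⟨h1, ht1⟩, ReflTransGen.refl⟩
  have m2 : t2 ∈ C t2 := (mC _ _).2 ⟨⟨h2, ht2⟩, ReflTransGen.refl⟩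
  have m12 : t2 ∉ C t1 := fun h => hp ((mC _ _).1 h).2
  have m21 : t1 ∉ C t2 := fun h => hp (RTG.symm ((mC _ _).1 h).2)
  have hnbr : ∀ n ∈ T, n ≠ {a, b, v} → 2 ≤ (n ∩ {a, b, v}).card → n = t1 ∨ n = t2 := fun n hn hne hc =>
    (nbr ht hdeg hn hne hc).imp
        (fun h => deg_two_unique hdav ht hsav hn h ht1 hav1 hne h1)
        (fun h => deg_two_unique hdbv ht hsbv hn h ht2 hbv2 hne h2)
  have hBd1 : ({a, v} : Finset V) ∈ Bd (C t1) := by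
    rw [mem_Bd]
    refine ⟨Finset.card_pair hav, deg_one_of m1 hav1 ?_⟩
    intro s hs h
    rw [mC] at hs
    exact deg_two_unique hdav ht hsav hs.1.2 h ht1 hav1 hs.1.1 h1
  have hBd2 : ({b, v} : Finset V) ∈ Bd (C t2) := by
    rw [mem_Bd]
    refine ⟨Finset.card_pair hbv, deg_one_of m2 hbv2 ?_⟩
    intro s hs h
    rw [mC] at hs
    exact deg_two_unique hdbv ht hsbv hs.1.2 h ht2 hbv2 hs.1.1 h2
  have hcov : ∀ s ∈ T, s = {a, b, v} ∨ s ∈ C t1 ∨ s ∈ C t2 := by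
    intro s hs
    have hpth := hT.conn ∅ (by simp) _ ht s hs (by simp) (by simp)
    clear hs
    induction hpth with
    | refl => exact Or.inl rfl
    | @tail y z _ r ih =>
      obtain ⟨r1, r2, -, -, r5⟩ := r
      by_cases hz : z = {a, b, v}
      · exact Or.inl hz
      right
      rcases ih with rfl | ih | ih
      · rw [Finset.inter_comm] at r5
        rcases hnbr z r2 hz r5 with rfl | rfl
        · exact Or.inl m1
        · exact Or.inr m2
      · exact Or.inl (hstep _ _ ih _ r2 hz r5)
      · exact Or.inr (hstep _ _ ih _ r2 hz r5)
  have hdisj : ∀ s, s ∈ C t1 → s ∉ C t2 := fun s k1 k2 =>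
    hp (((mC _ _).1 k1).2.trans (RTG.symm ((mC _ _).1 k2).2))
  have hg : ∀ t0, (∀ n ∈ C t0, 2 ≤ (n ∩ {a, b, v}).card → n = t0) → (∃ e, e ∈ Bd (C t0)) → Good (C t0) := by
    intro t0 h0 hbd
    refine sub_good hT hab hav hbv ht hdeg (Finset.filter_subset _ _) ?_ ?_ hbd
    · intro s1 hs1 s hs hne hn
      by_contra hcon
      exact hn (hstep t0 s1 hs1 s hs hne (not_lt.1 hcon))
    · intro A _ n hn n' hn' _ _ _ hc hc'
      rw [h0 n hn hc, h0 n' hn' hc']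
  have g1 : Good (C t1) := hg t1 (fun n hn hc => (hnbr n ((mC _ _).1 hn).1.2 ((mC _ _).1 hn).1.1 hc).resolve_right
    fun h => m12 (h ▸ hn)) ⟨_, hBd1⟩
  have g2 : Good (C t2) := hg t2 (fun n hn hc => (hnbr n ((mC _ _).1 hn).1.2 ((mC _ _).1 hn).1.1 hc).resolve_left
    fun h => m21 (h ▸ hn)) ⟨_, hBd2⟩
  have ha2 : a ∉ t2 := fun h => nab ht hdeg ht2 h2 h (pair_sub.1 hbv2).1
  have hb1 : b ∉ t1 := fun h => nab ht hdeg ht1 h1 (pair_sub.1 hav1).1 h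
  have hvert : ∀ x s1 s2, s1 ∈ C t1 → s2 ∈ C t2 → x ∈ s1 → x ∈ s2 → x = v := by
    intro x s1 s2 k1 k2 x1 x2
    by_contra hxv
    have hpth := hT.conn {x} (by simp) s1 (hCT _ k1) s2 (hCT _ k2) (by simpa) (by simpa)
    by_cases hxb : x = b
    · subst hxb
      rcases comp_stay (S := (C t2 : Set (Finset V))) (t := {a, x, v}) (t1 := t2) (fun n hn hne _ hxn hc =>
        (hnbr n hn hne hc).resolve_left (fun h => hb1 (h ▸ hxn))) (hstep t2) m2 k2 (RTG.symm hpth) with h | h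
      · exact hdisj _ k1 h
      · exact ((mC _ _).1 k1).1.1 h
    · rcases comp_stay (S := (C t1 : Set (Finset V))) (t := {a, b, v}) (t1 := t1) (fun n hn hne hxt hxn hc =>
        (hnbr n hn hne hc).resolve_right (fun h => by
          simp only [Finset.mem_insert, Finset.mem_singleton, hxb, hxv, or_false] at hxt
          exact ha2 (by rw [← hxt, ← h]; exact hxn))) (hstep t1) m1 k1 hpth with h | h
      · exact hdisj _ h k2
      · exact ((mC _ _).1 k2).1.1 h
  have hb : ∀ s ∈ C t1, b ∉ s := fun s hs h => hbv (hvert b s t2 hs m2 h (pair_sub.1 hbv2).1)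
  have ha : ∀ s ∈ C t2, a ∉ s := fun s hs h => hav (hvert a t1 s m1 hs (pair_sub.1 hav1).1 h)
  obtain ⟨α1, α2, α3⟩ := arc_one hav
  obtain ⟨β1, β2, β3⟩ := arc_one hbv
  let E' : Set (Finset V) := {f | f.card = 2 ∧ f ≠ {a, v} ∧ (f ∈ Bd (C t1) ∨ f ∈ E3 a b v)}
  have mE' : ∀ f, f ∈ E' ↔ f.card = 2 ∧ f ≠ {a, v} ∧ (f ∈ Bd (C t1) ∨ f ∈ E3 a b v) := by simp [E']
  have d1 : IsDisc (R ((C t1 : Set (Finset V)) ∪ {{a, b, v}})) (R E') := by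
    refine glue_complex (IH _ (hCc t1) g1) (tri_disc hab hav hbv)
      (A := {{a, v}}) (R_inter ?_ ?_ ?_) α1 α2 α3 ?_ ?_ ?_ ?_ ?_ ?_
    · intro s1 hs1 s2 hs2
      have hs2' : s2 = {a, b, v} := hs2
      subst hs2'
      refine ⟨{a, v}, rfl, ?_⟩
      intro x hx; simp at hx ⊢
      rcases hx.2 with h | rfl | h
      · exact Or.inl h
      · exact absurd hx.1 (hb _ hs1)
      · exact Or.inr h
    · intro e he
      have he' : e = {a, v} := he
      exact ⟨t1, m1, he' ▸ hav1⟩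
    · intro e he
      have he' : e = {a, v} := he
      exact ⟨_, rfl, he' ▸ hsav⟩
    · intro e he
      have he' : e = {a, v} := he
      exact he' ▸ hBd1
    · intro e he
      have he' : e = {a, v} := he
      rw [mem_E3]; simp [he']
    · intro e he
      have he' : e = {a, v} := he
      rw [he', Finset.card_pair hav]
    · exact fun f hf => Bd_ex hf
    · exact fun f hf => ⟨_, rfl, E3_sub hf⟩
    · exact fun f hf => (mE' f).1 hf
  have hE'ex : ∀ f ∈ E', ∃ s ∈ (C t1 : Set (Finset V)) ∪ {{a, b, v}}, f ⊆ s := by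
    intro f hf
    rcases ((mE' f).1 hf).2.2 with h | h
    · obtain ⟨s, hs, hfs⟩ := Bd_ex h
      exact ⟨s, Or.inl hs, hfs⟩
    · exact ⟨_, Or.inr rfl, E3_sub h⟩
  have hne : ({b, v} : Finset V) ≠ {a, v} := by
    intro h
    have : b ∈ ({a, v} : Finset V) := h ▸ (by simp)
    simp [hab.symm, hbv] at this
  have := glue_complex (E := Bd T) d1 (IH _ (hCc t2) g2)
    (A := {{b, v}}) (R_inter ?_ ?_ ?_) β1 β2 β3 ?_ ?_ ?_ hE'ex ?_ ?_
  · convert this using 2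
    ext s; simp only [Finset.mem_coe, mem_union, mem_singleton_iff]
    constructor
    · intro hs
      rcases hcov s hs with h | h | h <;> tauto
    · rintro ((h | rfl) | h)
      · exact hCT _ h
      · exact ht
      · exact hCT _ h
  · intro s1 hs1 s2 hs2
    refine ⟨{b, v}, rfl, ?_⟩
    intro x hx; simp only [Finset.mem_inter, Finset.mem_insert, Finset.mem_singleton] at hx ⊢
    rcases hs1 with hs1 | hs1
    · exact Or.inr (hvert x s1 s2 hs1 hs2 hx.1 hx.2)
    · have hs1' : s1 = {a, b, v} := hs1
      subst hs1'
      have := hx.1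
      simp at this
      rcases this with rfl | h | h
      · exact absurd hx.2 (ha _ hs2)
      · exact Or.inl h
      · exact Or.inr h
  · intro e he
    have he' : e = {b, v} := he
    exact ⟨_, Or.inr rfl, he' ▸ hsbv⟩
  · intro e he
    have he' : e = {b, v} := he
    exact ⟨_, m2, he' ▸ hbv2⟩
  · intro e he
    have he' : e = {b, v} := he
    subst he'
    exact (mE' _).2 ⟨Finset.card_pair hbv, hne, Or.inr (by rw [mem_E3]; simp)⟩
  · intro e he
    have he' : e = {b, v} := he
    exact he' ▸ hBd2
  · intro e he
    have he' : e = {b, v} := he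
    rw [he', Finset.card_pair hbv]
  · exact fun f hf => Bd_ex hf
  · intro f hf
    have hf' := mem_Bd.1 hf
    refine ⟨hf'.1, ?_, ?_⟩
    · intro he
      have he' : f = {b, v} := he
      subst he'
      exact deg_two_of ht hsbv ht2 hbv2 h2 hf'.2
    · have hfa : f ≠ {a, v} := by
        rintro rfl
        exact deg_two_of ht hsav ht1 hav1 h1 hf'.2
      obtain ⟨s, hs, hfs⟩ := Bd_ex hf
      rcases hcov s hs with rfl | h | h
      · exact Or.inl ((mE' _).2 ⟨hf'.1, hfa, Or.inr (mem_E3_of hf'.1 hfs)⟩)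
      · exact Or.inl ((mE' _).2 ⟨hf'.1, hfa, Or.inl (Bd_sub hf (hCT _) h hfs)⟩)
      · exact Or.inr (Bd_sub hf (hCT _) h hfs)

lemma good_disc (k : ℕ) : ∀ T : Finset (Finset V), T.card = k → Good T →
    IsDisc (R (T : Set (Finset V))) (R (Bd T)) := by
  induction k using Nat.strong_induction_on with
  | _ k ih =>
  rintro T rfl hT
  have IH : ∀ T1 : Finset (Finset V), T1.card < T.card → Good T1 →
    IsDisc (R (T1 : Set (Finset V))) (R (Bd T1)) := fun T1 h hg => ih _ h T1 rfl hg
  obtain ⟨e, he⟩ := hT.bd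
  obtain ⟨t, ht, het⟩ := Bd_ex he
  have he' := mem_Bd.1 he
  obtain ⟨a, b, hab, rfl⟩ := Finset.card_eq_two.1 he'.1
  obtain ⟨v, hv⟩ : ∃ v, t \ {a, b} = {v} := by
    rw [← Finset.card_eq_one, Finset.card_sdiff_of_subset het, hT.tri t ht, he'.1]
  have hvt : v ∈ t \ {a, b} := hv ▸ (by simp)
  have htt : t = {a, b, v} := by
    rw [← Finset.union_sdiff_of_subset het, hv]; ext x; simp
  simp at hvt
  have hav : a ≠ v := fun h => hvt.2.1 h.symm
  have hbv : b ≠ v := fun h => hvt.2.2 h.symm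
  subst htt
  by_cases hP : ∃ t1 ∈ T, t1 ≠ {a, b, v} ∧ {a, v} ⊆ t1
  · obtain ⟨t1, ht1, h1, hav1⟩ := hP
    by_cases hQ : ∃ t2 ∈ T, t2 ≠ {a, b, v} ∧ {b, v} ⊆ t2
    · obtain ⟨t2, ht2, h2, hbv2⟩ := hQ
      by_cases hp : ReflTransGen (Rel (T.erase {a, b, v}) {v}) t1 t2
      · exact disc_case2a hT IH hab hav hbv ht he'.2 ht1 h1 hav1 ht2 h2 hbv2 hp
      · exact disc_case2b hT IH hab hav hbv ht he'.2 ht1 h1 hav1 ht2 h2 hbv2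
          (no_path hT hab hav hbv ht he'.2 ht1 h1 hav1 ht2 h2 hbv2 hp)
    · exact disc_case1 hT IH hab hav hbv ht he'.2 ht1 h1 hav1 hQ
  · by_cases hQ : ∃ t2 ∈ T, t2 ≠ {a, b, v} ∧ {b, v} ⊆ t2
    · obtain ⟨t2, ht2, h2, hbv2⟩ := hQ
      have hc : ({b, a, v} : Finset V) = {a, b, v} := Finset.insert_comm _ _ _
      refine disc_case1 hT IH hab.symm hbv hav (hc ▸ ht) (by rw [Finset.pair_comm]; exact he'.2)
        ht2 (hc ▸ h2) hbv2 ?_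
      rwa [hc]
    · have hTt : ∀ s ∈ T, s = {a, b, v} := by
        intro s hs
        by_contra hne
        obtain ⟨n, hn, hnt, -, hc⟩ := first_step (hT.conn ∅ (by simp) _ ht s hs (by simp) (by simp)) hne
        rcases nbr ht he'.2 hn hnt hc with h | h
        · exact hP ⟨n, hn, hnt, h⟩
        · exact hQ ⟨n, hn, hnt, h⟩
      have hTe : (T : Set (Finset V)) = {{a, b, v}} := by
        ext s; simp only [Finset.mem_coe, mem_singleton_iff]
        exact ⟨hTt s, fun h => h ▸ ht⟩
      rw [hTe]
      refine (tri_disc hab hav hbv).mono fun x _ hx => R_refine ?_ hx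
      intro f hf
      obtain ⟨s, hs, hfs⟩ := Bd_ex hf
      exact ⟨f, mem_E3_of (mem_Bd.1 hf).1 (hTt s hs ▸ hfs), subset_rfl⟩

end Part9

section Part10
open Set Topology Filter Relation

variable {V : Type*} [DecidableEq V] [Fintype V]

/-- edges of the complex generated by `T` -/
def Ed (T : Finset (Finset V)) : Finset (Finset V) :=
  Finset.univ.filter (fun e => e.card = 2 ∧ ∃ t ∈ T, e ⊆ t)

lemma mem_Ed {T : Finset (Finset V)} {e : Finset V} : e ∈ Ed T ↔ e.card = 2 ∧ ∃ t ∈ T, e ⊆ t := by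
  simp [Ed]

lemma tri_form {t : Finset V} (h : t.card = 3) {x y z : V} (hxy : x ≠ y) (hxz : x ≠ z) (hyz : y ≠ z)
    (hx : x ∈ t) (hy : y ∈ t) (hz : z ∈ t) : t = {x, y, z} := by
  symm
  apply Finset.eq_of_subset_of_card_le
  · intro w hw; simp at hw; rcases hw with rfl | rfl | rfl <;> assumption
  · rw [h, Finset.card_eq_three.2 ⟨x, y, z, hxy, hxz, hyz, rfl⟩]

lemma edges_of_tri {T : Finset (Finset V)} {x y z : V} (hxy : x ≠ y) (hxz : x ≠ z) (hyz : y ≠ z)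
    (ht : {x, y, z} ∈ T) : (Ed T).filter (· ⊆ {x, y, z}) = {{x, y}, {x, z}, {y, z}} := by
  ext e
  simp only [Finset.mem_filter, mem_Ed, Finset.mem_insert, Finset.mem_singleton]
  rw [← mem_E3]
  constructor
  · rintro ⟨⟨h1, -⟩, h2⟩; exact mem_E3_of h1 h2
  · intro h
    refine ⟨⟨?_, _, ht, E3_sub h⟩, E3_sub h⟩
    rcases mem_E3.1 h with rfl | rfl | rfl
    · exact Finset.card_pair hxy
    · exact Finset.card_pair hxz
    · exact Finset.card_pair hyz

lemma sum_edges {M : Type*} [AddCommMonoid M] {x y z : V} (hxy : x ≠ y) (hxz : x ≠ z) (hyz : y ≠ z)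
    (f : Finset V → M) : ∑ e ∈ ({{x, y}, {x, z}, {y, z}} : Finset (Finset V)), f e =
      f {x, y} + f {x, z} + f {y, z} := by
  have h1 : ({x, y} : Finset V) ≠ {x, z} := by
    intro h; have : y ∈ ({x, z} : Finset V) := h ▸ (by simp)
    simp [hxy.symm, hyz] at this
  have h2 : ({x, y} : Finset V) ≠ {y, z} := by
    intro h; have : x ∈ ({y, z} : Finset V) := h ▸ (by simp)
    simp [hxy, hxz] at this
  have h3 : ({x, z} : Finset V) ≠ {y, z} := by
    intro h; have : x ∈ ({y, z} : Finset V) := h ▸ (by simp)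
    simp [hxy, hxz] at this
  rw [Finset.sum_insert (by simp [h1, h2]), Finset.sum_pair h3, add_assoc]

lemma euler_mod2 {T : Finset (Finset V)} (tri : ∀ t ∈ T, t.card = 3)
    (deg2 : ∀ e : Finset V, e.card = 2 → deg T e ≤ 2)
    (conn : ∀ s ∈ T, ∀ t ∈ T, ReflTransGen (Rel T ∅) s t) (bd : ∃ e, e ∈ Bd T)
    (hv : ∀ x : V, ∃ t ∈ T, x ∈ t) :
    Fintype.card V + T.card ≤ (Ed T).card + 1 ∧ (Fintype.card V + T.card = (Ed T).card + 1 →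
      ∀ c : Finset V → ZMod 2, (∀ x y z, x ≠ y → x ≠ z → y ≠ z → {x, y, z} ∈ T →
    c {x, y} + c {x, z} + c {y, z} = 0) → ∃ g : V → ZMod 2, ∀ t ∈ T, ∀ x ∈ t, ∀ y ∈ t, x ≠ y →
      c {x, y} = g x + g y) := by
  let d0 : (V → ZMod 2) →ₗ[ZMod 2] (↥(Ed T) → ZMod 2) :=
    { toFun := fun g e => ∑ x ∈ e.1, g x
      map_add' := by intro g g'; funext e; simp [Finset.sum_add_distrib]
      map_smul' := by intro k g; funext e; simp [Finset.mul_sum] }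
  let d1 : (↥(Ed T) → ZMod 2) →ₗ[ZMod 2] (↥T → ZMod 2) :=
    { toFun := fun c t => ∑ e : ↥(Ed T), if e.1 ⊆ t.1 then c e else 0
      map_add' := by
        intro g g'; funext e; simp only [Pi.add_apply, ← Finset.sum_add_distrib]
        apply Finset.sum_congr rfl; intro x _; split_ifs <;> simp
      map_smul' := by intro k g; funext e; simp [Finset.mul_sum] }
  have d1app : ∀ c : Finset V → ZMod 2, ∀ x y z (hxy : x ≠ y) (hxz : x ≠ z) (hyz : y ≠ z)
      (ht : {x, y, z} ∈ T), d1 (fun e => c e.1) ⟨{x, y, z}, ht⟩ = c {x, y} + c {x, z} + c {y, z} := by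
    intro c x y z hxy hxz hyz ht
    show ∑ e : ↥(Ed T), (if e.1 ⊆ {x, y, z} then c e.1 else 0) = _
    rw [Finset.sum_coe_sort (Ed T) (fun e => if e ⊆ {x, y, z} then c e else 0), ← Finset.sum_filter,
      edges_of_tri hxy hxz hyz ht, sum_edges hxy hxz hyz]
  have htri : ∀ t ∈ T, ∃ x y z, x ≠ y ∧ x ≠ z ∧ y ≠ z ∧ t = {x, y, z} :=
    fun t ht => Finset.card_eq_three.1 (tri t ht)
  have hker : LinearMap.range d0 ≤ LinearMap.ker d1 := by
    rintro _ ⟨g, rfl⟩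
    rw [LinearMap.mem_ker]
    funext t
    obtain ⟨t, ht⟩ := t
    obtain ⟨x, y, z, hxy, hxz, hyz, rfl⟩ := htri t ht
    have := d1app (fun e => ∑ x ∈ e, g x) x y z hxy hxz hyz ht
    rw [Finset.sum_pair hxy, Finset.sum_pair hxz, Finset.sum_pair hyz] at this
    refine Eq.trans this ?_
    show _ = (0 : ZMod 2)
    generalize g x = p; generalize g y = q; generalize g z = r; revert p q r; decide
  have hd1s : ∀ e (he : e ∈ Ed T) (t : ↥T), d1 (Pi.single ⟨e, he⟩ 1) t = if e ⊆ t.1 then 1 else 0 := by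
    intro e he t
    show ∑ e' : ↥(Ed T), (if e'.1 ⊆ t.1 then (Pi.single (⟨e, he⟩ : ↥(Ed T)) 1 : ↥(Ed T) → ZMod 2) e' else 0) = _
    rw [Finset.sum_eq_single ⟨e, he⟩]
    · simp
    · intro b _ hb; simp [hb]
    · simp
  have hsurj : LinearMap.range d1 = ⊤ := by
    obtain ⟨e0, he0⟩ := bd
    obtain ⟨t0, ht0, het0⟩ := Bd_ex he0
    rw [mem_Bd] at he0
    have hall : ∀ t (ht : t ∈ T), (Pi.single (⟨t, ht⟩ : ↥T) 1 : ↥T → ZMod 2) ∈ LinearMap.range d1 := by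
      intro t ht
      have hp := conn t0 ht0 t ht
      induction hp with
      | refl =>
        refine ⟨Pi.single ⟨e0, mem_Ed.2 ⟨he0.1, t0, ht0, het0⟩⟩ 1, ?_⟩
        funext s
        rw [hd1s]
        by_cases hs : s = ⟨t0, ht0⟩
        · subst hs; simp [het0]
        · rw [if_neg, Pi.single_eq_of_ne hs]
          intro h; exact hs (Subtype.ext (deg_one_unique he0.2 s.2 h ht0 het0))
      | @tail y z _ r ih =>
        obtain ⟨r1, r2, -, -, r5⟩ := r
        have ih := ih r1
        by_cases hyz : z = y
        · subst hyz; exact ih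
        obtain ⟨e, he, hec⟩ := Finset.exists_subset_card_eq r5
        have hey : e ⊆ y := he.trans Finset.inter_subset_left
        have hez : e ⊆ z := he.trans Finset.inter_subset_right
        have : (Pi.single (⟨z, ht⟩ : ↥T) 1 : ↥T → ZMod 2) = d1 (Pi.single ⟨e, mem_Ed.2 ⟨hec, y, r1, hey⟩⟩ 1)
            - Pi.single (⟨y, r1⟩ : ↥T) 1 := by
          funext s
          rw [Pi.sub_apply, hd1s]
          by_cases h1 : s = ⟨z, ht⟩
          · subst h1
            have : (⟨z, ht⟩ : ↥T) ≠ ⟨y, r1⟩ := fun h => hyz (congrArg Subtype.val h)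
            rw [Pi.single_eq_same, if_pos hez, Pi.single_eq_of_ne this]; simp
          · rw [Pi.single_eq_of_ne h1]
            by_cases h2 : s = ⟨y, r1⟩
            · subst h2; simp [hey]
            · rw [Pi.single_eq_of_ne h2, if_neg]; · simp
              intro h
              exact h1 (Subtype.ext (deg_two_unique (deg2 e hec) r1 hey s.2 h r2 hez
                (fun h => h2 (Subtype.ext h)) hyz))
        rw [this]
        exact Submodule.sub_mem _ ⟨_, rfl⟩ ih
    rw [eq_top_iff]
    intro φ _
    rw [pi_eq_sum_univ' φ]
    refine Submodule.sum_mem _ fun t _ => Submodule.smul_mem _ _ ?_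
    convert hall t.1 t.2 using 1
  have hk0 : LinearMap.ker d0 ≤ Submodule.span (ZMod 2) {(fun _ => 1 : V → ZMod 2)} := by
    intro g hg
    rw [LinearMap.mem_ker] at hg
    have hedge : ∀ t ∈ T, ∀ x ∈ t, ∀ y ∈ t, g x = g y := by
      intro t ht x hx y hy
      by_cases hxy : x = y
      · rw [hxy]
      have h1 : ({x, y} : Finset V) ∈ Ed T := mem_Ed.2 ⟨Finset.card_pair hxy, t, ht, pair_sub.2 ⟨hx, hy⟩⟩
      have h2 : ∑ z ∈ ({x, y} : Finset V), g z = 0 := congrFun hg ⟨_, h1⟩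
      rw [Finset.sum_pair hxy] at h2
      revert h2; generalize g x = p; generalize g y = q; revert p q; decide
    have hconst : ∀ x y, g x = g y := by
      intro x y
      obtain ⟨s, hs, hxs⟩ := hv x
      obtain ⟨t, ht, hyt⟩ := hv y
      have hp := conn s hs t ht
      have : ∀ z ∈ t, g z = g x := by
        clear hyt
        induction hp with
        | refl => exact fun z hz => hedge s hs z hz x hxs
        | @tail y z _ r ih =>
          obtain ⟨r1, r2, -, -, r5⟩ := r
          obtain ⟨u, hu⟩ := Finset.card_pos.1 (show 0 < (y ∩ z).card by omega)
          rw [Finset.mem_inter] at hu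
          exact fun w hw => (hedge z r2 w hw u hu.2).trans (ih r1 u hu.1)
      exact (this y hyt).symm
    rw [Submodule.mem_span_singleton]
    obtain ⟨e0, he0⟩ := bd
    obtain ⟨x0, hx0⟩ := Finset.card_pos.1 (show 0 < e0.card by rw [(mem_Bd.1 he0).1]; norm_num)
    exact ⟨g x0, by funext y; simp [hconst y x0]⟩
  have f1 := LinearMap.finrank_range_add_finrank_ker d0
  have f2 := LinearMap.finrank_range_add_finrank_ker d1
  rw [hsurj, finrank_top] at f2
  rw [Module.finrank_fintype_fun_eq_card] at f1 f2
  rw [Module.finrank_fintype_fun_eq_card] at f2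
  rw [Fintype.card_coe] at f2
  rw [Fintype.card_coe] at f2
  have f3 := Submodule.finrank_mono hk0
  have f4 := finrank_span_le_card (R := ZMod 2) ({(fun _ => 1 : V → ZMod 2)} : Set (V → ZMod 2))
  simp only [Set.toFinset_singleton, Finset.card_singleton] at f4
  have f5 := Submodule.finrank_mono hker
  refine ⟨by omega, fun heq c hc => ?_⟩
  have hEq : LinearMap.range d0 = LinearMap.ker d1 :=
    Submodule.eq_of_le_of_finrank_le hker (by omega)
  have hcm : (fun e : ↥(Ed T) => c e.1) ∈ LinearMap.ker d1 := by
    rw [LinearMap.mem_ker]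
    funext t
    obtain ⟨t, ht⟩ := t
    obtain ⟨x, y, z, hxy, hxz, hyz, rfl⟩ := htri t ht
    rw [d1app c x y z hxy hxz hyz ht]
    exact hc x y z hxy hxz hyz ht
  rw [← hEq] at hcm
  obtain ⟨g, hg⟩ := hcm
  refine ⟨g, fun t ht x hx y hy hxy => ?_⟩
  have h1 : ({x, y} : Finset V) ∈ Ed T := mem_Ed.2 ⟨Finset.card_pair hxy, t, ht, pair_sub.2 ⟨hx, hy⟩⟩
  have h2 := congrFun hg ⟨_, h1⟩
  rw [← Finset.sum_pair hxy]; exact h2.symm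

lemma euler_rat {T : Finset (Finset V)} (tri : ∀ t ∈ T, t.card = 3) [Nonempty V]
    (H : ∀ c : V → V → ℤ, (∀ x y, c y x = - c x y) → (∀ x y z, x ≠ y → x ≠ z → y ≠ z → {x, y, z} ∈ T →
      c x y + c y z + c z x = 0) → ∃ g : V → ℤ, ∀ t ∈ T, ∀ x ∈ t, ∀ y ∈ t, c x y = g y - g x) :
    (Ed T).card + 1 ≤ Fintype.card V + T.card := by
  have hE : ∀ e : ↥(Ed T), ∃ p : V × V, p.1 ≠ p.2 ∧ e.1 = {p.1, p.2} := by
    intro e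
    obtain ⟨x, y, hxy, h⟩ := Finset.card_eq_two.1 (mem_Ed.1 e.2).1
    exact ⟨(x, y), hxy, h⟩
  choose o ho1 ho2 using hE
  have hTt : ∀ t : ↥T, ∃ p : V × V × V, p.1 ≠ p.2.1 ∧ p.1 ≠ p.2.2 ∧ p.2.1 ≠ p.2.2 ∧ t.1 = {p.1, p.2.1, p.2.2} := by
    intro t
    obtain ⟨x, y, z, h1, h2, h3, h⟩ := Finset.card_eq_three.1 (tri t.1 t.2)
    exact ⟨(x, y, z), h1, h2, h3, h⟩
  choose q hq1 hq2 hq3 hq4 using hTt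
  let sg : V → V → ↥(Ed T) → ℤ := fun x y e => if (o e) = (x, y) then 1 else if o e = (y, x) then -1 else 0
  have sg_anti : ∀ x y e, sg y x e = - sg x y e := by
    intro x y e
    simp only [sg]
    by_cases h1 : o e = (x, y)
    · have : o e ≠ (y, x) := fun h => ho1 e (by rw [h1] at h; simp at h; rw [h1]; exact h.1)
      rw [if_neg this, if_pos h1, if_pos h1]
    · by_cases h2 : o e = (y, x)
      · rw [if_pos h2, if_neg h1, if_pos h2]; rfl
      · rw [if_neg h2, if_neg h1, if_neg h1, if_neg h2]; rfl
  let hat : V → V → (↥(Ed T) → ℚ) →ₗ[ℚ] ℚ := fun x y => ∑ e, (sg x y e : ℚ) • LinearMap.proj e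
  have hat_app : ∀ x y c, hat x y c = ∑ e, (sg x y e : ℚ) * c e := by
    intro x y c; simp [hat]
  let d1 : (↥(Ed T) → ℚ) →ₗ[ℚ] (↥T → ℚ) := LinearMap.pi fun t =>
    hat (q t).1 (q t).2.1 + hat (q t).2.1 (q t).2.2 + hat (q t).2.2 (q t).1
  let d0 : (V → ℚ) →ₗ[ℚ] (↥(Ed T) → ℚ) := LinearMap.pi fun e =>
    (LinearMap.proj (o e).2 : (V → ℚ) →ₗ[ℚ] ℚ) - LinearMap.proj (o e).1
  have hker : LinearMap.ker d1 ≤ LinearMap.range d0 := by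
    intro c hc
    obtain ⟨⟨N, hN⟩, hNc⟩ := IsLocalization.exist_integer_multiples_of_finite (nonZeroDivisors ℤ) c
    choose c' hc' using hNc
    have hN0 : (N : ℚ) ≠ 0 := by simpa using nonZeroDivisors.ne_zero hN
    have hc'' : ∀ e, (c' e : ℚ) = N * c e := by intro e; simpa using hc' e
    let cc : V → V → ℤ := fun x y => ∑ e, sg x y e * c' e
    have ccc : ∀ x y, (cc x y : ℚ) = N * hat x y c := by
      intro x y
      simp only [cc, hat_app, Finset.mul_sum]; push_cast
      exact Finset.sum_congr rfl fun e _ => by rw [hc'']; ring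
    have anti : ∀ x y, cc y x = - cc x y := by
      intro x y; simp only [cc, sg_anti x y, neg_mul, Finset.sum_neg_distrib]
    obtain ⟨g, hg⟩ := H cc anti (by
      intro x y z hxy hxz hyz ht
      have h1 : cc (q ⟨_, ht⟩).1 (q ⟨_, ht⟩).2.1 + cc (q ⟨_, ht⟩).2.1 (q ⟨_, ht⟩).2.2
          + cc (q ⟨_, ht⟩).2.2 (q ⟨_, ht⟩).1 = 0 := by
        rw [← Int.cast_inj (α := ℚ)]; push_cast
        rw [ccc, ccc, ccc, ← mul_add, ← mul_add]
        have := congrFun hc ⟨_, ht⟩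
        have h2 : hat (q ⟨_, ht⟩).1 (q ⟨_, ht⟩).2.1 c + hat (q ⟨_, ht⟩).2.1 (q ⟨_, ht⟩).2.2 c
          + hat (q ⟨_, ht⟩).2.2 (q ⟨_, ht⟩).1 c = 0 := this
        rw [h2, mul_zero]
      have k1 := hq1 ⟨_, ht⟩
      have k2 := hq2 ⟨_, ht⟩
      have k3 := hq3 ⟨_, ht⟩
      have k4 := hq4 ⟨_, ht⟩
      generalize q ⟨_, ht⟩ = p at h1 k1 k2 k3 k4
      obtain ⟨a, b, v⟩ := p
      simp only at h1 k1 k2 k3 k4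
      have hx : x ∈ ({a, b, v} : Finset V) := k4 ▸ (by simp)
      have hy : y ∈ ({a, b, v} : Finset V) := k4 ▸ (by simp)
      have hz : z ∈ ({a, b, v} : Finset V) := k4 ▸ (by simp)
      have a1 := anti a b
      have a2 := anti a v
      have a3 := anti b v
      simp only [Finset.mem_insert, Finset.mem_singleton] at hx hy hz
      clear hc hc' ccc
      rcases hx with rfl | rfl | rfl <;> rcases hy with rfl | rfl | rfl <;>
          rcases hz with rfl | rfl | rfl <;> first | contradiction | omega)
    refine ⟨fun x => (g x : ℚ) / N, ?_⟩
    funext e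
    show (g (o e).2 : ℚ) / N - (g (o e).1 : ℚ) / N = c e
    obtain ⟨t, ht, het⟩ := (mem_Ed.1 e.2).2
    have hsub := ho2 e ▸ het
    have h1 := hg t ht (o e).1 (hsub (by simp)) (o e).2 (hsub (by simp))
    have h2 := ccc (o e).1 (o e).2
    have h3 : hat (o e).1 (o e).2 c = c e := by
      rw [hat_app, Finset.sum_eq_single e]
      · simp [sg]
      · intro e' _ hne
        have n1 : o e' ≠ o e := fun h => hne (Subtype.ext (by rw [ho2 e', ho2 e, h]))
        have n2 : o e' ≠ ((o e).2, (o e).1) := fun h => hne (Subtype.ext (by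
          rw [ho2 e', ho2 e, h]; exact Finset.pair_comm _ _))
        have n1' : o e' ≠ ((o e).1, (o e).2) := n1
        simp only [sg, if_neg n1', if_neg n2]; simp
      · simp
    rw [h3, h1] at h2
    push_cast at h2
    field_simp
    linarith
  have hk0 : Submodule.span ℚ {(fun _ => 1 : V → ℚ)} ≤ LinearMap.ker d0 := by
    rw [Submodule.span_singleton_le_iff_mem, LinearMap.mem_ker]
    funext e; simp [d0]
  have f1 := LinearMap.finrank_range_add_finrank_ker d0
  have f2 := LinearMap.finrank_range_add_finrank_ker d1
  have f3 := Submodule.finrank_mono hk0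
  rw [finrank_span_singleton (by
    obtain ⟨x⟩ := ‹Nonempty V›
    intro h; simpa using congrFun h x)] at f3
  have f4 := Submodule.finrank_mono hker
  have f5 := Submodule.finrank_le (LinearMap.range d1)
  rw [Module.finrank_fintype_fun_eq_card] at f1 f2 f5
  rw [Fintype.card_coe] at f2 f5
  omega

end Part10

section Part11
open Set Topology Filter Relation

/-- pullback of a subset under a homeomorphism of subsets -/
def Pb {E E' : Type*} [TopologicalSpace E] [TopologicalSpace E'] {X : Set E'} {D : Set E} (φ : X ≃ₜ D)
    (S : Set E) : Set E' := {x | ∃ hx : x ∈ X, (φ ⟨x, hx⟩ : E) ∈ S}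

lemma mem_Pb {E E' : Type*} [TopologicalSpace E] [TopologicalSpace E'] {X : Set E'} {D : Set E} {φ : X ≃ₜ D}
    {S : Set E} {x : E'} : x ∈ Pb φ S ↔ ∃ hx : x ∈ X, (φ ⟨x, hx⟩ : E) ∈ S := by simp [Pb]

lemma log_on {E E' : Type*} [NormedAddCommGroup E] [NormedSpace ℝ E] [TopologicalSpace E']
    {X : Set E'} {D S : Set E} (φ : X ≃ₜ D) (hSD : S ⊆ D) {x0 : E} (hs : StarConvex ℝ x0 S) (hx0 : x0 ∈ S)
    (f : E' → ℂ) (hf : ContinuousOn f (Pb φ S)) (h0 : ∀ x ∈ Pb φ S, f x ≠ 0) :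
    ∃ h : E' → ℂ, ContinuousOn h (Pb φ S) ∧ ∀ x ∈ Pb φ S, f x = Complex.exp (h x) := by
  classical
  let ψ : E → E' := fun y => if hy : y ∈ D then (φ.symm ⟨y, hy⟩ : E') else (φ.symm ⟨x0, hSD hx0⟩ : E')
  have hψ : ∀ y (hy : y ∈ D), ψ y = φ.symm ⟨y, hy⟩ := fun y hy => dif_pos hy
  have hψc : ContinuousOn ψ D := by
    rw [continuousOn_iff_continuous_restrict]
    have : D.domRestrict ψ = fun y => (φ.symm y : E') := by funext y; exact hψ y.1 y.2
    rw [this]; fun_prop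
  have hψm : MapsTo ψ S (Pb φ S) := by
    intro y hy
    rw [mem_Pb, hψ y (hSD hy)]
    exact ⟨(φ.symm _).2, by simpa using hy⟩
  obtain ⟨h, hc, he⟩ := exists_log_star hs hx0 (f ∘ ψ) (hf.comp (hψc.mono hSD) hψm)
    (fun x hx => h0 _ (hψm hx))
  let θ : E' → E := fun x => if hx : x ∈ X then (φ ⟨x, hx⟩ : E) else x0
  have hθ : ∀ y (hy : y ∈ X), θ y = φ ⟨y, hy⟩ := fun y hy => dif_pos hy
  have hθc : ContinuousOn θ X := by
    rw [continuousOn_iff_continuous_restrict]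
    have : X.domRestrict θ = fun y => (φ y : E) := by funext y; exact hθ y.1 y.2
    rw [this]; fun_prop
  have hPX : Pb φ S ⊆ X := fun x hx => (mem_Pb.1 hx).1
  have hθm : MapsTo θ (Pb φ S) S := by
    intro x hx
    obtain ⟨h1, h2⟩ := mem_Pb.1 hx
    rw [hθ x h1]; exact h2
  refine ⟨h ∘ θ, hc.comp (hθc.mono hPX) hθm, fun x hx => ?_⟩
  obtain ⟨h1, h2⟩ := mem_Pb.1 hx
  have := he (θ x) (hθm hx)
  rw [Function.comp_apply, ← this, Function.comp_apply, hψ _ (hSD (hθm hx))]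
  congr 1
  have : (⟨θ x, hSD (hθm hx)⟩ : D) = φ ⟨x, h1⟩ := Subtype.ext (hθ x h1)
  rw [this]; simp

variable {V : Type*} [DecidableEq V] [Fintype V]

lemma R_convex (t : Finset V) : Convex ℝ (R {t}) := by
  intro w hw w' hw' a b ha hb hab
  obtain ⟨h0, h1, s, hs, h2⟩ := mem_R.1 hw
  obtain ⟨h0', h1', s', hs', h2'⟩ := mem_R.1 hw'
  have e1 : s = t := hs
  have e2 : s' = t := hs'
  subst e1; subst e2
  refine mem_R.2 ⟨fun i => ?_, ?_, s', rfl, fun i hi => ?_⟩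
  · have := h0 i; have := h0' i
    simp only [Pi.add_apply, Pi.smul_apply, smul_eq_mul]; positivity
  · simp only [Pi.add_apply, Pi.smul_apply, smul_eq_mul, Finset.sum_add_distrib, ← Finset.mul_sum, h1, h1']
    linarith
  · by_contra hcon
    have k1 : w i = 0 := by by_contra h; exact hcon (h2 i h)
    have k2 : w' i = 0 := by by_contra h; exact hcon (h2' i h)
    simp [k1, k2] at hi

lemma mem_R1 {t : Finset V} {w : V → ℝ} :
    w ∈ R {t} ↔ (∀ i, 0 ≤ w i) ∧ ∑ i, w i = 1 ∧ ∀ i, w i ≠ 0 → i ∈ t := by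
  rw [mem_R]; simp

lemma single_mem {t : Finset V} {x : V} (hx : x ∈ t) : (Pi.single x 1 : V → ℝ) ∈ R {t} := by
  refine mem_R1.2 ⟨fun i => ?_, by simp, fun i hi => ?_⟩
  · by_cases h : i = x
    · subst h; simp
    · simp [h]
  · by_cases h : i = x
    · exact h ▸ hx
    · simp [h] at hi

lemma R_contOn {Y : Type*} [TopologicalSpace Y] {T : Finset (Finset V)} {f : (V → ℝ) → Y}
    (h : ∀ t ∈ T, ContinuousOn f (R {t})) : ContinuousOn f (R (T : Set (Finset V))) := by
  have : R (T : Set (Finset V)) = ⋃ t : ↥T, R {t.1} := by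
    ext w
    simp only [mem_iUnion, mem_R1]
    rw [mem_R]
    constructor
    · rintro ⟨h0, h1, s, hs, h2⟩; exact ⟨⟨s, hs⟩, h0, h1, h2⟩
    · rintro ⟨⟨s, hs⟩, h0, h1, h2⟩; exact ⟨h0, h1, s, hs, h2⟩
  rw [this]
  exact (locallyFinite_of_finite _).continuousOn_iUnion (fun i => (R_compact _).isClosed) fun i => h i.1 i.2

lemma cocycle_of_log {T : Finset (Finset V)} (tri : ∀ t ∈ T, t.card = 3)
    (HL : ∀ f : (V → ℝ) → ℂ, ContinuousOn f (R (T : Set (Finset V))) → (∀ x ∈ R (T : Set (Finset V)), f x ≠ 0) →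
      ∃ h : (V → ℝ) → ℂ, ContinuousOn h (R (T : Set (Finset V))) ∧ ∀ x ∈ R (T : Set (Finset V)), f x = Complex.exp (h x))
    (c : V → V → ℤ) (anti : ∀ x y, c y x = - c x y) (hc : ∀ x y z, x ≠ y → x ≠ z → y ≠ z → {x, y, z} ∈ T →
      c x y + c y z + c z x = 0) : ∃ g : V → ℤ, ∀ t ∈ T, ∀ x ∈ t, ∀ y ∈ t, c x y = g y - g x := by
  classical
  have hc' : ∀ t ∈ T, ∀ x ∈ t, ∀ y ∈ t, ∀ z ∈ t, c x z = c x y + c y z := by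
    intro t ht x hx y hy z hz
    have a1 := anti x y
    have a2 := anti x z
    have a3 := anti y z
    by_cases hxy : x = y
    · subst hxy; omega
    by_cases hxz : x = z
    · subst hxz; omega
    by_cases hyz : y = z
    · subst hyz; omega
    have := hc x y z hxy hxz hyz (tri_form (tri t ht) hxy hxz hyz hx hy hz ▸ ht)
    omega
  let a : (V → ℝ) → V → Prop := fun w x => w x ≠ 0
  let F : V → (V → ℝ) → ℂ := fun b w => 2 * Real.pi * Complex.I * ∑ x, (w x : ℂ) * (c b x : ℂ)
  have hFc : ∀ b, Continuous (F b) := fun b => by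
    refine continuous_const.mul (continuous_finsetSum _ fun i _ => ?_)
    exact (Complex.continuous_ofReal.comp (continuous_apply i)).mul continuous_const
  let f : (V → ℝ) → ℂ := fun w => if h : ∃ b, w b ≠ 0 then Complex.exp (F h.choose w) else 1
  have hf : ∀ t ∈ T, ∀ w ∈ R {t}, ∀ b ∈ t, f w = Complex.exp (F b w) := by
    intro t ht w hw b hb
    obtain ⟨h0, h1, h2⟩ := mem_R1.1 hw
    have hex : ∃ b, w b ≠ 0 := by
      by_contra hcon
      push Not at hcon
      simp [hcon] at h1
    have hfw : f w = Complex.exp (F hex.choose w) := dif_pos hex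
    rw [hfw]
    have hat := h2 _ hex.choose_spec
    generalize hex.choose = a at hat
    have h1' : ∑ x, (w x : ℂ) = 1 := by exact_mod_cast congrArg Complex.ofReal h1
    have : F a w = F b w + (c a b : ℂ) * (2 * Real.pi * Complex.I) := by
      have hs : ∑ x, (w x : ℂ) * (c a x : ℂ) = ∑ x, (w x : ℂ) * (c b x : ℂ) + ∑ x, (w x : ℂ) * (c a b : ℂ) := by
        rw [← Finset.sum_add_distrib]
        refine Finset.sum_congr rfl fun x _ => ?_
        by_cases hx : w x = 0
        · simp [hx]
        · rw [hc' t ht a hat b hb x (h2 x hx)]; push_cast; ring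
      simp only [F]
      rw [hs, ← Finset.sum_mul, h1']; ring
    rw [this, Complex.exp_add, Complex.exp_int_mul_two_pi_mul_I, mul_one]
  have hsub : ∀ t ∈ T, R {t} ⊆ R (T : Set (Finset V)) := fun t ht =>
    R_refine fun s hs => ⟨t, ht, by rw [show s = t from hs]⟩
  obtain ⟨h, hcont, he⟩ := HL f (R_contOn fun t ht => by
    obtain ⟨b, hb⟩ := Finset.card_pos.1 (show 0 < t.card by rw [tri t ht]; norm_num)
    exact (Complex.continuous_exp.comp (hFc b)).continuousOn.congr (fun w hw => hf t ht w hw b hb)) (by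
      intro x _
      simp only [f]
      split_ifs
      · exact Complex.exp_ne_zero _
      · exact one_ne_zero)
  have hpi : (2 * Real.pi * Complex.I : ℂ) ≠ 0 := Complex.two_pi_I_ne_zero
  have hF1 : ∀ b x, F b (Pi.single x 1) = 2 * Real.pi * Complex.I * c b x := by
    intro b x
    simp only [F]
    rw [Finset.sum_eq_single x]
    · simp
    · intro y _ hy; simp [hy]
    · simp
  have hg : ∀ x, ∃ k : ℤ, (∃ t ∈ T, x ∈ t) → h (Pi.single x 1) = k * (2 * Real.pi * Complex.I) := by
    intro x
    by_cases hx : ∃ t ∈ T, x ∈ t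
    · obtain ⟨t, ht, hxt⟩ := hx
      have h1 := he _ (hsub t ht (single_mem hxt))
      rw [hf t ht _ (single_mem hxt) x hxt, hF1] at h1
      have : c x x = 0 := by have := anti x x; omega
      rw [this] at h1
      simp only [Int.cast_zero, mul_zero, Complex.exp_zero] at h1
      obtain ⟨k, hk⟩ := Complex.exp_eq_one_iff.1 h1.symm
      exact ⟨k, fun _ => hk⟩
    · exact ⟨0, fun h => absurd h hx⟩
  choose g hg using hg
  refine ⟨g, fun t ht x hx y hy => ?_⟩
  have key := exp_one_const (h := fun w => h w - F x w) (R_convex t).isPreconnected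
    ((hcont.mono (hsub t ht)).sub (hFc x).continuousOn) (by
      intro w hw
      rw [Complex.exp_sub, ← he w (hsub t ht hw), hf t ht w hw x hx, div_self (Complex.exp_ne_zero _)])
    _ (single_mem hx) _ (single_mem hy)
  simp only [hF1] at key
  rw [hg x ⟨t, ht, hx⟩, hg y ⟨t, ht, hy⟩] at key
  have hxx : c x x = 0 := by have := anti x x; omega
  rw [hxx] at key
  have : (c x y : ℂ) = g y - g x := by
    apply mul_left_cancel₀ hpi
    simp at key
    linear_combination key
  exact_mod_cast this

lemma euler_ge_of_log {T : Finset (Finset V)} (tri : ∀ t ∈ T, t.card = 3) [Nonempty V]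
    {E : Type*} [NormedAddCommGroup E] [NormedSpace ℝ E]
    (φ : R (T : Set (Finset V)) ≃ₜ Metric.closedBall (0 : E) 1) :
    (Ed T).card + 1 ≤ Fintype.card V + T.card := by
  refine euler_rat tri (cocycle_of_log tri fun f hf h0 => ?_)
  have hP : Pb φ (Metric.closedBall (0 : E) 1) = R (T : Set (Finset V)) := by
    ext x; rw [mem_Pb]; exact ⟨fun h => h.1, fun h => ⟨h, (φ _).2⟩⟩
  have := log_on φ subset_rfl ((convex_closedBall (0 : E) 1).starConvex (Metric.mem_closedBall_self zero_le_one))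
    (Metric.mem_closedBall_self zero_le_one) f (by rwa [hP]) (by rwa [hP])
  rwa [hP] at this

end Part11

section Part12
open Set Topology Filter Relation

lemma sub_diff {E : Type*} {X : Set E} {x : E} (hx : x ∈ X) (W : Set X) :
    (Subtype.val '' W : Set E) \ {x} = Subtype.val '' (W \ {⟨x, hx⟩}) := by
  rw [image_sdiff Subtype.val_injective, image_singleton]

lemma locPC_sub {E : Type*} [MetricSpace E] {X : Set E} {x : E} (hx : x ∈ X) (h : LocPC X ⟨x, hx⟩)
    {N : Set E} (hN : N ∈ 𝓝 x) : ∃ W : Set E, W ⊆ X ∩ N ∧ (∃ r > 0, X ∩ Metric.ball x r ⊆ W) ∧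
      IsPreconnected (W \ {x}) ∧ (W \ {x}).Nonempty := by
  obtain ⟨W, hW, hWN, hc, hne⟩ := h (Subtype.val ⁻¹' N) (continuous_subtype_val.continuousAt.preimage_mem_nhds hN)
  refine ⟨Subtype.val '' W, ?_, ?_, ?_, ?_⟩
  · rintro _ ⟨y, hy, rfl⟩; exact ⟨y.2, hWN hy⟩
  · obtain ⟨r, hr, hb⟩ := Metric.mem_nhds_iff.1 hW
    exact ⟨r, hr, fun y hy => ⟨⟨y, hy.1⟩, hb hy.2, rfl⟩⟩
  · rw [sub_diff hx]; exact hc.image _ continuous_subtype_val.continuousOn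
  · rw [sub_diff hx]; exact hne.image _

lemma logRk_sub {E : Type*} [MetricSpace E] {X : Set E} {x : E} (hx : x ∈ X) (h : LogRk X ⟨x, hx⟩)
    {N : Set E} (hN : N ∈ 𝓝 x) {f g : E → ℂ} (hf : Continuous f) (hg : Continuous g)
    (h0 : ∀ y ∈ X ∩ N, y ≠ x → f y ≠ 0 ∧ g y ≠ 0) : ∃ W : Set E, (∃ r > 0, X ∩ Metric.ball x r ⊆ W) ∧
      ∃ p q : ℤ, (p ≠ 0 ∨ q ≠ 0) ∧ ∃ h : E → ℂ, ContinuousOn h (W \ {x}) ∧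
        ∀ y ∈ W \ {x}, f y ^ p * g y ^ q = Complex.exp (h y) := by
  classical
  obtain ⟨W, hW, hWN, p, q, hpq, k, hk, hke⟩ := h (Subtype.val ⁻¹' N)
    (continuous_subtype_val.continuousAt.preimage_mem_nhds hN) (fun y => f y) (fun y => g y)
    (by fun_prop) (by fun_prop) (fun y hy => h0 y ⟨y.2, hy.1⟩ fun h => hy.2 (Subtype.ext h))
  let k' : E → ℂ := fun y => if hy : y ∈ X then k ⟨y, hy⟩ else 0
  have hk' : ∀ y : X, k' y = k y := fun y => dif_pos y.2
  refine ⟨Subtype.val '' W, ?_, p, q, hpq, k', ?_, ?_⟩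
  · obtain ⟨r, hr, hb⟩ := Metric.mem_nhds_iff.1 hW
    exact ⟨r, hr, fun y hy => ⟨⟨y, hy.1⟩, hb hy.2, rfl⟩⟩
  · rw [sub_diff hx]
    rintro _ ⟨y, hy, rfl⟩
    have h1 := hk y hy
    unfold ContinuousWithinAt at h1 ⊢
    rw [hk', show 𝓝[Subtype.val '' (W \ {⟨x, hx⟩})] (y : E) = map Subtype.val (𝓝[W \ {⟨x, hx⟩}] y) from
      (IsEmbedding.subtypeVal.map_nhdsWithin_eq _ _).symm, tendsto_map'_iff]
    exact h1.congr fun z => (hk' z).symm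
  · rw [sub_diff hx]
    rintro _ ⟨y, hy, rfl⟩
    rw [hk']; exact hke y hy

lemma bdry_log {E F : Type*} [MetricSpace E] [NormedAddCommGroup F] [NormedSpace ℝ F] [StrictConvexSpace ℝ F]
    {X : Set E} (φ : X ≃ₜ Metric.closedBall (0 : F) 1) {x : E} (hx : x ∈ X) (h1 : ‖(φ ⟨x, hx⟩ : F)‖ = 1)
    {N : Set E} (hN : N ∈ 𝓝 x) {f : E → ℂ} (hf : Continuous f) (h0 : ∀ y ∈ X ∩ N, y ≠ x → f y ≠ 0) :
    ∃ W : Set E, (∃ r > 0, X ∩ Metric.ball x r ⊆ W) ∧ ∃ h : E → ℂ, ContinuousOn h (W \ {x}) ∧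
        ∀ y ∈ W \ {x}, f y = Complex.exp (h y) := by
  set z := φ ⟨x, hx⟩ with hz
  have hN' : φ.symm ⁻¹' (Subtype.val ⁻¹' N) ∈ 𝓝 z := by
    apply φ.symm.continuous.continuousAt.preimage_mem_nhds
    apply continuous_subtype_val.continuousAt.preimage_mem_nhds
    simpa [hz] using hN
  obtain ⟨r, hr, hb⟩ := Metric.mem_nhds_iff.1 hN'
  have : Nontrivial F := ⟨⟨(z : F), 0, fun h => by rw [h] at h1; simp at h1⟩⟩
  have hzs : (z : F) ∈ Metric.sphere (0 : F) 1 := by simpa using h1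
  have hconv : Convex ℝ (Metric.closedBall (0 : F) 1 \ {(z : F)}) := by
    rw [← StrictConvexSpace.extremePoints_closedBall_eq_sphere,
      (convex_closedBall (0 : F) 1).mem_extremePoints_iff_convex_sdiff] at hzs
    exact hzs.2
  set S := (Metric.closedBall (0 : F) 1 \ {(z : F)}) ∩ Metric.ball (z : F) r with hS
  have hSc : Convex ℝ S := hconv.inter (convex_ball _ _)
  set W := Pb φ (Metric.ball (z : F) r) with hW
  have hWS : W \ {x} = Pb φ S := by
    ext y
    rw [Set.mem_sdiff, hW, mem_Pb, mem_Pb]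
    constructor
    · rintro ⟨⟨hy, hyb⟩, hne⟩
      refine ⟨hy, ⟨⟨(φ _).2, fun h => hne ?_⟩, hyb⟩⟩
      have h2 : φ ⟨y, hy⟩ = φ ⟨x, hx⟩ := Subtype.ext h
      have := φ.injective h2
      exact congrArg Subtype.val this
    · rintro ⟨hy, ⟨⟨h2, h3⟩, hyb⟩⟩
      refine ⟨⟨hy, hyb⟩, fun h => h3 ?_⟩
      have h' : y = x := h
      subst h'; rfl
  have hWN : W ⊆ X ∩ N := by
    intro y hy
    obtain ⟨hyX, hyb⟩ := mem_Pb.1 hy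
    have h2 := hb (show φ ⟨y, hyX⟩ ∈ Metric.ball z r from hyb)
    simp at h2
    exact ⟨hyX, h2⟩
  have hx0 : (1 - min r 1 / 2) • (z : F) ∈ S := by
    have m1 : 0 < min r 1 := lt_min hr one_pos
    have m2 : min r 1 ≤ 1 := min_le_right _ _
    have m3 : min r 1 ≤ r := min_le_left _ _
    refine ⟨⟨?_, ?_⟩, ?_⟩
    · rw [mem_closedBall_zero_iff, norm_smul, h1, Real.norm_eq_abs, abs_of_pos (by linarith)]; linarith
    · intro h
      have h' : (1 - min r 1 / 2) • (z : F) = z := h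
      have := congrArg norm h'
      rw [norm_smul, h1, Real.norm_eq_abs, abs_of_pos (by linarith)] at this; linarith
    · rw [mem_ball_iff_norm, sub_smul, one_smul, sub_sub_cancel_left, norm_neg, norm_smul, h1,
        Real.norm_eq_abs, abs_of_pos (by linarith)]; linarith
  obtain ⟨h, hc, he⟩ := log_on φ (S := S) (fun y hy => hy.1.1) (hSc.starConvex hx0) hx0 f hf.continuousOn (by
    rw [← hWS]; intro y hy; exact h0 y (hWN hy.1) hy.2)
  rw [← hWS] at hc he
  refine ⟨W, ?_, h, hc, he⟩
  have : φ ⁻¹' (Metric.ball z r) ∈ 𝓝 (⟨x, hx⟩ : X) :=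
    φ.continuous.continuousAt.preimage_mem_nhds (Metric.ball_mem_nhds _ hr)
  obtain ⟨δ, hδ, hbδ⟩ := Metric.mem_nhds_iff.1 this
  refine ⟨δ, hδ, fun y hy => mem_Pb.2 ⟨hy.1, ?_⟩⟩
  exact hbδ (show (⟨y, hy.1⟩ : X) ∈ Metric.ball ⟨x, hx⟩ δ from hy.2)

lemma winding {E : Type*} [TopologicalSpace E] {W : Set E} {h : E → ℂ} (hc : ContinuousOn h W) {L : ℝ → E}
    (hL : Continuous L) (hLW : ∀ θ, L θ ∈ W) (hper : L (2 * Real.pi) = L 0) {ε : ℝ} (hε : 0 < ε) {k : ℤ}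
    {G : ℝ → ℂ} (hG : Continuous G) (hGper : G (2 * Real.pi) = G 0)
    (he : ∀ θ : ℝ, Complex.exp (h (L θ)) = (ε * Complex.exp (θ * Complex.I)) ^ k * Complex.exp (G θ)) :
    k = 0 := by
  have hh : Continuous (fun θ => h (L θ)) := by
    rw [← continuousOn_univ]; exact hc.comp hL.continuousOn fun θ _ => hLW θ
  have hε' : (ε : ℂ) = Complex.exp (Real.log ε : ℂ) := by
    rw [← Complex.ofReal_exp, Real.exp_log hε]
  have key := exp_one_const (h := fun θ : ℝ => h (L θ) - k * (Real.log ε + θ * Complex.I) - G θ)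
    isPreconnected_univ (by
      apply Continuous.continuousOn
      exact (hh.sub (by fun_prop)).sub hG) (by
      intro θ _
      rw [Complex.exp_sub, Complex.exp_sub, he θ, Complex.exp_int_mul, Complex.exp_add, ← hε']
      have : (ε * Complex.exp (θ * Complex.I)) ^ k ≠ 0 :=
        zpow_ne_zero _ (mul_ne_zero (by exact_mod_cast hε.ne') (Complex.exp_ne_zero _))
      field_simp [Complex.exp_ne_zero])
    0 (mem_univ _) (2 * Real.pi) (mem_univ _)
  simp only [hper, hGper] at key
  have h2 : (k : ℂ) * (2 * Real.pi * Complex.I) = 0 := by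
    push_cast at key; linear_combination key
  rcases mul_eq_zero.1 h2 with h | h
  · exact_mod_cast h
  · exact absurd h Complex.two_pi_I_ne_zero

end Part12

section Part13
open Set Topology Filter Relation

variable {V : Type*} [DecidableEq V] [Fintype V]

lemma eq_single {y : V → ℝ} {v : V} (h1 : ∑ i, y i = 1) (h : ∀ i, y i ≠ 0 → i = v) : y = Pi.single v 1 := by
  have h0 : ∀ i, i ≠ v → y i = 0 := fun i hi => by by_contra h'; exact hi (h i h')
  have : ∑ i, y i = y v := Finset.sum_eq_single v (fun i _ hi => h0 i hi) (by simp)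
  ext i
  by_cases hi : i = v
  · subst hi; simp; linarith
  · rw [h0 i hi]; simp [hi]

lemma sum_two {y : V → ℝ} {u v : V} (huv : u ≠ v) (h : ∀ i, y i ≠ 0 → i ∈ ({u, v} : Finset V)) :
    ∑ i, y i = y u + y v := by
  rw [← Finset.sum_pair huv]
  symm
  apply Finset.sum_subset (Finset.subset_univ _)
  intro i _ hi; by_contra h'; exact hi (h i h')

lemma sum_three {y : V → ℝ} {u v p : V} (huv : u ≠ v) (hup : u ≠ p) (hvp : v ≠ p)
    (h : ∀ i, y i ≠ 0 → i ∈ ({u, v, p} : Finset V)) :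
    ∑ i, y i = y u + y v + y p := by
  rw [add_assoc, ← Finset.sum_pair hvp, ← Finset.sum_insert (by simp [huv, hup])]
  symm
  apply Finset.sum_subset (Finset.subset_univ _)
  intro i _ hi; by_contra h'; exact hi (h i h')

lemma nhd_pos {x : V → ℝ} {v : V} (h : 0 < x v) : {w : V → ℝ | 0 < w v} ∈ 𝓝 x :=
  (isOpen_lt continuous_const (continuous_apply v)).mem_nhds h

lemma mem_R_of {C : Set (Finset V)} {s : Finset V} (hs : s ∈ C) {w : V → ℝ} (h : w ∈ R {s}) : w ∈ R C :=
  R_refine (fun t ht => ⟨s, hs, by have : t = s := ht; rw [this]⟩) h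

lemma no_iso {C : Set (Finset V)} {v : V} (hv : {v} ∈ C) (h : ∀ x, LPt (R C) x) :
    ∃ s ∈ C, v ∈ s ∧ 2 ≤ s.card := by
  have hx : (Pi.single v 1 : V → ℝ) ∈ R C := mem_R_of hv (single_mem (by simp))
  obtain ⟨W, hW, -, -, y, hy, hne⟩ := locPC_sub hx (h _).locPC (nhd_pos (v := v) (by simp))
  obtain ⟨hyC, hyN⟩ := hW hy
  obtain ⟨h0, h1, s, hs, h2⟩ := mem_R.1 hyC
  have hvs : v ∈ s := h2 v (ne_of_gt hyN)
  refine ⟨s, hs, hvs, ?_⟩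
  by_contra hc
  exact hne (eq_single h1 fun i hi => Finset.card_le_one.1 (by omega) _ (h2 i hi) _ hvs)

lemma no_free {C : Set (Finset V)} {u v : V} (huv : u ≠ v) (hv : {u, v} ∈ C) (h : ∀ x, LPt (R C) x) :
    ∃ s ∈ C, u ∈ s ∧ v ∈ s ∧ 3 ≤ s.card := by
  by_contra hcon
  push Not at hcon
  let P : ℝ → V → ℝ := fun a => a • Pi.single u 1 + (1 - a) • Pi.single v 1
  have Pu : ∀ a, P a u = a := fun a => by simp [P, huv]
  have Pv : ∀ a, P a v = 1 - a := fun a => by simp [P, huv.symm]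
  have hP : ∀ a, 0 ≤ a → a ≤ 1 → P a ∈ R C := fun a h0 h1 => mem_R_of hv
    (R_convex _ (single_mem (by simp)) (single_mem (by simp)) h0 (by linarith) (by ring))
  have hx := hP (1 / 2) (by norm_num) (by norm_num)
  obtain ⟨W, hW, ⟨r, hr, hb⟩, hc, -⟩ := locPC_sub hx (h _).locPC
    (inter_mem (nhd_pos (v := u) (by rw [Pu]; norm_num)) (nhd_pos (v := v) (by rw [Pv]; norm_num)))
  have hPc : Continuous P := by fun_prop
  obtain ⟨δ, hδ, hd⟩ := Metric.continuous_iff.1 hPc (1 / 2) r hr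
  have hmem : ∀ a, 0 ≤ a → a ≤ 1 → a ≠ 1 / 2 → |a - 1 / 2| < δ → P a ∈ W \ {P (1 / 2)} := by
    intro a h0 h1 h2 h3
    refine ⟨hb ⟨hP a h0 h1, hd a h3⟩, fun h => h2 ?_⟩
    have h' : P a = P (1 / 2) := h
    rw [← Pu a, h', Pu]
  have m1 : 0 < min δ 1 := lt_min hδ one_pos
  have m2 : min δ 1 ≤ 1 := min_le_right _ _
  have m3 : min δ 1 ≤ δ := min_le_left _ _
  have a1 := hmem (1 / 2 - min δ 1 / 2) (by linarith) (by linarith) (by linarith)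
    (by rw [abs_lt]; constructor <;> linarith)
  have a2 := hmem (1 / 2 + min δ 1 / 2) (by linarith) (by linarith) (by linarith)
    (by rw [abs_lt]; constructor <;> linarith)
  obtain ⟨y, ⟨hyW, hyx⟩, hy⟩ := hc.intermediate_value a1 a2 (f := fun y : V → ℝ => y u)
    (continuous_apply u).continuousOn (show (1 / 2 : ℝ) ∈ _ by
      simp only [Pu]; constructor <;> linarith)
  obtain ⟨hyC, hyu, hyv⟩ := hW hyW
  obtain ⟨h0, h1, s, hs, h2⟩ := mem_R.1 hyC
  have hus : u ∈ s := h2 u (ne_of_gt hyu)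
  have hvs : v ∈ s := h2 v (ne_of_gt hyv)
  have hsc := hcon s hs hus hvs
  have hse : {u, v} = s := Finset.eq_of_subset_of_card_le (pair_sub.2 ⟨hus, hvs⟩)
    (by rw [Finset.card_pair huv]; omega)
  rw [← hse] at h2
  have hsum := sum_two huv h2
  apply hyx
  show y = P (1 / 2)
  simp only at hy
  ext i
  by_cases hi : i = u
  · subst hi; rw [hy, Pu]
  by_cases hi' : i = v
  · subst hi'; rw [Pv]; linarith
  have : y i = 0 := by by_contra h'; have := h2 i h'; simp [hi, hi'] at this
  rw [this]; simp [P, hi, hi']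

/-- splitting off a dual component -/
lemma split_conn {T : Finset (Finset V)} {S : Set (V → ℝ)} (hS : IsPreconnected S) {A s t : Finset V}
    (hST : ∀ y ∈ S, ∃ a ∈ T, A ⊆ a ∧ y ∈ R {a})
    (hs : s ∈ T) (ht : t ∈ T) (hAs : A ⊆ s) (hAt : A ⊆ t)
    (hse : (S ∩ R {s}).Nonempty) (hte : (S ∩ R {t}).Nonempty)
    (hstep : ∀ a ∈ T, ∀ b ∈ T, A ⊆ a → A ⊆ b → ∀ y ∈ S, y ∈ R {a} → y ∈ R {b} → ReflTransGen (Rel T A) a b) :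
    ReflTransGen (Rel T A) s t := by
  by_contra hcon
  set C1 : Set (Finset V) := {a | a ∈ T ∧ A ⊆ a ∧ ReflTransGen (Rel T A) s a} with hC1
  set C2 : Set (Finset V) := {a | a ∈ T ∧ A ⊆ a ∧ ¬ ReflTransGen (Rel T A) s a} with hC2
  have m1 : ∀ a, a ∈ C1 ↔ a ∈ T ∧ A ⊆ a ∧ ReflTransGen (Rel T A) s a := fun a => by simp [hC1]
  have m2 : ∀ a, a ∈ C2 ↔ a ∈ T ∧ A ⊆ a ∧ ¬ ReflTransGen (Rel T A) s a := fun a => by simp [hC2]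
  obtain ⟨y, hyS, hy1, hy2⟩ := isPreconnected_closed_iff.1 hS (R C1) (R C2) (R_compact _).isClosed
    (R_compact _).isClosed (by
      intro y hy
      obtain ⟨a, ha, hAa, hya⟩ := hST y hy
      by_cases h : ReflTransGen (Rel T A) s a
      · exact Or.inl (mem_R_of ((m1 a).2 ⟨ha, hAa, h⟩) hya)
      · exact Or.inr (mem_R_of ((m2 a).2 ⟨ha, hAa, h⟩) hya))
    (hse.mono (inter_subset_inter_right _ fun w hw => mem_R_of ((m1 s).2 ⟨hs, hAs, .refl⟩) hw))
    (hte.mono (inter_subset_inter_right _ fun w hw => mem_R_of ((m2 t).2 ⟨ht, hAt, hcon⟩) hw))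
  obtain ⟨h0, h1, a, ha, h2⟩ := mem_R.1 hy1
  obtain ⟨-, -, b, hb, h3⟩ := mem_R.1 hy2
  rw [m1] at ha; rw [m2] at hb
  exact hb.2.2 (ha.2.2.trans (hstep a ha.1 b hb.1 ha.2.1 hb.2.1 y hyS (mem_R1.2 ⟨h0, h1, h2⟩) (mem_R1.2 ⟨h0, h1, h3⟩)))

lemma link_conn {T : Finset (Finset V)} (tri : ∀ t ∈ T, t.card = 3) (h : ∀ x, LPt (R (T : Set (Finset V))) x)
    {v : V} {s t : Finset V} (hs : s ∈ T) (ht : t ∈ T) (hvs : v ∈ s) (hvt : v ∈ t) :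
    ReflTransGen (Rel T {v}) s t := by
  have hx : (Pi.single v 1 : V → ℝ) ∈ R (T : Set (Finset V)) := mem_R_of hs (single_mem hvs)
  obtain ⟨W, hW, ⟨r, hr, hb⟩, hc, -⟩ := locPC_sub hx (h _).locPC (nhd_pos (v := v) (by simp))
  have hne : ∀ s ∈ T, v ∈ s → ((W \ {Pi.single v 1}) ∩ R {s}).Nonempty := by
    intro s hs hvs
    obtain ⟨y, hy, hyv⟩ := Finset.exists_mem_ne (show 1 < s.card by rw [tri s hs]; norm_num) v
    let P : ℝ → V → ℝ := fun a => (1 - a) • Pi.single v 1 + a • Pi.single y 1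
    have hPc : Continuous P := by fun_prop
    obtain ⟨δ, hδ, hd⟩ := Metric.continuous_iff.1 hPc 0 r hr
    have P0 : P 0 = Pi.single v 1 := by simp [P]
    have m1 : 0 < min δ 1 := lt_min hδ one_pos
    have m2 : min δ 1 ≤ 1 := min_le_right _ _
    have m3 : min δ 1 ≤ δ := min_le_left _ _
    have hm : P (min δ 1 / 2) ∈ R {s} := R_convex s (single_mem hvs) (single_mem hy) (by linarith)
      (by linarith) (by ring)
    refine ⟨P (min δ 1 / 2), ⟨hb ⟨mem_R_of hs hm, ?_⟩, fun h => ?_⟩, hm⟩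
    · rw [← P0]; apply hd; rw [Real.dist_eq, sub_zero, abs_of_pos (by linarith)]; linarith
    · have h' : P (min δ 1 / 2) = Pi.single v 1 := h
      have := congrFun h' y
      simp [P, hyv] at this; linarith
  refine split_conn hc ?_ hs ht (by simpa) (by simpa) (hne s hs hvs) (hne t ht hvt) ?_
  · intro y hy
    obtain ⟨hyC, hyN⟩ := hW hy.1
    obtain ⟨h0, h1, a, ha, h2⟩ := mem_R.1 hyC
    exact ⟨a, ha, by simpa using h2 v (ne_of_gt hyN), mem_R1.2 ⟨h0, h1, h2⟩⟩
  · intro a ha b hb hva hvb y hy hya hyb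
    obtain ⟨h0, h1, h2⟩ := mem_R1.1 hya
    obtain ⟨-, -, h3⟩ := mem_R1.1 hyb
    refine ReflTransGen.single ⟨ha, hb, hva, hvb, ?_⟩
    by_contra hlt
    refine hy.2 (eq_single h1 fun i hi => ?_)
    rw [Finset.singleton_subset_iff] at hva hvb
    exact Finset.card_le_one.1 (by omega) i (Finset.mem_inter.2 ⟨h2 i hi, h3 i hi⟩) v (Finset.mem_inter.2 ⟨hva, hvb⟩)

lemma glob_conn {T : Finset (Finset V)} (tri : ∀ t ∈ T, t.card = 3) (h : ∀ x, LPt (R (T : Set (Finset V))) x)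
    (hc : IsPreconnected (R (T : Set (Finset V)))) {s t : Finset V} (hs : s ∈ T) (ht : t ∈ T) :
    ReflTransGen (Rel T ∅) s t := by
  have hne : ∀ s ∈ T, (R (T : Set (Finset V)) ∩ R {s}).Nonempty := by
    intro s hs
    obtain ⟨v, hv⟩ := Finset.card_pos.1 (show 0 < s.card by rw [tri s hs]; norm_num)
    exact ⟨_, mem_R_of hs (single_mem hv), single_mem hv⟩
  refine split_conn hc ?_ hs ht (by simp) (by simp) (hne s hs) (hne t ht) ?_
  · intro y hy
    obtain ⟨h0, h1, a, ha, h2⟩ := mem_R.1 hy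
    exact ⟨a, ha, by simp, mem_R1.2 ⟨h0, h1, h2⟩⟩
  · intro a ha b hb _ _ y hy hya hyb
    obtain ⟨h0, h1, h2⟩ := mem_R1.1 hya
    obtain ⟨-, -, h3⟩ := mem_R1.1 hyb
    obtain ⟨i, hi⟩ : ∃ i, y i ≠ 0 := by
      by_contra hcon; push Not at hcon
      simp [hcon] at h1
    exact RTG.mono (by simp) (link_conn tri h ha hb (h2 i hi) (h3 i hi))

end Part13

section Part14
open Set Topology Filter Relation

variable {V : Type*} [DecidableEq V] [Fintype V]

lemma pert {s : Finset V} {x d : V → ℝ} (hx : x ∈ R {s}) (hd : ∑ i, d i = 0) (hs : ∀ i, d i ≠ 0 → i ∈ s)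
    (h0 : ∀ i, 0 ≤ x i + d i) : x + d ∈ R {s} := by
  obtain ⟨_, h1, h2⟩ := mem_R1.1 hx
  refine mem_R1.2 ⟨h0, by simp [Finset.sum_add_distrib, hd, h1], fun i hi => ?_⟩
  by_contra h
  have e1 : x i = 0 := by by_contra h'; exact h (h2 i h')
  have e2 : d i = 0 := by by_contra h'; exact h (hs i h')
  simp [e1, e2] at hi

lemma edge_loop {T : Set (Finset V)} {u v p r : V} (huv : u ≠ v) (hup : u ≠ p) (hvp : v ≠ p) (hur : u ≠ r)
    (hvr : v ≠ r) (hpr : p ≠ r) (hp : {u, v, p} ∈ T) (hr : {u, v, r} ∈ T) {x : V → ℝ} (hx : x ∈ R {{u, v}})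
    (hxu : 0 < x u) (hxv : 0 < x v) {ρ : ℝ} (hρ : 0 < ρ) :
    ∃ (ε : ℝ) (L : ℝ → V → ℝ), 0 < ε ∧ Continuous L ∧ L (2 * Real.pi) = L 0 ∧
      (∀ θ, L θ ∈ R T ∩ Metric.ball x ρ) ∧
      (∀ θ, L θ u - L θ v - (x u - x v) = ε * Real.cos θ) ∧
      (∀ θ, L θ u + L θ v = 1 - ε * |Real.sin θ|) ∧ (∀ θ, L θ p = ε * max (Real.sin θ) 0) ∧
      (∀ q, q ≠ u → q ≠ v → q ≠ p → q ≠ r → ∀ θ, L θ q = 0) := by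
  obtain ⟨k0, k1, k2⟩ := mem_R1.1 hx
  have hz : ∀ i, i ≠ u → i ≠ v → x i = 0 := fun i h1 h2 => by
    by_contra h'; have := k2 i h'; simp [h1, h2] at this
  rw [sum_two huv k2] at k1
  let m := min (min (x u) (x v)) ρ
  have hm : 0 < m := lt_min (lt_min hxu hxv) hρ
  have hmu : m ≤ x u := (min_le_left _ _).trans (min_le_left _ _)
  have hmv : m ≤ x v := (min_le_left _ _).trans (min_le_right _ _)
  have hmρ : m ≤ ρ := min_le_right _ _
  let ε := m / 2
  have hε : 0 < ε := by positivity
  let S : V → V → ℝ := fun a => Pi.single a 1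
  let d : ℝ → V → ℝ := fun θ => ε • ((Real.cos θ / 2) • (S u - S v)
    + max (Real.sin θ) 0 • (S p - (1 / 2 : ℝ) • (S u + S v))
    + max (-Real.sin θ) 0 • (S r - (1 / 2 : ℝ) • (S u + S v)))
  have hc : ∀ θ, max (Real.sin θ) 0 + max (-Real.sin θ) 0 = |Real.sin θ| := fun θ => by
    rcases le_total 0 (Real.sin θ) with h | h
    · rw [max_eq_left h, max_eq_right (by linarith), abs_of_nonneg h, add_zero]
    · rw [max_eq_right h, max_eq_left (by linarith), abs_of_nonpos h, zero_add]
  have du : ∀ θ, d θ u = ε * (Real.cos θ / 2 - |Real.sin θ| / 2) := fun θ => by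
    rw [← hc]; simp only [d, S, Pi.smul_apply, Pi.add_apply, Pi.sub_apply, smul_eq_mul, Pi.single_eq_same,
      Pi.single_eq_of_ne huv, Pi.single_eq_of_ne hup, Pi.single_eq_of_ne hur]; ring
  have dv : ∀ θ, d θ v = ε * (-(Real.cos θ / 2) - |Real.sin θ| / 2) := fun θ => by
    rw [← hc]; simp only [d, S, Pi.smul_apply, Pi.add_apply, Pi.sub_apply, smul_eq_mul, Pi.single_eq_same,
      Pi.single_eq_of_ne huv.symm, Pi.single_eq_of_ne hvp, Pi.single_eq_of_ne hvr]; ring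
  have dp : ∀ θ, d θ p = ε * max (Real.sin θ) 0 := fun θ => by
    simp [d, S, hup.symm, hvp.symm, hpr]
  have dr : ∀ θ, d θ r = ε * max (-Real.sin θ) 0 := fun θ => by
    simp [d, S, hur.symm, hvr.symm, hpr.symm]
  have dq : ∀ q, q ≠ u → q ≠ v → q ≠ p → q ≠ r → ∀ θ, d θ q = 0 := fun q h1 h2 h3 h4 θ => by
    simp [d, S, h1, h2, h3, h4]
  have hds : ∀ θ, ∑ i, d θ i = 0 := fun θ => by
    have hS : ∀ a, ∑ i, S a i = 1 := fun a => by simp [S]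
    simp only [d, Pi.smul_apply, Pi.add_apply, Pi.sub_apply, smul_eq_mul, Finset.sum_add_distrib,
      Finset.sum_sub_distrib, ← Finset.mul_sum, hS]
    ring
  have hdb : ∀ θ i, |d θ i| ≤ ε := by
    intro θ i
    have c1 := abs_le.1 (Real.abs_cos_le_one θ)
    have c2 := Real.abs_sin_le_one θ
    have c3 := abs_nonneg (Real.sin θ)
    have c4 := abs_le.1 c2
    have key : ∀ t : ℝ, |t| ≤ 1 → |ε * t| ≤ ε := fun t ht => by
      rw [abs_mul, abs_of_pos hε]; nlinarith
    by_cases h1 : i = u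
    · rw [h1, du]; apply key; rw [abs_le]; constructor <;> linarith
    by_cases h2 : i = v
    · rw [h2, dv]; apply key; rw [abs_le]; constructor <;> linarith
    by_cases h3 : i = p
    · rw [h3, dp]; apply key; rw [abs_of_nonneg (le_max_right _ _)]; exact max_le (by linarith) zero_le_one
    by_cases h4 : i = r
    · rw [h4, dr]; apply key; rw [abs_of_nonneg (le_max_right _ _)]; exact max_le (by linarith) zero_le_one
    rw [dq i h1 h2 h3 h4]; simpa using hε.le
  have hdn : ∀ θ i, 0 ≤ x i + d θ i := by
    intro θ i
    have := (abs_le.1 (hdb θ i)).1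
    by_cases h1 : i = u
    · subst h1; simp only [ε] at this; linarith
    by_cases h2 : i = v
    · subst h2; simp only [ε] at this; linarith
    rw [hz i h1 h2, zero_add]
    by_cases h3 : i = p
    · rw [h3, dp]; positivity
    by_cases h4 : i = r
    · rw [h4, dr]; positivity
    rw [dq i h1 h2 h3 h4]
  refine ⟨ε, fun θ => x + d θ, hε, by fun_prop, by simp [d], fun θ => ⟨?_, ?_⟩, ?_, ?_, ?_, ?_⟩
  · rcases le_total 0 (Real.sin θ) with h | h
    · refine mem_R_of hp (pert (R_refine ?_ hx) (hds θ) (fun i hi => ?_) (hdn θ))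
      · intro s hs; exact ⟨_, rfl, by have : s = {u, v} := hs; rw [this]; simp [pair_sub]⟩
      · by_contra hni; simp at hni
        by_cases h4 : i = r
        · rw [h4, dr, max_eq_right (by linarith)] at hi; simp at hi
        · exact hi (dq i hni.1 hni.2.1 hni.2.2 h4 θ)
    · refine mem_R_of hr (pert (R_refine ?_ hx) (hds θ) (fun i hi => ?_) (hdn θ))
      · intro s hs; exact ⟨_, rfl, by have : s = {u, v} := hs; rw [this]; simp [pair_sub]⟩
      · by_contra hni; simp at hni
        by_cases h4 : i = p
        · rw [h4, dp, max_eq_right (by linarith)] at hi; simp at hi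
        · exact hi (dq i hni.1 hni.2.1 h4 hni.2.2 θ)
  · rw [mem_ball_iff_norm, add_sub_cancel_left]
    refine lt_of_le_of_lt ((pi_norm_le_iff_of_nonneg hε.le).2 fun i => by rw [Real.norm_eq_abs]; exact hdb θ i) ?_
    simp only [ε]; linarith
  · intro θ; simp only [Pi.add_apply, du, dv]; ring
  · intro θ; simp only [Pi.add_apply, du, dv]; linarith
  · intro θ; simp only [Pi.add_apply, dp, hz p hup.symm hvp.symm, zero_add]
  · intro q h1 h2 h3 h4 θ; simp only [Pi.add_apply, dq q h1 h2 h3 h4, hz q h1 h2, zero_add]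

/-- the folding function at an edge point -/
noncomputable def fld (x : V → ℝ) (u v p : V) (w : V → ℝ) : ℂ :=
  ⟨w u - w v - (x u - x v), 2 * w p + w u + w v - 1⟩

lemma fld_cont (x : V → ℝ) (u v p : V) : Continuous (fld x u v p) := by
  have : fld x u v p = fun w => ((w u - w v - (x u - x v) : ℝ) : ℂ) + ((2 * w p + w u + w v - 1 : ℝ) : ℂ) * Complex.I := by
    ext w; exact (Complex.mk_eq_add_mul_I _ _)
  rw [this]; fun_prop

lemma fld_ne {T : Finset (Finset V)} (tri : ∀ t ∈ T, t.card = 3) {u v p : V} (huv : u ≠ v) (hup : u ≠ p)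
    (hvp : v ≠ p) {x : V → ℝ} (hx : x ∈ R {{u, v}}) {y : V → ℝ}
    (hy : y ∈ R (T : Set (Finset V)) ∩ ({w | 0 < w u} ∩ {w | 0 < w v})) (hne : y ≠ x) : fld x u v p y ≠ 0 := by
  obtain ⟨k0, k1, k2⟩ := mem_R1.1 hx
  rw [sum_two huv k2] at k1
  obtain ⟨hyT, hyu, hyv⟩ := hy
  obtain ⟨h0, h1, s, hs, h2⟩ := mem_R.1 hyT
  have hus : u ∈ s := h2 u (ne_of_gt hyu)
  have hvs : v ∈ s := h2 v (ne_of_gt hyv)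
  obtain ⟨z, hz, hzn⟩ : ∃ z ∈ s, z ∉ ({u, v} : Finset V) := Finset.exists_mem_notMem_of_card_lt_card
    (by rw [tri s hs, Finset.card_pair huv]; norm_num)
  simp at hzn
  have hse := tri_form (tri s hs) huv (Ne.symm hzn.1) (Ne.symm hzn.2) hus hvs hz
  rw [hse] at h2
  rw [sum_three huv (Ne.symm hzn.1) (Ne.symm hzn.2) h2] at h1
  intro h
  have e1 := congrArg Complex.re h
  have e2 := congrArg Complex.im h
  simp [fld] at e1 e2
  have hyz : y z = 0 := by
    by_cases hzp : z = p
    · subst hzp; linarith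
    · have : y p = 0 := by
        by_contra h'; have := h2 p h'; simp [hup.symm, hvp.symm, Ne.symm hzp] at this
      rw [this] at e2; linarith
  apply hne
  ext i
  by_cases hi : i = u
  · rw [hi]; linarith
  by_cases hi2 : i = v
  · rw [hi2]; linarith
  have a1 : x i = 0 := by by_contra h'; have := k2 i h'; simp [hi, hi2] at this
  by_cases hi3 : i = z
  · rw [hi3] at a1 ⊢; rw [hyz, a1]
  rw [a1]
  by_contra h'; have := h2 i h'; simp [hi, hi2, hi3] at this

lemma fld_loop {x : V → ℝ} {u v p : V} {w : V → ℝ} {ε θ : ℝ} (h1 : w u - w v - (x u - x v) = ε * Real.cos θ)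
    (h2 : w u + w v = 1 - ε * |Real.sin θ|) (h3 : w p = ε * max (Real.sin θ) 0) :
    fld x u v p w = ε * Complex.exp (θ * Complex.I) := by
  apply Complex.ext
  · simp [fld, Complex.exp_ofReal_mul_I_re, h1]
  · simp only [fld, h3, Complex.im_ofReal_mul, Complex.exp_ofReal_mul_I_im]
    rcases le_total 0 (Real.sin θ) with h | h
    · rw [abs_of_nonneg h] at h2; rw [max_eq_left h]; linarith
    · rw [abs_of_nonpos h] at h2; rw [max_eq_right h]; linarith

lemma fld_loop' {x : V → ℝ} {u v p : V} {w : V → ℝ} {ε θ : ℝ} (h1 : w u - w v - (x u - x v) = ε * Real.cos θ)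
    (h2 : w u + w v = 1 - ε * |Real.sin θ|) (h3 : w p = 0) :
    fld x u v p w = ε * Complex.exp ((-Real.arccos (Real.cos θ) : ℝ) * Complex.I) := by
  have hs : Real.sin (Real.arccos (Real.cos θ)) = |Real.sin θ| := by
    rw [Real.sin_arccos, ← Real.sqrt_sq_eq_abs]; congr 1; linarith [Real.sin_sq_add_cos_sq θ]
  apply Complex.ext
  · simp only [fld, Complex.re_ofReal_mul, Complex.exp_ofReal_mul_I_re, h1, Real.cos_neg]
    rw [Real.cos_arccos (Real.neg_one_le_cos _) (Real.cos_le_one _)]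
  · simp only [fld, h3, Complex.im_ofReal_mul, Complex.exp_ofReal_mul_I_im, Real.sin_neg, hs]
    linarith

lemma exp_zero {T : Set (Finset V)} {u v p q r : V} (huv : u ≠ v) (hup : u ≠ p) (hvp : v ≠ p) (hur : u ≠ r)
    (hvr : v ≠ r) (hpr : p ≠ r) (hp : {u, v, p} ∈ T) (hr : {u, v, r} ∈ T) {x : V → ℝ} (hx : x ∈ R {{u, v}})
    (hxu : 0 < x u) (hxv : 0 < x v) (hqu : q ≠ u) (hqv : q ≠ v) (hqp : q ≠ p) (hqr : q ≠ r)
    {W : Set (V → ℝ)} {ρ : ℝ} (hρ : 0 < ρ) (hW : R T ∩ Metric.ball x ρ ⊆ W) {a b : ℤ} {h : (V → ℝ) → ℂ}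
    (hc : ContinuousOn h (W \ {x}))
    (he : ∀ y ∈ W \ {x}, fld x u v p y ^ a * fld x u v q y ^ b = Complex.exp (h y)) : a = 0 := by
  obtain ⟨ε, L, hε, hL, hper, hLW, l1, l2, l3, l4⟩ := edge_loop huv hup hvp hur hvr hpr hp hr hx hxu hxv hρ
  have f1 : ∀ θ, fld x u v p (L θ) = ε * Complex.exp (θ * Complex.I) := fun θ => fld_loop (l1 θ) (l2 θ) (l3 θ)
  have f2 := fun θ => fld_loop' (l1 θ) (l2 θ) (l4 q hqu hqv hqp hqr θ)
  have hx0 : fld x u v p x = 0 := by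
    obtain ⟨k0, k1, k2⟩ := mem_R1.1 hx
    rw [sum_two huv k2] at k1
    have : x p = 0 := by by_contra h'; have := k2 p h'; simp [hup.symm, hvp.symm] at this
    apply Complex.ext <;> simp [fld, this]; linarith
  have hmem : ∀ θ, L θ ∈ W \ {x} := fun θ => ⟨hW (hLW θ), fun h' => by
    have h2 : L θ = x := h'
    have := f1 θ
    rw [h2, hx0] at this
    exact (mul_ne_zero (by exact_mod_cast hε.ne') (Complex.exp_ne_zero _)) this.symm⟩
  have hε' : (ε : ℂ) = Complex.exp (Real.log ε : ℂ) := by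
    rw [← Complex.ofReal_exp, Real.exp_log hε]
  refine winding hc hL hmem hper hε (k := a)
    (G := fun θ => b * (Real.log ε + (-Real.arccos (Real.cos θ) : ℝ) * Complex.I)) ?_ (by simp) ?_
  · have := Real.continuous_arccos.comp Real.continuous_cos
    simp only [Function.comp_def] at this
    fun_prop
  · intro θ
    rw [← he _ (hmem θ), f1, f2, Complex.exp_int_mul, Complex.exp_add, ← hε']

lemma third {T : Finset (Finset V)} (tri : ∀ t ∈ T, t.card = 3) {u v : V} (huv : u ≠ v) {s : Finset V}
    (hs : s ∈ T) (he : {u, v} ⊆ s) : ∃ p, u ≠ p ∧ v ≠ p ∧ s = {u, v, p} := by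
  obtain ⟨z, hz, hzn⟩ : ∃ z ∈ s, z ∉ ({u, v} : Finset V) := Finset.exists_mem_notMem_of_card_lt_card
    (by rw [tri s hs, Finset.card_pair huv]; norm_num)
  simp at hzn
  rw [pair_sub] at he
  exact ⟨z, Ne.symm hzn.1, Ne.symm hzn.2, tri_form (tri s hs) huv (Ne.symm hzn.1) (Ne.symm hzn.2) he.1 he.2 hz⟩

lemma deg_le_two {T : Finset (Finset V)} (tri : ∀ t ∈ T, t.card = 3) (h : ∀ x, LPt (R (T : Set (Finset V))) x)
    {e : Finset V} (hec : e.card = 2) : deg T e ≤ 2 := by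
  obtain ⟨u, v, huv, rfl⟩ := Finset.card_eq_two.1 hec
  by_contra hcon
  obtain ⟨s1, h1, s2, h2, s3, h3, h12, h13, h23⟩ := Finset.two_lt_card.1 (not_le.1 hcon)
  rw [Finset.mem_filter] at h1 h2 h3
  obtain ⟨p, hup, hvp, rfl⟩ := third tri huv h1.1 h1.2
  obtain ⟨q, huq, hvq, rfl⟩ := third tri huv h2.1 h2.2
  obtain ⟨r, hur, hvr, rfl⟩ := third tri huv h3.1 h3.2
  have hpq : p ≠ q := fun h => h12 (by rw [h])
  have hpr : p ≠ r := fun h => h13 (by rw [h])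
  have hqr : q ≠ r := fun h => h23 (by rw [h])
  let x : V → ℝ := (1 / 2 : ℝ) • Pi.single u 1 + (1 / 2 : ℝ) • Pi.single v 1
  have hx : x ∈ R {{u, v}} := R_convex _ (single_mem (by simp)) (single_mem (by simp)) (by norm_num)
    (by norm_num) (by norm_num)
  have hxu : 0 < x u := by simp [x, huv]
  have hxv : 0 < x v := by simp [x, huv.symm]
  have hxT : x ∈ R (T : Set (Finset V)) := R_refine (fun t ht => ⟨_, h1.1, by
    have : t = {u, v} := ht
    rw [this]; exact h1.2⟩) hx
  obtain ⟨W, ⟨ρ, hρ, hW⟩, a, b, hab, k, hk, hke⟩ := logRk_sub hxT (h _).logRk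
    (inter_mem (nhd_pos hxu) (nhd_pos hxv)) (fld_cont x u v p) (fld_cont x u v q)
    (fun y hy hne => ⟨fld_ne tri huv hup hvp hx hy hne, fld_ne tri huv huq hvq hx hy hne⟩)
  have ha := exp_zero huv hup hvp hur hvr hpr h1.1 h3.1 hx hxu hxv huq.symm hvq.symm hpq.symm hqr hρ hW hk hke
  have hb := exp_zero huv huq hvq hur hvr hqr h2.1 h3.1 hx hxu hxv hup.symm hvp.symm hpq hpr hρ hW hk
    (fun y hy => by rw [mul_comm]; exact hke y hy)
  rcases hab with h | h
  · exact h ha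
  · exact h hb

end Part14

section Part15
open Set Topology Filter Relation

variable {V : Type*} [DecidableEq V] [Fintype V]

lemma tri_loop {u v p : V} (huv : u ≠ v) (hup : u ≠ p) (hvp : v ≠ p)
    {x : V → ℝ} (hx : x ∈ R {{u, v, p}})
    (hxu : 0 < x u) (hxv : 0 < x v) (hxp : 0 < x p) {ρ : ℝ} (hρ : 0 < ρ) :
    ∃ (ε : ℝ) (L : ℝ → V → ℝ), 0 < ε ∧ Continuous L ∧ L (2 * Real.pi) = L 0 ∧
      (∀ θ, L θ ∈ R {{u, v, p}} ∩ Metric.ball x ρ) ∧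
      (∀ θ, L θ u - x u = ε * Real.cos θ) ∧ (∀ θ, L θ v - x v = ε * Real.sin θ) := by
  obtain ⟨k0, k1, k2⟩ := mem_R1.1 hx
  have hz : ∀ i, i ≠ u → i ≠ v → i ≠ p → x i = 0 := fun i h1 h2 h3 => by
    by_contra h'; have := k2 i h'; simp [h1, h2, h3] at this
  obtain ⟨ε, hε, e1, e2, e3, e4⟩ : ∃ ε : ℝ, 0 < ε ∧ 2 * ε < x u ∧ 2 * ε < x v ∧ 2 * ε < x p ∧ 2 * ε < ρ := by
    refine ⟨min (min (x u) (x v)) (min (x p) ρ) / 4, by positivity, ?_⟩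
    have a0 : 0 < min (min (x u) (x v)) (min (x p) ρ) := by positivity
    have a1 := min_le_left (min (x u) (x v)) (min (x p) ρ)
    have a2 := min_le_right (min (x u) (x v)) (min (x p) ρ)
    have a3 := min_le_left (x u) (x v)
    have a4 := min_le_right (x u) (x v)
    have a5 := min_le_left (x p) ρ
    have a6 := min_le_right (x p) ρ
    refine ⟨?_, ?_, ?_, ?_⟩ <;> linarith
  let S : V → V → ℝ := fun a => Pi.single a 1
  let d : ℝ → V → ℝ := fun θ => ε • (Real.cos θ • (S u - S p) + Real.sin θ • (S v - S p))
  have du : ∀ θ, d θ u = ε * Real.cos θ := fun θ => by simp [d, S, huv, hup]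
  have dv : ∀ θ, d θ v = ε * Real.sin θ := fun θ => by simp [d, S, huv.symm, hvp]
  have dp : ∀ θ, d θ p = ε * (-Real.cos θ - Real.sin θ) := fun θ => by
    simp [d, S, hup.symm, hvp.symm]; ring
  have dq : ∀ q, q ≠ u → q ≠ v → q ≠ p → ∀ θ, d θ q = 0 := fun q h1 h2 h3 θ => by
    simp [d, S, h1, h2, h3]
  have hds : ∀ θ, ∑ i, d θ i = 0 := fun θ => by
    have hS : ∀ a, ∑ i, S a i = 1 := fun a => by simp [S]
    simp only [d, Pi.smul_apply, Pi.add_apply, Pi.sub_apply, smul_eq_mul, Finset.sum_add_distrib,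
      Finset.sum_sub_distrib, ← Finset.mul_sum, hS]
    ring
  have hdb : ∀ θ i, |d θ i| ≤ 2 * ε := by
    intro θ i
    have c1 := abs_le.1 (Real.abs_cos_le_one θ)
    have c4 := abs_le.1 (Real.abs_sin_le_one θ)
    have key : ∀ t : ℝ, |t| ≤ 2 → |ε * t| ≤ 2 * ε := fun t ht => by
      rw [abs_mul, abs_of_pos hε]; nlinarith
    by_cases h1 : i = u
    · rw [h1, du]; apply key; rw [abs_le]; constructor <;> linarith
    by_cases h2 : i = v
    · rw [h2, dv]; apply key; rw [abs_le]; constructor <;> linarith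
    by_cases h3 : i = p
    · rw [h3, dp]; apply key; rw [abs_le]; constructor <;> linarith
    rw [dq i h1 h2 h3]; simpa using hε.le
  have hdn : ∀ θ i, 0 ≤ x i + d θ i := by
    intro θ i
    have := (abs_le.1 (hdb θ i)).1
    by_cases h1 : i = u
    · subst h1; linarith
    by_cases h2 : i = v
    · subst h2; linarith
    by_cases h3 : i = p
    · subst h3; linarith
    rw [hz i h1 h2 h3, dq i h1 h2 h3, zero_add]
  refine ⟨ε, fun θ => x + d θ, hε, by fun_prop, by simp [d], fun θ => ⟨?_, ?_⟩, ?_, ?_⟩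
  · refine pert hx (hds θ) (fun i hi => ?_) (hdn θ)
    by_contra hni; simp at hni
    exact hi (dq i hni.1 hni.2.1 hni.2.2 θ)
  · rw [mem_ball_iff_norm, add_sub_cancel_left]
    exact lt_of_le_of_lt ((pi_norm_le_iff_of_nonneg (by positivity)).2 fun i => by
      rw [Real.norm_eq_abs]; exact hdb θ i) e4
  · intro θ; simp only [Pi.add_apply, du]; ring
  · intro θ; simp only [Pi.add_apply, dv]; ring

lemma wind1 {E : Type*} [MetricSpace E] {X : Set E} {x : E} {f : E → ℂ} (hfx : f x = 0) {W : Set E} {ρ ε : ℝ}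
    (hW : X ∩ Metric.ball x ρ ⊆ W) {h : E → ℂ} (hc : ContinuousOn h (W \ {x}))
    (he : ∀ y ∈ W \ {x}, f y = Complex.exp (h y)) {L : ℝ → E} (hε : 0 < ε) (hL : Continuous L)
    (hper : L (2 * Real.pi) = L 0) (hLW : ∀ θ, L θ ∈ X ∩ Metric.ball x ρ)
    (hf : ∀ θ, f (L θ) = ε * Complex.exp (θ * Complex.I)) : False := by
  have hmem : ∀ θ, L θ ∈ W \ {x} := fun θ => ⟨hW (hLW θ), fun h' => by
    have h2 : L θ = x := h'
    have := hf θ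
    rw [h2, hfx] at this
    exact (mul_ne_zero (by exact_mod_cast hε.ne') (Complex.exp_ne_zero _)) this.symm⟩
  exact one_ne_zero (winding hc hL hmem hper hε (k := 1) (G := fun _ => 0) continuous_const rfl
    fun θ => by rw [← he _ (hmem θ), hf]; simp)

lemma bd_exists {T : Finset (Finset V)} (tri : ∀ t ∈ T, t.card = 3) {E : Type*} [NormedAddCommGroup E]
    [NormedSpace ℝ E] [StrictConvexSpace ℝ E] (hE : 1 < Module.rank ℝ E)
    (φ : R (T : Set (Finset V)) ≃ₜ Metric.closedBall (0 : E) 1) : ∃ e, e ∈ Bd T := by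
  by_contra hcon
  push Not at hcon
  have : Nontrivial E := (rank_pos_iff_nontrivial (R := ℝ)).1 (lt_trans zero_lt_one hE)
  have hinf : (Metric.sphere (0 : E) 1).Infinite := by
    refine (isPreconnected_sphere hE 0 1).infinite_of_nontrivial ?_
    obtain ⟨z, hz⟩ := NormedSpace.sphere_nonempty (x := (0 : E)) (r := 1) |>.2 zero_le_one
    refine ⟨z, hz, -z, by simpa using hz, fun h => ?_⟩
    have := IsAddTorsionFree.of_isTorsionFree ℝ E
    have : z = 0 := self_eq_neg.1 h
    rw [this] at hz; simp at hz
  have hfin : {z : E | ∃ (v : V) (h : Pi.single v 1 ∈ R (T : Set (Finset V))), z = φ ⟨_, h⟩}.Finite := by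
    classical
    refine (Set.finite_range (fun v : V => if h : Pi.single v 1 ∈ R (T : Set (Finset V)) then (φ ⟨_, h⟩ : E) else 0)).subset ?_
    rintro z ⟨v, h, rfl⟩
    exact ⟨v, by simp [h]⟩
  obtain ⟨z, hz, hzn⟩ := hinf.exists_notMem_finite hfin
  have hzb : z ∈ Metric.closedBall (0 : E) 1 := Metric.sphere_subset_closedBall hz
  obtain ⟨⟨x, hx⟩, hxz⟩ := φ.surjective ⟨z, hzb⟩
  have h1 : ‖(φ ⟨x, hx⟩ : E)‖ = 1 := by rw [hxz]; simpa using hz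
  obtain ⟨k0, k1, s, hs, k2⟩ := mem_R.1 hx
  have hxs : ∀ v, x ≠ Pi.single v 1 := fun v h => hzn ⟨v, h ▸ hx, by subst h; rw [hxz]⟩
  set S := Finset.univ.filter (fun i => x i ≠ 0) with hS
  have mS : ∀ i, i ∈ S ↔ x i ≠ 0 := fun i => by simp [hS]
  have hSs : S ⊆ s := fun i hi => k2 i ((mS i).1 hi)
  have hxS : x ∈ R {S} := mem_R1.2 ⟨k0, k1, fun i hi => (mS i).2 hi⟩
  have hpos : ∀ i ∈ S, 0 < x i := fun i hi => lt_of_le_of_ne (k0 i) (Ne.symm ((mS i).1 hi))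
  have hle := (Finset.card_le_card hSs).trans (tri s hs).le
  have hne0 : S.Nonempty := by
    by_contra h
    rw [Finset.not_nonempty_iff_eq_empty] at h
    have : ∀ i, x i = 0 := fun i => by by_contra h'; have := (mS i).2 h'; rw [h] at this; simp at this
    simp [this] at k1
  have hne1 : S.card ≠ 1 := fun h => by
    obtain ⟨v, hv⟩ := Finset.card_eq_one.1 h
    exact hxs v (eq_single k1 fun i hi => by have := (mS i).2 hi; rw [hv] at this; simpa using this)
  have := hne0.card_pos
  obtain h | h : S.card = 2 ∨ S.card = 3 := by omega
  · obtain ⟨u, v, huv, hSe⟩ := Finset.card_eq_two.1 h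
    rw [hSe] at hxS hSs hpos
    have hxu := hpos u (by simp)
    have hxv := hpos v (by simp)
    have hdeg : 1 < deg T {u, v} := by
      have h3 := deg_pos hs hSs
      have h4 : deg T {u, v} ≠ 1 := fun h' => hcon _ (mem_Bd.2 ⟨Finset.card_pair huv, h'⟩)
      omega
    obtain ⟨s1, h1', s2, h2, h12⟩ := Finset.one_lt_card.1 hdeg
    rw [Finset.mem_filter] at h1' h2
    obtain ⟨p, hup, hvp, rfl⟩ := third tri huv h1'.1 h1'.2
    obtain ⟨r, hur, hvr, rfl⟩ := third tri huv h2.1 h2.2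
    have hpr : p ≠ r := fun h => h12 (by rw [h])
    obtain ⟨W, ⟨ρ, hρ, hW⟩, k, hk, hke⟩ := bdry_log φ hx h1
      (inter_mem (nhd_pos hxu) (nhd_pos hxv)) (fld_cont x u v p)
      (fun y hy hne => fld_ne tri huv hup hvp hxS hy hne)
    obtain ⟨ε, L, hε, hL, hper, hLW, l1, l2, l3, l4⟩ :=
      edge_loop huv hup hvp hur hvr hpr h1'.1 h2.1 hxS hxu hxv hρ
    refine wind1 ?_ hW hk hke hε hL hper hLW fun θ => fld_loop (l1 θ) (l2 θ) (l3 θ)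
    obtain ⟨k0, k1, k2⟩ := mem_R1.1 hxS
    rw [sum_two huv k2] at k1
    have : x p = 0 := by by_contra h'; have := k2 p h'; simp [hup.symm, hvp.symm] at this
    apply Complex.ext <;> simp [fld, this]; linarith
  · obtain ⟨u, v, p, huv, hup, hvp, hSe⟩ := Finset.card_eq_three.1 h
    have hse : S = s := Finset.eq_of_subset_of_card_le hSs (by rw [h, tri s hs])
    rw [hse] at hSe
    rw [hse, hSe] at hxS hpos
    rw [hSe] at hs
    have hxu := hpos u (by simp)
    have hxv := hpos v (by simp)
    have hxp := hpos p (by simp)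
    let f : (V → ℝ) → ℂ := fun w => ((w u - x u : ℝ) : ℂ) + ((w v - x v : ℝ) : ℂ) * Complex.I
    obtain ⟨W, ⟨ρ, hρ, hW⟩, k, hk, hke⟩ := bdry_log φ hx h1
      (inter_mem (nhd_pos hxu) (inter_mem (nhd_pos hxv) (nhd_pos hxp))) (f := f) (by fun_prop)
      (by
        intro y hy hne h0
        obtain ⟨hyT, hyu, hyv, hyp⟩ := hy
        obtain ⟨h0', h1, t, ht, h2⟩ := mem_R.1 hyT
        have hte := tri_form (tri t ht) huv hup hvp (h2 u (ne_of_gt hyu)) (h2 v (ne_of_gt hyv)) (h2 p (ne_of_gt hyp))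
        rw [hte] at h2
        rw [sum_three huv hup hvp h2] at h1
        obtain ⟨k0, k1, k2⟩ := mem_R1.1 hxS
        rw [sum_three huv hup hvp k2] at k1
        have e1 := congrArg Complex.re h0
        have e2 := congrArg Complex.im h0
        simp [f] at e1 e2
        apply hne
        ext i
        by_cases hi : i = u
        · rw [hi]; linarith
        by_cases hi2 : i = v
        · rw [hi2]; linarith
        by_cases hi3 : i = p
        · rw [hi3]; linarith
        have a1 : x i = 0 := by by_contra h'; have := k2 i h'; simp [hi, hi2, hi3] at this
        have a2 : y i = 0 := by by_contra h'; have := h2 i h'; simp [hi, hi2, hi3] at this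
        rw [a1, a2])
    obtain ⟨ε, L, hε, hL, hper, hLW, l1, l2⟩ := tri_loop huv hup hvp hxS hxu hxv hxp hρ
    refine wind1 (f := f) (by simp [f]) hW hk hke hε hL hper (fun θ => ⟨mem_R_of hs (hLW θ).1, (hLW θ).2⟩) fun θ => ?_
    simp only [f, l1, l2, Complex.exp_mul_I]
    push_cast; ring

end Part15

section Part16
open Set Topology Filter Relation

/-- image of a subset of a subtype -/
noncomputable def imgH {X : Type*} [TopologicalSpace X] (A : Set X) (S : Set A) : S ≃ₜ (Subtype.val '' S : Set X) :=
  IsEmbedding.subtypeVal.homeomorphImage S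

lemma LPt.frozen {K : Geometry.SimplicialComplex ℝ (Pt n)} {x : Pt n} (hx : x ∈ K.space)
    (h : LPt K.space ⟨x, hx⟩) : IsLocallyPlanarPt K x := by
  have key : ∀ S : Set K.space, IsOpen S → (⟨x, hx⟩ : K.space) ∈ S → (Subtype.val '' S : Set (Pt n)) ⊆ K.space ∧
      (Subtype.val '' S : Set (Pt n)) ∈ 𝓝[K.space] x := by
    intro S hS hxS
    refine ⟨by rintro _ ⟨y, _, rfl⟩; exact y.2, ?_⟩
    rw [nhdsWithin_eq_map_subtype_coe hx]
    exact image_mem_map (hS.mem_nhds hxS)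
  refine ⟨hx, ?_⟩
  rcases h with ⟨φ, h⟩ | ⟨φ, h⟩
  · left
    obtain ⟨h1, h2⟩ := key _ φ.open_source h
    exact ⟨_, h1, h2, φ.target, φ.open_target, ⟨(imgH _ _).symm.trans φ.toHomeomorphSourceTarget⟩⟩
  · right
    obtain ⟨h1, h2⟩ := key _ φ.open_source h
    exact ⟨_, h1, h2, φ.target, φ.open_target, ⟨(imgH _ _).symm.trans φ.toHomeomorphSourceTarget⟩⟩

lemma LPt.of_frozen {K : Geometry.SimplicialComplex ℝ (Pt n)} {x : Pt n} (hx : x ∈ K.space)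
    (h : IsLocallyPlanarPt K x) : LPt K.space ⟨x, hx⟩ := by
  have key : ∀ U : Set (Pt n), U ⊆ K.space → U ∈ 𝓝[K.space] x →
      (Subtype.val ⁻¹' U : Set K.space) ∈ 𝓝 (⟨x, hx⟩ : K.space) ∧
      Nonempty ((Subtype.val ⁻¹' U : Set K.space) ≃ₜ U) := by
    intro U hU hn
    refine ⟨by rw [mem_nhds_subtype_iff_nhdsWithin]; simpa [inter_eq_right.2 hU] using hn,
      ⟨(imgH _ _).trans (Homeomorph.setCongr (by simpa using hU))⟩⟩
  rcases h.2 with ⟨U, hU, hn, V, hV, ⟨e⟩⟩ | ⟨U, hU, hn, V, hV, ⟨e⟩⟩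
  · obtain ⟨h1, ⟨e'⟩⟩ := key U hU hn
    exact Or.inl (chart_of_nbhd h1 hV (e'.trans e))
  · obtain ⟨h1, ⟨e'⟩⟩ := key U hU hn
    exact Or.inr (chart_of_nbhd h1 hV (e'.trans e))

lemma lpt_disc0 : LPt (Metric.closedBall (0 : ℂ) 1) ⟨0, by simp⟩ := by
  left
  obtain ⟨φ, hφ⟩ := chart_of_nbhd (X := Metric.closedBall (0 : ℂ) 1) (x := ⟨0, by simp⟩)
    (U := Subtype.val ⁻¹' Metric.ball 0 1)
    ((Metric.isOpen_ball.preimage continuous_subtype_val).mem_nhds (by simp)) (Metric.isOpen_ball)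
    ((imgH _ _).trans (Homeomorph.setCongr (t := Metric.ball (0 : ℂ) 1)
      (by simpa using Metric.ball_subset_closedBall)))
  exact ⟨φ.trans rrC.symm.toOpenPartialHomeomorph, by simpa using hφ⟩

lemma lpt_disc_pos {a : ℝ} (h0 : 0 < a) (h1 : (a : ℂ) ∈ Metric.closedBall (0 : ℂ) 1) :
    LPt (Metric.closedBall (0 : ℂ) 1) ⟨a, h1⟩ := by
  right
  have hb : ∀ z : Metric.closedBall (0 : ℂ) 1, ‖(z : ℂ)‖ ≤ 1 := fun z => mem_closedBall_zero_iff.1 z.2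
  have hmem : ∀ p : HalfPlane, Complex.exp ((-p.1.2 : ℝ) + (p.1.1 : ℝ) * Complex.I) ∈ Metric.closedBall (0 : ℂ) 1 := by
    intro p
    have := mem_hp.1 p.2
    simp [Complex.norm_exp, this]
  refine ⟨{ toFun := fun z => ⟨((Complex.log z).im, -(Complex.log z).re), mem_hp.2 (by
              rw [Complex.log_re]; have := Real.log_nonpos (norm_nonneg _) (hb z); simpa using this)⟩
            invFun := fun p => ⟨_, hmem p⟩
            source := {z | (z : ℂ) ∈ Complex.slitPlane}
            target := {p | p.1.1 ∈ Ioo (-Real.pi) Real.pi}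
            map_source' := fun z hz => by
              have hz' : (z : ℂ) ∈ Complex.slitPlane := hz
              simp only [mem_ofPred_eq, Complex.log_im]
              exact ⟨Complex.neg_pi_lt_arg _, lt_of_le_of_ne (Complex.arg_le_pi _) (Complex.mem_slitPlane_iff_arg.1 hz').1⟩
            map_target' := fun p hp => by
              have hp' : p.1.1 ∈ Ioo (-Real.pi) Real.pi := by simpa using hp
              simp only [mem_ofPred_eq]
              rw [Complex.mem_slitPlane_iff_arg, ← Complex.log_im, Complex.log_exp] <;> simp
              · exact hp'.2.ne
              · exact hp'.1
              · exact hp'.2.le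
            left_inv' := fun z hz => by
              have hz' : (z : ℂ) ∈ Complex.slitPlane := hz
              apply Subtype.ext
              simp only [neg_neg]
              rw [Complex.re_add_im, Complex.exp_log (Complex.slitPlane_ne_zero hz')]
            right_inv' := fun p hp => by
              have hp' : p.1.1 ∈ Ioo (-Real.pi) Real.pi := by simpa using hp
              apply Subtype.ext
              simp only
              rw [Complex.log_exp (by simpa using hp'.1) (by simpa using hp'.2.le)]
              ext <;> simp
            open_source := Complex.isOpen_slitPlane.preimage continuous_subtype_val
            open_target := (isOpen_Ioo.preimage (continuous_fst.comp continuous_subtype_val))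
            continuousOn_toFun := by
              have : ContinuousOn (fun z : Metric.closedBall (0 : ℂ) 1 => Complex.log z) {z | (z : ℂ) ∈ Complex.slitPlane} :=
                fun z hz => ((continuousAt_clog hz).comp continuous_subtype_val.continuousAt).continuousWithinAt
              rw [IsInducing.subtypeVal.continuousOn_iff]
              exact (Complex.continuous_im.comp_continuousOn this).prodMk (Complex.continuous_re.comp_continuousOn this).neg
            continuousOn_invFun := by
              apply Continuous.continuousOn
              apply Continuous.subtype_mk
              fun_prop }, ?_⟩
  show (a : ℂ) ∈ Complex.slitPlane
  simp [Complex.mem_slitPlane_iff, h0]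

lemma lpt_disc (z : Metric.closedBall (0 : ℂ) 1) : LPt (Metric.closedBall (0 : ℂ) 1) z := by
  obtain ⟨z, hz⟩ := z
  by_cases h0 : z = 0
  · subst h0; exact lpt_disc0
  have hn : 0 < ‖z‖ := norm_pos_iff.2 h0
  let c : Circle := ⟨z / ‖z‖, by
    rw [← SetLike.mem_coe, Submonoid.coe_unitSphere]; simp [hn.ne']⟩
  let e : Metric.closedBall (0 : ℂ) 1 ≃ₜ Metric.closedBall (0 : ℂ) 1 :=
    (rotation c).toHomeomorph.subtype (fun w => by simp [Circle.norm_coe])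
  have h := (lpt_disc_pos hn (by simpa using hz)).homeo e
  convert h using 1
  apply Subtype.ext
  show z = rotation c (‖z‖ : ℂ)
  rw [rotation_apply]
  show z = z / ‖z‖ * ‖z‖
  have : (‖z‖ : ℂ) ≠ 0 := by exact_mod_cast hn.ne'
  field_simp

/-- unit discs in `ℂ` and `ℝ²` -/
noncomputable def discC : Metric.closedBall (0 : ℂ) 1 ≃ₜ Metric.closedBall (0 : EuclideanSpace ℝ (Fin 2)) 1 :=
  Complex.orthonormalBasisOneI.repr.toHomeomorph.subtype (fun w => by simp)

lemma IsDisc.homeo {E : Type*} [TopologicalSpace E] {X B : Set E} (h : IsDisc X B) :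
    Nonempty (X ≃ₜ Metric.closedBall (0 : ℂ) 1) := by
  obtain ⟨hX, f, hf, hi, him, -⟩ := h
  have : CompactSpace X := isCompact_iff_compactSpace.1 hX
  have hm : MapsTo f X (Metric.closedBall (0 : ℂ) 1) := him ▸ mapsTo_image f X
  have hb : BijOn f X (Metric.closedBall (0 : ℂ) 1) := ⟨hm, hi, him.symm.subset⟩
  exact ⟨Continuous.homeoOfEquivCompactToT2 (f := hb.equiv f) (hf.mapsToRestrict hm)⟩

end Part16

section Part17
open Set Topology Filter Relation Geometry

lemma combi (K : SimplicialComplex ℝ (Pt n)) (hfin : K.faces.Finite) (hdim : TwoDimensional K)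
    (hne : K.faces.Nonempty) (hL : ∀ x, LPt K.space x) :
    ∃ (m : ℕ) (T : Finset (Finset (Fin m))), Nonempty (Fin m) ∧ (∀ t ∈ T, t.card = 3) ∧
      (∀ x, LPt (R (T : Set (Finset (Fin m)))) x) ∧ (∀ x, ∃ t ∈ T, x ∈ t) ∧
      Nonempty (R (T : Set (Finset (Fin m))) ≃ₜ K.space) ∧
      ((∃ e, IsBoundaryEdge K e) ↔ ∃ e, e ∈ Bd T) ∧
      eulerChar K = (m : ℤ) - (Ed T).card + T.card := by
  classical
  obtain ⟨m, ve, hinj, hran, ⟨Ψ⟩⟩ := exists_model K hfin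
  set C : Set (Finset (Fin m)) := {s | s.image ve ∈ K.faces} with hC
  have mC : ∀ s, s ∈ C ↔ s.image ve ∈ K.faces := fun s => by
    rw [hC, Set.mem_ofPred_eq]
  have hcard : ∀ s : Finset (Fin m), (s.image ve).card = s.card := fun s => Finset.card_image_of_injective s hinj
  have hface : ∀ f ∈ K.faces, ∃ s ∈ C, s.image ve = f := by
    intro f hf
    have h1 : (f : Set (Pt n)) ⊆ ve '' univ := by
      rw [image_univ, hran, SimplicialComplex.vertices_eq]
      exact Set.subset_biUnion_of_mem (u := fun k : Finset (Pt n) => (k : Set (Pt n))) hf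
    obtain ⟨s, -, hs⟩ := Finset.subset_set_image_iff.1 h1
    exact ⟨s, (mC s).2 (hs ▸ hf), hs⟩
  have hsing : ∀ v, {v} ∈ C := fun v => by
    rw [mC, Finset.image_singleton, ← SimplicialComplex.mem_vertices, ← hran]; exact mem_range_self v
  have hC3 : ∀ s ∈ C, s.card ≤ 3 := fun s hs => by rw [← hcard]; exact hdim _ ((mC s).1 hs)
  have hC0 : ∀ s ∈ C, 1 ≤ s.card := fun s hs => by
    rw [← hcard]; exact (K.nonempty_of_mem_faces ((mC s).1 hs)).card_pos
  have hdown : ∀ s ∈ C, ∀ t ⊆ s, t.Nonempty → t ∈ C := fun s hs t hts ht =>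
    (mC t).2 (K.down_closed ((mC s).1 hs) (Finset.image_subset_image hts) (ht.image _))
  have hLC : ∀ x, LPt (R C) x := fun x => by
    have := (hL (Ψ x)).homeo Ψ.symm
    rwa [Ψ.symm_apply_apply] at this
  set T : Finset (Finset (Fin m)) := Finset.univ.filter (fun s => s ∈ C ∧ s.card = 3) with hT
  have mT : ∀ s, s ∈ T ↔ s ∈ C ∧ s.card = 3 := fun s => by simp [hT]
  have p2 : ∀ s ∈ C, 2 ≤ s.card → ∃ t ∈ T, s ⊆ t := by
    intro s hs h2
    obtain h | h : s.card = 3 ∨ s.card = 2 := by have := hC3 s hs; omega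
    · exact ⟨s, (mT s).2 ⟨hs, h⟩, subset_rfl⟩
    · obtain ⟨u, v, huv, rfl⟩ := Finset.card_eq_two.1 h
      obtain ⟨t, ht, hu, hv, h3⟩ := no_free huv hs hLC
      exact ⟨t, (mT t).2 ⟨ht, le_antisymm (hC3 t ht) h3⟩, pair_sub.2 ⟨hu, hv⟩⟩
  have hv : ∀ x, ∃ t ∈ T, x ∈ t := by
    intro x
    obtain ⟨s, hs, hx, h2⟩ := no_iso (hsing x) hLC
    obtain ⟨t, ht, hst⟩ := p2 s hs h2
    exact ⟨t, ht, hst hx⟩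
  have pure : ∀ s ∈ C, ∃ t ∈ T, s ⊆ t := by
    intro s hs
    by_cases h2 : 2 ≤ s.card
    · exact p2 s hs h2
    · obtain ⟨x, rfl⟩ := Finset.card_eq_one.1 (show s.card = 1 by have := hC0 s hs; omega)
      obtain ⟨t, ht, hx⟩ := hv x
      exact ⟨t, ht, by simpa using hx⟩
  have hR : R C = R (T : Set (Finset (Fin m))) := Subset.antisymm (R_refine fun s hs => pure s hs)
    (R_refine fun s hs => ⟨s, ((mT s).1 hs).1, subset_rfl⟩)
  have mE : ∀ e, e ∈ Ed T ↔ e ∈ C ∧ e.card = 2 := by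
    intro e
    rw [mem_Ed]
    constructor
    · rintro ⟨h2, t, ht, het⟩
      exact ⟨hdown t ((mT t).1 ht).1 e het (Finset.card_pos.1 (by omega)), h2⟩
    · rintro ⟨h, h2⟩; exact ⟨h2, pure e h⟩
  have himj : Function.Injective (Finset.image ve) := Finset.image_injective hinj
  have hcount : ∀ (k : ℕ) (S : Finset (Finset (Fin m))), (∀ s, s ∈ S ↔ s ∈ C ∧ s.card = k) →
      {f : Finset (Pt n) | f ∈ K.faces ∧ f.card = k}.ncard = S.card := by
    intro k S hS
    rw [← Set.ncard_coe_finset, ← Set.ncard_image_of_injective _ himj]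
    congr 1
    ext f
    simp only [Set.mem_ofPred_eq, Set.mem_image, Finset.mem_coe, hS]
    constructor
    · rintro ⟨hf, hk⟩
      obtain ⟨s, hs, rfl⟩ := hface f hf
      exact ⟨s, ⟨hs, by rw [← hcard]; exact hk⟩, rfl⟩
    · rintro ⟨s, ⟨hs, hk⟩, rfl⟩
      exact ⟨(mC s).1 hs, by rw [hcard]; exact hk⟩
  have hdeg : ∀ e : Finset (Fin m), (trianglesContaining K (e.image ve)).ncard = deg T e := by
    intro e
    unfold deg
    rw [← Set.ncard_coe_finset, ← Set.ncard_image_of_injective _ himj]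
    congr 1
    ext f
    simp only [trianglesContaining, Set.mem_ofPred_eq, Set.mem_image, Finset.mem_coe, Finset.mem_filter, mT]
    constructor
    · rintro ⟨hf, hk, he⟩
      obtain ⟨s, hs, rfl⟩ := hface f hf
      exact ⟨s, ⟨⟨hs, by rw [← hcard]; exact hk⟩, (Finset.image_subset_image_iff hinj).1 he⟩, rfl⟩
    · rintro ⟨s, ⟨⟨hs, hk⟩, he⟩, rfl⟩
      exact ⟨(mC s).1 hs, by rw [hcard]; exact hk, Finset.image_subset_image he⟩
  refine ⟨m, T, ?_, fun t ht => ((mT t).1 ht).2, by rw [← hR]; exact hLC, hv,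
    ⟨(Homeomorph.setCongr hR.symm).trans Ψ⟩, ⟨?_, ?_⟩, ?_⟩
  · obtain ⟨f, hf⟩ := hne
    obtain ⟨s, hs, -⟩ := hface f hf
    obtain ⟨x, -⟩ := Finset.card_pos.1 (hC0 s hs)
    exact ⟨x⟩
  · rintro ⟨f, hf, h2, h1⟩
    obtain ⟨s, hs, rfl⟩ := hface f hf
    exact ⟨s, mem_Bd.2 ⟨by rw [← hcard]; exact h2, by rw [← hdeg]; exact h1⟩⟩
  · rintro ⟨e, he⟩
    obtain ⟨s, hs, hes⟩ := Bd_ex he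
    rw [mem_Bd] at he
    have heC := ((mE e).1 (mem_Ed.2 ⟨he.1, s, hs, hes⟩)).1
    exact ⟨e.image ve, (mC e).1 heC, by rw [hcard]; exact he.1, by rw [hdeg]; exact he.2⟩
  · have hvn : K.vertices.ncard = m := by
      rw [← hran, ← image_univ, Set.ncard_image_of_injective _ hinj, Set.ncard_univ, Nat.card_eq_fintype_card, Fintype.card_fin]
    unfold eulerChar
    rw [hvn, hcount 2 (Ed T) mE, hcount 3 T mT]

end Part17
open Geometry
theorem homeo_disk_iff (K : SimplicialComplex ℝ (Pt n)) (hfin : K.faces.Finite)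
    (hdim : TwoDimensional K) (hne : K.faces.Nonempty) :
    Nonempty (↥K.space ≃ₜ ↥(Metric.closedBall (0 : EuclideanSpace ℝ (Fin 2)) 1)) ↔
      (IsConnected K.space ∧ LocallyPlanar K ∧ (∃ e, IsBoundaryEdge K e) ∧ eulerChar K = 1) := by
  constructor
  · rintro ⟨φ⟩
    have hL : ∀ x, LPt K.space x := fun x => by
      have := (lpt_disc (discC.symm (φ x))).homeo (discC.trans φ.symm)
      simpa using this
    have hcon : IsConnected K.space := by
      have : ConnectedSpace (Metric.closedBall (0 : EuclideanSpace ℝ (Fin 2)) 1) :=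
        isConnected_iff_connectedSpace.1 (((convex_closedBall _ _).isConnected (by simp)))
      exact isConnected_iff_connectedSpace.2 (φ.symm.surjective.connectedSpace φ.symm.continuous)
    obtain ⟨m, T, hm, tri, hLT, hv, ⟨Ψ⟩, hbd, hχ⟩ := combi K hfin hdim hne hL
    have hrank : 1 < Module.rank ℝ (EuclideanSpace ℝ (Fin 2)) := by
      rw [← Module.finrank_eq_rank]; simp
    have bd := bd_exists tri hrank (Ψ.trans φ)
    have hcT : IsPreconnected (R (T : Set (Finset (Fin m)))) := by
      have : ConnectedSpace K.space := isConnected_iff_connectedSpace.1 hcon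
      exact (isConnected_iff_connectedSpace.2 (Ψ.symm.surjective.connectedSpace Ψ.symm.continuous)).isPreconnected
    have h1 := (euler_mod2 tri (fun e he => deg_le_two tri hLT he)
      (fun s hs t ht => glob_conn tri hLT hcT hs ht) bd hv).1
    have h2 := euler_ge_of_log tri (Ψ.trans φ)
    rw [Fintype.card_fin] at h1 h2
    exact ⟨hcon, fun x hx => (hL ⟨x, hx⟩).frozen hx, hbd.2 bd, by rw [hχ]; omega⟩
  · rintro ⟨hcon, hlp, hb, hχ1⟩
    obtain ⟨m, T, hm, tri, hLT, hv, ⟨Ψ⟩, hbd, hχ⟩ := combi K hfin hdim hne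
      (fun x => LPt.of_frozen x.2 (hlp x x.2))
    have hcT : IsPreconnected (R (T : Set (Finset (Fin m)))) := by
      have : ConnectedSpace K.space := isConnected_iff_connectedSpace.1 hcon
      exact (isConnected_iff_connectedSpace.2 (Ψ.symm.surjective.connectedSpace Ψ.symm.continuous)).isPreconnected
    have bd := hbd.1 hb
    have deg2 : ∀ e : Finset (Fin m), e.card = 2 → deg T e ≤ 2 := fun e he => deg_le_two tri hLT he
    have conn0 : ∀ s ∈ T, ∀ t ∈ T, Relation.ReflTransGen (Rel T ∅) s t := fun s hs t ht => glob_conn tri hLT hcT hs ht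
    have hG : Good T := {
      tri := tri
      deg2 := deg2
      conn := by
        intro A hA s hs t ht hAs hAt
        rcases Nat.lt_or_ge 0 A.card with h | h
        · obtain ⟨v, rfl⟩ := Finset.card_eq_one.1 (show A.card = 1 by omega)
          exact link_conn tri hLT hs ht (by simpa using hAs) (by simpa using hAt)
        · rw [Finset.card_eq_zero.1 (Nat.le_zero.1 h)]; exact conn0 s hs t ht
      bd := bd
      coh := (euler_mod2 tri deg2 conn0 bd hv).2 (by rw [Fintype.card_fin]; rw [hχ] at hχ1; omega) }
    obtain ⟨ψ⟩ := (good_disc _ T rfl hG).homeo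
    exact ⟨(Ψ.symm.trans ψ).trans discC⟩

end PaperAlg
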